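/- If G is a connected subcubic graph of girth at least 5 that is isomorphic to neither H₁ nor H₂, then ν_ur(G) ≥ (n(G) − 1)/3. -/

import Mathlib

open SimpleGraph

namespace URPaper

/-- `M` is a matching in the simple graph `G`: a finite set of edges of `G`
that are pairwise vertex-disjoint. -/
def IsMatchingSet {V : Type*} (G : SimpleGraph V) (M : Finset (Sym2 V)) : Prop :=
  (∀ e ∈ M, e ∈ G.edgeSet) ∧
    ∀ e ∈ M, ∀ f ∈ M, e ≠ f → ∀ v : V, v ∈ e → v ∉ f

/-- The set of vertices covered by a set of edges. -/
def covered {V : Type*} (M : Finset (Sym2 V)) : Set V := {v | ∃ e ∈ M, v ∈ e}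

/-- A matching `M` in `G` is uniquely restricted if no other matching of `G`
covers exactly the same set of vertices. -/
def IsURMatching {V : Type*} (G : SimpleGraph V) (M : Finset (Sym2 V)) : Prop :=
  IsMatchingSet G M ∧
    ∀ M' : Finset (Sym2 V), IsMatchingSet G M' → covered M' = covered M → M' = M

/-- The matching number `ν(G)`: the maximum size of a matching in `G`. -/
noncomputable def nu {V : Type*} (G : SimpleGraph V) : ℕ :=
  sSup {k | ∃ M : Finset (Sym2 V), IsMatchingSet G M ∧ M.card = k}

/-- The uniquely restricted matching number `ν_ur(G)`: the maximum size of a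
uniquely restricted matching in `G`. -/
noncomputable def nuUR {V : Type*} (G : SimpleGraph V) : ℕ :=
  sSup {k | ∃ M : Finset (Sym2 V), IsURMatching G M ∧ M.card = k}

/-- `D_G`: the set of vertices missed by at least one maximum matching of `G`. -/
def gallaiD {V : Type*} (G : SimpleGraph V) : Set V :=
  {v | ∃ M : Finset (Sym2 V), IsMatchingSet G M ∧ M.card = nu G ∧ v ∉ covered M}

/-- `A_G`: the set of vertices outside `D_G` having a neighbor in `D_G`. -/
def gallaiA {V : Type*} (G : SimpleGraph V) : Set V :=
  {v | v ∉ gallaiD G ∧ ∃ u ∈ gallaiD G, G.Adj v u}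

/-- `C_G = V(G) \ (A_G ∪ D_G)`. -/
def gallaiC {V : Type*} (G : SimpleGraph V) : Set V :=
  {v | v ∉ gallaiD G ∧ v ∉ gallaiA G}

/-- Membership in the family `𝒯`: trees `T` with `ν(T) = (n(T) - 1)/3`
(equivalently `3 ν(T) + 1 = n(T)`) such that every vertex of `A_T` has degree
at most `3` in `T`. -/
def MemT {V : Type*} (T : SimpleGraph V) : Prop :=
  T.IsTree ∧ (∀ v ∈ gallaiA T, (T.neighborSet v).ncard ≤ 3) ∧
    3 * nu T + 1 = Nat.card V

/-- The graph obtained from `T` by contracting the set `S` to a single new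
vertex (the vertex `none`), all other vertices being kept. -/
def contractSet {V : Type*} (T : SimpleGraph V) (S : Set V) :
    SimpleGraph (Option {x : V // x ∉ S}) where
  Adj a b :=
    match a, b with
    | some x, some y => T.Adj x y
    | some x, none => ∃ u ∈ S, T.Adj (x : V) u
    | none, some y => ∃ u ∈ S, T.Adj (y : V) u
    | none, none => False
  symm := by
    refine ⟨?_⟩
    rintro (_ | x) (_ | y) h
    · exact h
    · exact h
    · exact h
    · exact T.adj_symm h
  loopless := by
    refine ⟨?_⟩
    rintro (_ | x) h
    · exact h
    · exact T.irrefl h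

/-- The graph `BG1` from the paper, given by an explicit edge list. -/
def BG1 : SimpleGraph (Fin 10) :=
  SimpleGraph.fromEdgeSet {s(0,4), s(1,4), s(0,5), s(2,5), s(0,6), s(3,6), s(1,7), s(2,7), s(1,8), s(3,8), s(2,9), s(3,9)}

/-- The graph `BG2` from the paper, given by an explicit edge list. -/
def BG2 : SimpleGraph (Fin 13) :=
  SimpleGraph.fromEdgeSet {s(0,4), s(1,4), s(0,5), s(2,5), s(0,6), s(3,6), s(1,7), s(2,7), s(1,8), s(3,8), s(2,9), s(3,9), s(10,6), s(10,7), s(11,8), s(11,5), s(12,4), s(12,9)}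

/-- The graph `BG3` from the paper, given by an explicit edge list. -/
def BG3 : SimpleGraph (Fin 16) :=
  SimpleGraph.fromEdgeSet {s(0,1), s(1,2), s(2,3), s(3,4), s(4,5), s(5,0), s(6,7), s(7,8), s(8,9), s(9,10), s(10,11), s(11,6), s(12,0), s(12,6), s(13,2), s(13,8), s(14,4), s(14,10), s(15,12), s(15,13), s(15,14)}

/-- The graph `BG4` from the paper, given by an explicit edge list. -/
def BG4 : SimpleGraph (Fin 19) :=
  SimpleGraph.fromEdgeSet {s(0,1), s(1,2), s(2,3), s(3,4), s(4,5), s(5,0), s(6,7), s(7,8), s(8,9), s(9,10), s(10,11), s(11,6), s(12,0), s(13,1), s(14,2), s(15,3), s(16,4), s(17,5), s(12,6), s(13,7), s(14,8), s(15,9), s(16,10), s(17,11), s(18,12), s(18,14), s(18,16)}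

/-- The graph `BG5` from the paper, given by an explicit edge list. -/
def BG5 : SimpleGraph (Fin 16) :=
  SimpleGraph.fromEdgeSet {s(0,4), s(1,4), s(0,5), s(2,5), s(0,6), s(3,6), s(1,7), s(2,7), s(1,8), s(3,8), s(2,9), s(3,9), s(10,6), s(10,7), s(11,8), s(11,5), s(12,4), s(12,9), s(13,14), s(14,15), s(13,10), s(13,11), s(15,12)}

/-- The graph `BG6` from the paper, given by an explicit edge list. -/
def BG6 : SimpleGraph (Fin 19) :=
  SimpleGraph.fromEdgeSet {s(0,4), s(1,4), s(0,5), s(2,5), s(0,6), s(3,6), s(1,7), s(2,7), s(1,8), s(3,8), s(2,9), s(3,9), s(10,6), s(10,7), s(11,8), s(11,5), s(12,4), s(12,9), s(13,14), s(14,15), s(15,16), s(16,17), s(17,18), s(18,13), s(13,10), s(15,11), s(17,12)}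

/-- The graph `BG7` from the paper, given by an explicit edge list. -/
def BG7 : SimpleGraph (Fin 19) :=
  SimpleGraph.fromEdgeSet {s(0,1), s(1,2), s(2,3), s(3,4), s(4,5), s(5,0), s(6,7), s(7,8), s(8,9), s(9,10), s(10,11), s(11,6), s(12,0), s(12,6), s(13,2), s(13,8), s(14,4), s(14,10), s(15,12), s(15,13), s(15,14), s(17,16), s(16,18), s(17,9), s(17,5), s(18,3), s(18,11)}

/-- The graph `BG8` from the paper, given by an explicit edge list. -/
def BG8 : SimpleGraph (Fin 22) :=
  SimpleGraph.fromEdgeSet {s(0,1), s(1,2), s(2,3), s(3,4), s(4,5), s(5,0), s(6,7), s(7,8), s(8,9), s(9,10), s(10,11), s(11,6), s(12,0), s(13,1), s(14,2), s(15,3), s(16,4), s(17,5), s(12,6), s(13,7), s(14,8), s(15,9), s(16,10), s(17,11), s(18,12), s(18,14), s(18,16), s(19,20), s(20,21), s(19,13), s(19,15), s(21,17)}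

/-- The graph `BG9` from the paper, given by an explicit edge list. -/
def BG9 : SimpleGraph (Fin 25) :=
  SimpleGraph.fromEdgeSet {s(0,1), s(1,2), s(2,3), s(3,4), s(4,5), s(5,0), s(6,7), s(7,8), s(8,9), s(9,10), s(10,11), s(11,6), s(12,0), s(13,1), s(14,2), s(15,3), s(16,4), s(17,5), s(12,6), s(13,7), s(14,8), s(15,9), s(16,10), s(17,11), s(18,12), s(18,14), s(18,16), s(19,20), s(20,21), s(21,22), s(22,23), s(23,24), s(24,19), s(19,13), s(21,15), s(23,17)}

/-- The graph `GraphH1` from the paper, given by an explicit edge list. -/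
def GraphH1 : SimpleGraph (Fin 14) :=
  SimpleGraph.fromEdgeSet {s(0,4), s(1,4), s(0,5), s(2,5), s(0,6), s(3,6), s(1,7), s(2,7), s(1,8), s(3,8), s(2,9), s(3,9), s(10,6), s(10,7), s(11,8), s(11,5), s(12,4), s(12,9), s(13,10), s(13,11), s(13,12)}

/-- The graph `GraphH2` from the paper, given by an explicit edge list. -/
def GraphH2 : SimpleGraph (Fin 20) :=
  SimpleGraph.fromEdgeSet {s(0,1), s(1,2), s(2,3), s(3,4), s(4,5), s(5,0), s(6,7), s(7,8), s(8,9), s(9,10), s(10,11), s(11,6), s(12,0), s(13,1), s(14,2), s(15,3), s(16,4), s(17,5), s(12,6), s(13,7), s(14,8), s(15,9), s(16,10), s(17,11), s(18,12), s(18,14), s(18,16), s(19,13), s(19,15), s(19,17)}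

/-- Membership in the family `ℬ = {G₁, …, G₉}`, up to isomorphism. -/
def IsBlockB : ∀ (X : Type), SimpleGraph X → Prop := fun _ H =>
  Nonempty (H ≃g BG1) ∨ Nonempty (H ≃g BG2) ∨ Nonempty (H ≃g BG3) ∨
  Nonempty (H ≃g BG4) ∨ Nonempty (H ≃g BG5) ∨ Nonempty (H ≃g BG6) ∨
  Nonempty (H ≃g BG7) ∨ Nonempty (H ≃g BG8) ∨ Nonempty (H ≃g BG9)

/-- Membership in the family `ℬ_c = {G₁, G₂, G₃, G₄}`, up to isomorphism. -/
def IsBlockBc : ∀ (X : Type), SimpleGraph X → Prop := fun _ H =>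
  Nonempty (H ≃g BG1) ∨ Nonempty (H ≃g BG2) ∨ Nonempty (H ≃g BG3) ∨ Nonempty (H ≃g BG4)

/-- `G` (on vertex set `W`) arises from the tree `T` (on vertex set `V`) by
replacing every vertex of `S` by a graph from the family `𝓑`.  The map `π`
sends every vertex of `G` to the vertex of `T` it corresponds to:
* every fiber over a vertex outside `S` is a single vertex, and on these
  vertices `π` is an isomorphism with the corresponding induced subgraph of `T`;
* the fiber over a vertex `s ∈ S` induces a graph of the family `𝓑`;
* there are no edges between the fibers of two distinct vertices of `S`;
* for `s ∈ S` and `v ∉ S`, there is exactly one edge of `G` between the two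
  fibers if `sv ∈ E(T)` and none otherwise;
* each vertex of a fiber over `s ∈ S` has at most one neighbor outside this
  fiber (distinct attachment vertices), and a vertex of such a fiber having a
  neighbor outside the fiber has exactly two neighbors inside it
  (attachment only at vertices of degree `2` of the replacing graph). -/
def ArisesFrom (𝓑 : ∀ (X : Type), SimpleGraph X → Prop) {W V : Type}
    (G : SimpleGraph W) (T : SimpleGraph V) (S : Set V) (π : W → V) : Prop :=
  Function.Surjective π ∧
  (∀ v ∉ S, ∀ w w' : W, π w = v → π w' = v → w = w') ∧
  (∀ w w' : W, π w ∉ S → π w' ∉ S → (G.Adj w w' ↔ T.Adj (π w) (π w'))) ∧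
  (∀ s ∈ S, 𝓑 _ (G.induce (π ⁻¹' {s}))) ∧
  (∀ s ∈ S, ∀ s' ∈ S, s ≠ s' → ∀ w w' : W, π w = s → π w' = s' → ¬ G.Adj w w') ∧
  (∀ s ∈ S, ∀ v ∉ S, T.Adj s v →
    ∃! p : W × W, π p.1 = s ∧ π p.2 = v ∧ G.Adj p.1 p.2) ∧
  (∀ s ∈ S, ∀ v ∉ S, ¬ T.Adj s v →
    ∀ w w' : W, π w = s → π w' = v → ¬ G.Adj w w') ∧
  (∀ s ∈ S, ∀ w : W, π w = s → ∀ w₁ w₂ : W, π w₁ ≠ s → π w₂ ≠ s →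
    G.Adj w w₁ → G.Adj w w₂ → w₁ = w₂) ∧
  (∀ s ∈ S, ∀ w : W, π w = s → ∀ w' : W, π w' ≠ s → G.Adj w w' →
    (G.neighborSet w ∩ π ⁻¹' {s}).ncard = 2)

/-- Membership in the family `𝒢`: graphs arising from a tree `T ∈ 𝒯` by
replacing each vertex of a subset `S ⊆ D_T` by a graph of the family `ℬ`. -/
def InCalG {W : Type} (G : SimpleGraph W) : Prop :=
  ∃ (V : Type) (T : SimpleGraph V) (S : Set V) (π : W → V),
    Finite V ∧ MemT T ∧ S ⊆ gallaiD T ∧ ArisesFrom IsBlockB G T S π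

/-- `κ_G(P)`: the number of connected components of `G` whose induced graph
satisfies the (isomorphism invariant) predicate `P`. -/
noncomputable def kappa {W : Type} (G : SimpleGraph W)
    (P : ∀ (X : Type), SimpleGraph X → Prop) : ℕ :=
  Nat.card {c : G.ConnectedComponent // P _ (G.induce c.supp)}

/-- Membership in `𝒢₃`: cubic graphs of girth at least `5`. -/
def IsCubicGirth5 : ∀ (X : Type), SimpleGraph X → Prop := fun _ H =>
  (∀ v, (H.neighborSet v).ncard = 3) ∧ 5 ≤ H.egirth

/-- Being isomorphic to `H₁` or `H₂`. -/
def IsH1orH2 : ∀ (X : Type), SimpleGraph X → Prop := fun _ H =>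
  Nonempty (H ≃g GraphH1) ∨ Nonempty (H ≃g GraphH2)

end URPaper

open SimpleGraph
namespace URPaper
section
set_option linter.unusedSectionVars false
set_option linter.unusedVariables false

lemma FM {α : Type} [DecidableEq α] : (∀ {a b : α} {s : Finset α}, a ∈ insert b s ↔ a = b ∨ a ∈ s) ∧
    (∀ {a : α} {s t : Finset α}, a ∈ s ∪ t ↔ a ∈ s ∨ a ∈ t) ∧ (∀ {a b : α} {s : Finset α}, a ∈ s.erase b ↔ a ≠ b ∧ a ∈ s) ∧
    (∀ {a : α} {s t : Finset α}, a ∈ s \ t ↔ a ∈ s ∧ a ∉ t) ∧ (∀ {a b : α}, a ∈ ({b} : Finset α) ↔ a = b) :=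
  ⟨Finset.mem_insert, Finset.mem_union, Finset.mem_erase, Finset.mem_sdiff, Finset.mem_singleton⟩

lemma NL {α : Type} : (∀ {a : α} {l : List α}, (a :: l).Nodup ↔ a ∉ l ∧ l.Nodup) ∧ (∀ {a b : α} {l : List α}, a ∈ b :: l ↔ a = b ∨ a ∈ l) ∧
    (∀ a : α, a ∉ ([] : List α)) ∧ ([] : List α).Nodup := by simp
variable {V : Type} [Fintype V] [DecidableEq V] (G : SimpleGraph V)

def U (S : Finset V) (k : ℕ) : Prop :=
  ∃ M : Finset (Sym2 V), IsURMatching G M ∧ (∀ v ∈ covered M, v ∈ S) ∧ M.card = k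

variable {G}

lemma cov_card {M : Finset (Sym2 V)} (hM : IsMatchingSet G M) :
    ((Finset.univ.filter (fun v => ∃ e ∈ M, v ∈ e)).card) = 2 * M.card := by
  classical
  have h : (Finset.univ.filter (fun v => ∃ e ∈ M, v ∈ e)) = M.biUnion (fun e => e.toFinset) := by
    ext v; simp
  rw [h, Finset.card_biUnion]
  · rw [Finset.sum_const_nat (m := 2)]
    · ring
    · intro e he
      exact Sym2.card_toFinset_of_not_isDiag e (G.not_isDiag_of_mem_edgeSet (hM.1 e he))
  · intro e he f hf hef
    refine Finset.disjoint_left.2 ?_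
    intro v hv hv'
    simp at hv hv'
    exact hM.2 e he f hf hef v hv hv'

lemma U.empty : U G ∅ 0 := by
  refine ⟨∅, ⟨⟨by simp, by simp⟩, ?_⟩, by simp [covered], rfl⟩
  intro M' hM' hc
  rw [Finset.eq_empty_iff_forall_notMem]
  intro e he
  induction e using Sym2.ind with
  | _ a b =>
    have : a ∈ covered M' := ⟨_, he, by simp⟩
    rw [hc] at this
    simp [covered] at this

lemma U.mono {S T : Finset V} {k : ℕ} (h : U G S k) (hST : S ⊆ T) : U G T k := by
  obtain ⟨M, h1, h2, h3⟩ := h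
  exact ⟨M, h1, fun v hv => hST (h2 v hv), h3⟩

lemma sub_matching {M N : Finset (Sym2 V)} (h : IsMatchingSet G M) (hN : N ⊆ M) :
    IsMatchingSet G N :=
  ⟨fun e he => h.1 e (hN he), fun e he f hf => h.2 e (hN he) f (hN hf)⟩

lemma U.leaf {S : Finset V} {k : ℕ} (h : U G S k) {u v : V} (hu : u ∉ S) (hv : v ∉ S)
    (huv : G.Adj u v) (hn : ∀ z ∈ S, ¬ G.Adj u z) : U G (insert u (insert v S)) (k+1) := by
  obtain ⟨M, ⟨⟨hm1, hm2⟩, hur⟩, hs, hk⟩ := h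
  have hcu : ∀ e ∈ M, u ∉ e := fun e he hue => hu (hs u ⟨e, he, hue⟩)
  have hcv : ∀ e ∈ M, v ∉ e := fun e he hue => hv (hs v ⟨e, he, hue⟩)
  have hnot : s(u,v) ∉ M := fun h => hcu _ h (by simp)
  refine ⟨insert s(u,v) M, ⟨⟨?_, ?_⟩, ?_⟩, ?_, ?_⟩
  · intro e he
    rcases Finset.mem_insert.1 he with rfl | he
    · exact huv
    · exact hm1 e he
  · intro e he f hf hef w hwe hwf
    rcases Finset.mem_insert.1 he with rfl | he' <;> rcases Finset.mem_insert.1 hf with rfl | hf'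
    · exact hef rfl
    · rcases Sym2.mem_iff.1 hwe with rfl | rfl
      · exact hcu f hf' hwf
      · exact hcv f hf' hwf
    · rcases Sym2.mem_iff.1 hwf with rfl | rfl
      · exact hcu e he' hwe
      · exact hcv e he' hwe
    · exact hm2 e he' f hf' hef w hwe hwf
  · intro M' hM' hc
    have hcc : ∀ w, (∃ e ∈ M', w ∈ e) ↔ (w = u ∨ w = v ∨ ∃ e ∈ M, w ∈ e) := by
      intro w
      have := Set.ext_iff.1 hc w
      simp only [covered, Set.mem_ofPred_eq, Finset.mem_insert, exists_eq_or_imp, Sym2.mem_iff] at this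
      rw [this]; tauto
    obtain ⟨e, he, hue⟩ := (hcc u).2 (Or.inl rfl)
    obtain ⟨z, rfl⟩ := Sym2.mem_iff_exists.1 hue
    have hadj : G.Adj u z := hM'.1 _ he
    have hz : z = v := by
      rcases (hcc z).1 ⟨_, he, by simp⟩ with h | h | h
      · exact absurd h.symm hadj.ne
      · exact h
      · exact absurd hadj (hn z (hs z h))
    subst hz
    have hMe : M'.erase s(u,z) = M := by
      apply hur _ (sub_matching hM' (Finset.erase_subset _ _))
      ext w
      simp only [covered, Set.mem_ofPred_eq, Finset.mem_erase]
      constructor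
      · rintro ⟨f, ⟨hne, hf⟩, hw⟩
        rcases (hcc w).1 ⟨f, hf, hw⟩ with h | h | h
        · subst h; exact absurd (by simp) (hM'.2 f hf _ he hne w hw)
        · subst h; exact absurd (by simp) (hM'.2 f hf _ he hne w hw)
        · exact h
      · rintro ⟨f, hf, hw⟩
        obtain ⟨g, hg, hwg⟩ := (hcc w).2 (Or.inr (Or.inr ⟨f, hf, hw⟩))
        refine ⟨g, ⟨?_, hg⟩, hwg⟩
        rintro rfl
        rcases Sym2.mem_iff.1 hwg with rfl | rfl
        · exact hcu f hf hw
        · exact hcv f hf hw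
    rw [← hMe, Finset.insert_erase he]
  · rintro w ⟨e, he, hw⟩
    rcases Finset.mem_insert.1 he with rfl | he
    · rcases Sym2.mem_iff.1 hw with rfl | rfl <;> simp
    · have := hs w ⟨e, he, hw⟩; simp [this]
  · rw [Finset.card_insert_of_notMem hnot, hk]

lemma union_aux {S T : Finset V} (hd : Disjoint S T) {x : V}
    (hx : ∀ s ∈ S, ∀ t ∈ T, G.Adj s t → s = x ∨ t = x)
    {M N M' : Finset (Sym2 V)} (hM : IsMatchingSet G M) (hM' : IsMatchingSet G M')
    (hMS : ∀ v, (∃ e ∈ M, v ∈ e) → v ∈ S) (hNT : ∀ v, (∃ e ∈ N, v ∈ e) → v ∈ T)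
    (hc : ∀ w, (∃ e ∈ M', w ∈ e) ↔ ((∃ e ∈ M, w ∈ e) ∨ ∃ e ∈ N, w ∈ e))
    {s t : V} (hs : s ∈ S) (ht : t ∈ T) : s(s,t) ∉ M' := by
  intro hst
  have hadj : G.Adj s t := hM'.1 _ hst
  have hxe : x ∈ s(s,t) := by
    rcases hx s hs t ht hadj with rfl | rfl <;> simp
  have huniq : ∀ a ∈ S, ∀ b ∈ T, s(a,b) ∈ M' → s(a,b) = s(s,t) := by
    intro a ha b hb hab
    by_contra hne
    have hxe' : x ∈ s(a,b) := by
      rcases hx a ha b hb (hM'.1 _ hab) with rfl | rfl <;> simp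
    exact hM'.2 _ hab _ hst hne x hxe' hxe
  let P := M'.filter (fun e => ∀ v ∈ e, v ∈ S)
  have hP : IsMatchingSet G P := sub_matching hM' (Finset.filter_subset _ _)
  have h1 := cov_card hM
  have h2 := cov_card hP
  have hTS : ∀ a ∈ S, a ∉ T := fun a ha hb => Finset.disjoint_left.1 hd ha hb
  have hsM : ∃ e ∈ M, s ∈ e := by
    rcases (hc s).1 ⟨_, hst, by simp⟩ with h | h
    · exact h
    · exact absurd (hNT s h) (hTS s hs)
  have h3 : (Finset.univ.filter (fun v => ∃ e ∈ P, v ∈ e)) =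
      (Finset.univ.filter (fun v => ∃ e ∈ M, v ∈ e)).erase s := by
    ext w
    simp only [P, Finset.mem_filter, Finset.mem_univ, true_and, Finset.mem_erase]
    constructor
    · rintro ⟨e, ⟨he, heS⟩, hw⟩
      constructor
      · rintro rfl
        have : e ≠ s(w,t) := by
          rintro rfl
          exact hTS t (heS t (by simp)) ht
        exact hM'.2 e he _ hst this w hw (by simp)
      · rcases (hc w).1 ⟨e, he, hw⟩ with h | h
        · exact h
        · exact absurd (hNT w h) (hTS w (heS w hw))
    · rintro ⟨hws, hw⟩
      have hwS := hMS w hw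
      obtain ⟨e, he, hwe⟩ := (hc w).2 (Or.inl hw)
      refine ⟨e, ⟨he, ?_⟩, hwe⟩
      obtain ⟨z, rfl⟩ := Sym2.mem_iff_exists.1 hwe
      intro v hv
      rcases Sym2.mem_iff.1 hv with rfl | rfl
      · exact hwS
      · rcases (hc v).1 ⟨_, he, by simp⟩ with h | h
        · exact hMS v h
        · exfalso
          have h5 := huniq w hwS v (hNT v h) he
          have : w ∈ s(s,t) := h5 ▸ (by simp)
          rcases Sym2.mem_iff.1 this with rfl | rfl
          · exact hws rfl
          · exact hTS w hwS ht
  rw [h3, Finset.card_erase_of_mem (by simp [hsM]), h1] at h2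
  have : 0 < M.card := by
    obtain ⟨e, he, _⟩ := hsM
    exact Finset.card_pos.2 ⟨e, he⟩
  omega

lemma U.union {S T : Finset V} {k l : ℕ} (hS : U G S k) (hT : U G T l) (hd : Disjoint S T)
    (x : V) (hx : ∀ s ∈ S, ∀ t ∈ T, G.Adj s t → s = x ∨ t = x) : U G (S ∪ T) (k + l) := by
  obtain ⟨M, ⟨hM, hMu⟩, hMS, hk⟩ := hS
  obtain ⟨N, ⟨hN, hNu⟩, hNT, hl⟩ := hT
  have hTS : ∀ a ∈ S, a ∉ T := fun a ha hb => Finset.disjoint_left.1 hd ha hb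
  have hMN : Disjoint M N := by
    rw [Finset.disjoint_left]
    intro e he hf
    induction e using Sym2.ind with
    | _ a b => exact hTS a (hMS a ⟨_, he, by simp⟩) (hNT a ⟨_, hf, by simp⟩)
  refine ⟨M ∪ N, ⟨⟨?_, ?_⟩, ?_⟩, ?_, ?_⟩
  · intro e he
    rcases Finset.mem_union.1 he with h | h
    · exact hM.1 e h
    · exact hN.1 e h
  · intro e he f hf hef v hve hvf
    rcases Finset.mem_union.1 he with h | h <;> rcases Finset.mem_union.1 hf with h' | h'
    · exact hM.2 e h f h' hef v hve hvf
    · exact hTS v (hMS v ⟨_, h, hve⟩) (hNT v ⟨_, h', hvf⟩)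
    · exact hTS v (hMS v ⟨_, h', hvf⟩) (hNT v ⟨_, h, hve⟩)
    · exact hN.2 e h f h' hef v hve hvf
  · intro M' hM' hc
    have hcc : ∀ w, (∃ e ∈ M', w ∈ e) ↔ ((∃ e ∈ M, w ∈ e) ∨ ∃ e ∈ N, w ∈ e) := by
      intro w
      have := Set.ext_iff.1 hc w
      simp only [covered, Set.mem_ofPred_eq, Finset.mem_union] at this
      rw [this]
      constructor
      · rintro ⟨e, h | h, hw⟩
        · exact Or.inl ⟨e, h, hw⟩
        · exact Or.inr ⟨e, h, hw⟩
      · rintro (⟨e, h, hw⟩ | ⟨e, h, hw⟩)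
        · exact ⟨e, Or.inl h, hw⟩
        · exact ⟨e, Or.inr h, hw⟩
    have hno : ∀ s ∈ S, ∀ t ∈ T, s(s,t) ∉ M' := fun s hs t ht =>
      union_aux hd hx hM hM' hMS hNT hcc hs ht
    have hA : M'.filter (fun e => ∀ v ∈ e, v ∈ S) = M := by
      apply hMu _ (sub_matching hM' (Finset.filter_subset _ _))
      ext w
      simp only [covered, Set.mem_ofPred_eq, Finset.mem_filter]
      constructor
      · rintro ⟨e, ⟨he, heS⟩, hw⟩
        rcases (hcc w).1 ⟨e, he, hw⟩ with h | h
        · exact h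
        · exact absurd (hNT w h) (hTS w (heS w hw))
      · intro hw
        obtain ⟨e, he, hwe⟩ := (hcc w).2 (Or.inl hw)
        refine ⟨e, ⟨he, ?_⟩, hwe⟩
        obtain ⟨z, rfl⟩ := Sym2.mem_iff_exists.1 hwe
        intro v hv
        rcases Sym2.mem_iff.1 hv with rfl | rfl
        · exact hMS _ hw
        · rcases (hcc v).1 ⟨_, he, by simp⟩ with h | h
          · exact hMS v h
          · exact absurd he (hno w (hMS w hw) v (hNT v h))
    have hB : M'.filter (fun e => ∀ v ∈ e, v ∈ T) = N := by
      apply hNu _ (sub_matching hM' (Finset.filter_subset _ _))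
      ext w
      simp only [covered, Set.mem_ofPred_eq, Finset.mem_filter]
      constructor
      · rintro ⟨e, ⟨he, heS⟩, hw⟩
        rcases (hcc w).1 ⟨e, he, hw⟩ with h | h
        · exact absurd (heS w hw) (hTS w (hMS w h))
        · exact h
      · intro hw
        obtain ⟨e, he, hwe⟩ := (hcc w).2 (Or.inr hw)
        refine ⟨e, ⟨he, ?_⟩, hwe⟩
        obtain ⟨z, rfl⟩ := Sym2.mem_iff_exists.1 hwe
        intro v hv
        rcases Sym2.mem_iff.1 hv with rfl | rfl
        · exact hNT _ hw
        · rcases (hcc v).1 ⟨_, he, by simp⟩ with h | h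
          · exact absurd he (Sym2.eq_swap ▸ hno v (hMS v h) w (hNT w hw))
          · exact hNT v h
    ext e
    rw [Finset.mem_union, ← hA, ← hB]
    simp only [Finset.mem_filter]
    constructor
    · intro he
      induction e using Sym2.ind with
      | _ a b =>
        rcases (hcc a).1 ⟨_, he, by simp⟩ with h | h <;> rcases (hcc b).1 ⟨_, he, by simp⟩ with h' | h'
        · left; refine ⟨he, fun v hv => ?_⟩
          rcases Sym2.mem_iff.1 hv with rfl | rfl
          · exact hMS _ h
          · exact hMS _ h'
        · exact absurd he (hno a (hMS a h) b (hNT b h'))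
        · exact absurd he (Sym2.eq_swap ▸ hno b (hMS b h') a (hNT a h))
        · right; refine ⟨he, fun v hv => ?_⟩
          rcases Sym2.mem_iff.1 hv with rfl | rfl
          · exact hNT _ h
          · exact hNT _ h'
    · rintro (h | h) <;> exact h.1
  · rintro w ⟨e, he, hw⟩
    rcases Finset.mem_union.1 he with h | h
    · exact Finset.mem_union_left _ (hMS w ⟨e, h, hw⟩)
    · exact Finset.mem_union_right _ (hNT w ⟨e, h, hw⟩)
  · rw [Finset.card_union_of_disjoint hMN, hk, hl]

variable (G)
/-- waste at most `c` -/
def W (S : Finset V) (c : ℤ) : Prop := ∃ k, U G S k ∧ (S.card : ℤ) ≤ 3 * k + c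
variable {G}

lemma W.empty : W G ∅ 0 := ⟨0, U.empty, by simp⟩

lemma W.le {S : Finset V} {c d : ℤ} (h : W G S c) (hcd : c ≤ d) : W G S d := by
  obtain ⟨k, h1, h2⟩ := h
  exact ⟨k, h1, by omega⟩

lemma W.ins {S : Finset V} {c : ℤ} (h : W G S c) (x : V) : W G (insert x S) (c+1) := by
  obtain ⟨k, h1, h2⟩ := h
  refine ⟨k, h1.mono (Finset.subset_insert _ _), ?_⟩
  have := Finset.card_insert_le x S
  omega

lemma W.single (x : V) : W G {x} 1 := W.ins W.empty x

lemma W.leaf {S : Finset V} {c : ℤ} (h : W G S c) {u v : V} (hu : u ∉ S) (hv : v ∉ S)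
    (huv : G.Adj u v) (hn : ∀ z ∈ S, ¬ G.Adj u z) : W G (insert u (insert v S)) (c-1) := by
  obtain ⟨k, h1, h2⟩ := h
  refine ⟨k+1, h1.leaf hu hv huv hn, ?_⟩
  have := Finset.card_insert_le u (insert v S)
  have := Finset.card_insert_le v S
  push_cast
  omega

lemma W.union {S T : Finset V} {c d : ℤ} (hS : W G S c) (hT : W G T d) (hd : Disjoint S T)
    (x : V) (hx : ∀ s ∈ S, ∀ t ∈ T, G.Adj s t → s = x ∨ t = x) : W G (S ∪ T) (c + d) := by
  obtain ⟨k, h1, h2⟩ := hS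
  obtain ⟨l, h3, h4⟩ := hT
  refine ⟨k+l, h1.union h3 hd x hx, ?_⟩
  have := Finset.card_union_le S T
  push_cast
  omega

lemma W.mod {S : Finset V} {c : ℤ} (h : W G S c) (d : ℤ) (hd : c < d + 3)
    (hm : (3:ℤ) ∣ S.card - d) : W G S d := by
  obtain ⟨k, h1, h2⟩ := h
  exact ⟨k, h1, by omega⟩

lemma nuUR_ge (h : W G Finset.univ 1) : ((Nat.card V : ℝ) - 1) / 3 ≤ nuUR G := by
  obtain ⟨k, ⟨M, hM, -, hk⟩, h2⟩ := h
  have : k ≤ nuUR G := by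
    apply le_csSup
    · refine ⟨Fintype.card (Finset (Sym2 V)) + Fintype.card (Sym2 V), ?_⟩
      rintro _ ⟨M, -, rfl⟩
      exact (Finset.card_le_univ M).trans (by omega)
    · exact ⟨M, hM, hk⟩
  have h3 : Nat.card V ≤ 3 * nuUR G + 1 := by
    rw [Finset.card_univ] at h2
    rw [Nat.card_eq_fintype_card]; omega
  have h4 : (Nat.card V : ℝ) ≤ 3 * nuUR G + 1 := by exact_mod_cast h3
  linarith
end
end URPaper

open SimpleGraph
namespace URPaper
section
set_option linter.unusedSectionVars false
set_option linter.unusedVariables false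
variable {V : Type} [Fintype V] [DecidableEq V] (G : SimpleGraph V) [DecidableRel G.Adj]

def dg (v : V) (D : Finset V) : ℕ := (D.filter (fun z => G.Adj v z)).card
def ee (C D : Finset V) : ℕ := ∑ c ∈ C, dg G c D
def bd (B C : Finset V) : ℕ := ee G C (B \ C)
def Conn (S : Finset V) : Prop := S.Nonempty ∧ ∀ C ⊆ S, C.Nonempty → C ≠ S → 0 < bd G S C

structure Hyp : Prop where
  deg : ∀ v S, dg G v S ≤ 3
  tri : ∀ a b c, G.Adj a b → G.Adj b c → G.Adj a c → False
  c4 : ∀ a b c d, a ≠ b → c ≠ d → G.Adj a c → G.Adj b c → G.Adj a d → G.Adj b d → False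

variable {G}

lemma W.to {S T : Finset V} {c d : ℤ} (h : W G S c) (hcd : c ≤ d) (hST : T = S) : W G T d := hST ▸ h.le hcd

lemma W.union0 {S T : Finset V} {c d : ℤ} (hS : W G S c) (hT : W G T d) (hd : Disjoint S T)
    (hx : ∀ s ∈ S, ∀ t ∈ T, ¬ G.Adj s t) : W G (S ∪ T) (c + d) := by
  rcases S.eq_empty_or_nonempty with rfl | ⟨x, _⟩
  · obtain ⟨k, h1, h2⟩ := hS
    obtain ⟨l, h3, h4⟩ := hT
    by_cases hk : k = 0
    · subst hk
      refine ⟨l, by simpa using h3, ?_⟩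
      simp at *; omega
    · obtain ⟨M, _, h5, h6⟩ := h1
      exfalso
      obtain ⟨e, he⟩ := Finset.card_pos.1 (show 0 < M.card by omega)
      induction e using Sym2.ind with
      | _ a b => exact absurd (h5 a ⟨_, he, by simp⟩) (by simp)
  · exact hS.union hT hd x (fun s hs t ht h => absurd h (hx s hs t ht))

lemma dg_empty (v : V) : dg G v ∅ = 0 := by simp [dg]
lemma dg_mono (v : V) {D E : Finset V} (h : D ⊆ E) : dg G v D ≤ dg G v E :=
  Finset.card_le_card (Finset.filter_subset_filter _ h)
lemma dg_union (v : V) {D E : Finset V} (h : Disjoint D E) : dg G v (D ∪ E) = dg G v D + dg G v E := by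
  unfold dg
  rw [Finset.filter_union, Finset.card_union_of_disjoint (Finset.disjoint_filter_filter h)]
lemma dg_sdiff (v : V) {D E : Finset V} (h : D ⊆ E) : dg G v (E \ D) + dg G v D = dg G v E := by
  rw [← dg_union v Finset.sdiff_disjoint, Finset.sdiff_union_of_subset h]
lemma dg_single (v w : V) : dg G v {w} = if G.Adj v w then 1 else 0 := by
  unfold dg; rw [Finset.filter_singleton]; split_ifs <;> simp
lemma dg_insert (v w : V) {D : Finset V} (h : w ∉ D) :
    dg G v (insert w D) = dg G v D + if G.Adj v w then 1 else 0 := by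
  rw [Finset.insert_eq, dg_union v (by simpa using h), dg_single]; ring
lemma dg_erase (v w : V) {D : Finset V} (h : w ∈ D) :
    dg G v (D.erase w) + (if G.Adj v w then 1 else 0) = dg G v D := by
  conv_rhs => rw [← Finset.insert_erase h]
  rw [dg_insert v w (by simp)]
lemma dg_pos {v : V} {D : Finset V} : 0 < dg G v D ↔ ∃ z ∈ D, G.Adj v z := by
  unfold dg; rw [Finset.card_pos]; simp [Finset.Nonempty]
lemma dg_zero {v : V} {D : Finset V} : dg G v D = 0 ↔ ∀ z ∈ D, ¬ G.Adj v z := by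
  unfold dg; rw [Finset.card_eq_zero, Finset.filter_eq_empty_iff]
lemma dg_one {v : V} {D : Finset V} (h : dg G v D = 1) :
    ∃ a ∈ D, G.Adj v a ∧ ∀ z ∈ D, G.Adj v z → z = a := by
  obtain ⟨a, ha⟩ := Finset.card_eq_one.1 h
  have h2 : ∀ z, (z ∈ D ∧ G.Adj v z) ↔ z = a := fun z => by
    have := Finset.ext_iff.1 ha z; simpa using this
  exact ⟨a, ((h2 a).2 rfl).1, ((h2 a).2 rfl).2, fun z hz hv => (h2 z).1 ⟨hz, hv⟩⟩
lemma dg_two {v : V} {D : Finset V} (h : dg G v D = 2) :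
    ∃ a ∈ D, ∃ b ∈ D, a ≠ b ∧ G.Adj v a ∧ G.Adj v b ∧ ∀ z ∈ D, G.Adj v z → z = a ∨ z = b := by
  obtain ⟨a, b, hab, ha⟩ := Finset.card_eq_two.1 h
  have h2 : ∀ z, (z ∈ D ∧ G.Adj v z) ↔ z = a ∨ z = b := fun z => by
    have := Finset.ext_iff.1 ha z; simpa using this
  exact ⟨a, ((h2 a).2 (by simp)).1, b, ((h2 b).2 (by simp)).1, hab, ((h2 a).2 (by simp)).2,
    ((h2 b).2 (by simp)).2, fun z hz hv => (h2 z).1 ⟨hz, hv⟩⟩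
lemma dg_three {v : V} {D : Finset V} (h : dg G v D = 3) :
    ∃ a ∈ D, ∃ b ∈ D, ∃ c ∈ D, a ≠ b ∧ a ≠ c ∧ b ≠ c ∧ G.Adj v a ∧ G.Adj v b ∧ G.Adj v c ∧
      ∀ z ∈ D, G.Adj v z → z = a ∨ z = b ∨ z = c := by
  obtain ⟨a, b, c, hab, hac, hbc, ha⟩ := Finset.card_eq_three.1 h
  have h2 : ∀ z, (z ∈ D ∧ G.Adj v z) ↔ z = a ∨ z = b ∨ z = c := fun z => by
    have := Finset.ext_iff.1 ha z; simpa using this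
  exact ⟨a, ((h2 a).2 (by simp)).1, b, ((h2 b).2 (by simp)).1, c, ((h2 c).2 (by simp)).1,
    hab, hac, hbc, ((h2 a).2 (by simp)).2, ((h2 b).2 (by simp)).2, ((h2 c).2 (by simp)).2,
    fun z hz hv => (h2 z).1 ⟨hz, hv⟩⟩

lemma ee_empty_left (D : Finset V) : ee G ∅ D = 0 := by simp [ee]
lemma ee_empty_right (D : Finset V) : ee G D ∅ = 0 := by simp [ee, dg_empty]
lemma ee_comm (C D : Finset V) : ee G C D = ee G D C := by
  unfold ee dg
  simp_rw [Finset.card_filter]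
  rw [Finset.sum_comm]
  simp_rw [G.adj_comm]
lemma ee_single_left (v : V) (D : Finset V) : ee G {v} D = dg G v D := by simp [ee]
lemma ee_union_left {C C' : Finset V} (D : Finset V) (h : Disjoint C C') :
    ee G (C ∪ C') D = ee G C D + ee G C' D := Finset.sum_union h
lemma ee_union_right {C C' : Finset V} (D : Finset V) (h : Disjoint C C') :
    ee G D (C ∪ C') = ee G D C + ee G D C' := by
  rw [ee_comm, ee_union_left D h, ee_comm, ee_comm D C']
lemma ee_insert_left {v : V} {C : Finset V} (D : Finset V) (h : v ∉ C) :
    ee G (insert v C) D = dg G v D + ee G C D := Finset.sum_insert h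
lemma ee_insert_right {v : V} {C : Finset V} (D : Finset V) (h : v ∉ C) :
    ee G D (insert v C) = dg G v D + ee G D C := by
  rw [ee_comm, ee_insert_left D h, ee_comm]
lemma ee_sdiff_right {D E : Finset V} (C : Finset V) (h : D ⊆ E) :
    ee G C (E \ D) + ee G C D = ee G C E := by
  rw [← ee_union_right C Finset.sdiff_disjoint, Finset.sdiff_union_of_subset h]
lemma ee_mono {C D E : Finset V} (h : D ⊆ E) : ee G C D ≤ ee G C E := by
  have := ee_sdiff_right (G := G) C h; omega
lemma ee_mono_left {C D E : Finset V} (h : D ⊆ E) : ee G D C ≤ ee G E C := by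
  rw [ee_comm D, ee_comm E]; exact ee_mono h
lemma ee_zero {C D : Finset V} : ee G C D = 0 ↔ ∀ x ∈ C, ∀ y ∈ D, ¬ G.Adj x y := by
  unfold ee; rw [Finset.sum_eq_zero_iff]; simp only [dg_zero]
lemma ee_pos {C D : Finset V} : 0 < ee G C D ↔ ∃ x ∈ C, ∃ y ∈ D, G.Adj x y := by
  rw [Nat.pos_iff_ne_zero, Ne, ee_zero]; push Not; rfl
lemma ee_dg {C D : Finset V} {x : V} (hx : x ∈ C) : ee G C D = dg G x D + ee G (C.erase x) D := by
  conv_lhs => rw [← Finset.insert_erase hx]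
  rw [ee_insert_left _ (by simp)]

/-- pull an explicit edge out of a cut -/
lemma ee_one {C D : Finset V} (h : ee G C D = 1) :
    ∃ x ∈ C, ∃ y ∈ D, G.Adj x y ∧ ∀ a ∈ C, ∀ b ∈ D, G.Adj a b → a = x ∧ b = y := by
  obtain ⟨x, hx, y, hy, hxy⟩ := ee_pos.1 (by omega : 0 < ee G C D)
  refine ⟨x, hx, y, hy, hxy, ?_⟩
  rw [ee_dg hx] at h
  have h1 : 0 < dg G x D := dg_pos.2 ⟨y, hy, hxy⟩
  have h2 : ee G (C.erase x) D = 0 := by omega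
  have h3 : dg G x D = 1 := by omega
  obtain ⟨z, _, _, hz⟩ := dg_one h3
  intro a ha b hb hab
  have hax : a = x := by
    by_contra hne
    exact ee_zero.1 h2 a (by simp [hne, ha]) b hb hab
  subst hax
  exact ⟨rfl, by rw [hz b hb hab, hz y hy hxy]⟩

lemma bd_move {B C : Finset V} {v : V} (hv : v ∈ B) (hvC : v ∉ C) (hC : C ⊆ B) :
    bd G B (insert v C) + 2 * dg G v C = bd G B C + dg G v B := by
  unfold bd
  have h1 : B \ C = insert v (B \ insert v C) := by grind
  have h2 := dg_sdiff (G := G) v (show C ⊆ B from hC)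
  rw [h1, dg_insert _ _ (by simp)] at h2
  rw [h1, ee_insert_left _ hvC, ee_insert_right _ (by simp)]
  simp at h2
  omega

lemma bd_zero {B C : Finset V} : bd G B C = 0 ↔ ∀ x ∈ C, ∀ y ∈ B, y ∉ C → ¬ G.Adj x y := by
  unfold bd; rw [ee_zero]; simp only [Finset.mem_sdiff]; grind

lemma bd_pos {B C : Finset V} : 0 < bd G B C ↔ ∃ x ∈ C, ∃ y ∈ B, y ∉ C ∧ G.Adj x y := by
  unfold bd; rw [ee_pos]; simp only [Finset.mem_sdiff]; grind

lemma bd_empty (B : Finset V) : bd G B ∅ = 0 := ee_empty_left _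
lemma bd_self (B : Finset V) : bd G B B = 0 := by simp [bd, ee_empty_right]

lemma bd_compl {B C : Finset V} (h : C ⊆ B) : bd G B (B \ C) = bd G B C := by
  unfold bd; rw [ee_comm, Finset.sdiff_sdiff_eq_self h]

lemma bd_single {B : Finset V} (v : V) (hv : v ∈ B) : bd G B {v} = dg G v B := by
  have := bd_move (G := G) hv (Finset.notMem_empty v) (Finset.empty_subset B)
  simpa [bd_empty, dg_empty] using this

lemma bd_erase {B : Finset V} (v : V) (hv : v ∈ B) : bd G B (B.erase v) = dg G v B := by
  rw [← bd_single v hv, ← bd_compl (C := {v}) (by simpa using hv), Finset.sdiff_singleton_eq_erase]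

lemma bd_union {B C D : Finset V} (hd : Disjoint C D) (hn : ∀ x ∈ C, ∀ y ∈ D, ¬ G.Adj x y)
    (hC : C ⊆ B) (hD : D ⊆ B) : bd G B (C ∪ D) = bd G B C + bd G B D := by
  unfold bd
  rw [Finset.disjoint_left] at hd
  have h1 : B \ C = (B \ (C ∪ D)) ∪ D := by grind
  have h2 : B \ D = (B \ (C ∪ D)) ∪ C := by grind
  have h0 := ee_zero.2 hn
  rw [h1, h2, ee_union_right _ (by rw [Finset.disjoint_left]; grind),
    ee_union_right _ (by rw [Finset.disjoint_left]; grind), ee_comm D C, h0,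
    ee_union_left _ (by rw [Finset.disjoint_left]; grind)]
  rfl

/-- `bd` in a larger ambient set -/
lemma bd_amb {A B C : Finset V} (hC : C ⊆ A) (hA : A ⊆ B) :
    bd G B C = bd G A C + ee G C (B \ A) := by
  unfold bd
  rw [show B \ C = (A \ C) ∪ (B \ A) by grind, ee_union_right _ (by rw [Finset.disjoint_left]; grind)]

lemma bd_amb_le {A B C : Finset V} (hC : C ⊆ A) (hA : A ⊆ B) : bd G A C ≤ bd G B C := by
  rw [bd_amb hC hA]; omega

lemma bd_amb_eq {A B C : Finset V} (hC : C ⊆ A) (hA : A ⊆ B)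
    (hn : ∀ x ∈ C, ∀ y ∈ B, y ∉ A → ¬ G.Adj x y) : bd G B C = bd G A C := by
  rw [bd_amb hC hA, ee_zero.2 (by simp only [Finset.mem_sdiff]; grind)]; rfl

lemma Conn.edge {S C : Finset V} (h : Conn G S) (hC : C ⊆ S) (hne : C.Nonempty) (hS : C ≠ S) :
    ∃ x ∈ C, ∃ y ∈ S, y ∉ C ∧ G.Adj x y := bd_pos.1 (h.2 C hC hne hS)

lemma exists_comp (T : Finset V) (hT : T.Nonempty) :
    ∃ C ⊆ T, Conn G C ∧ ∀ x ∈ C, ∀ y ∈ T, y ∉ C → ¬ G.Adj x y := by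
  induction hn : T.card using Nat.strong_induction_on generalizing T with
  | _ n ih =>
    by_cases hc : Conn G T
    · exact ⟨T, subset_rfl, hc, by grind⟩
    · unfold Conn at hc
      push Not at hc
      obtain ⟨C, hCT, hCne, hne, hb⟩ := hc hT
      have hb : bd G T C = 0 := by omega
      obtain ⟨D, hDC, hD, hD2⟩ := ih C.card (by
        rw [← hn]; exact Finset.card_lt_card (Finset.ssubset_iff_subset_ne.2 ⟨hCT, hne⟩)) C hCne rfl
      rw [bd_zero] at hb
      exact ⟨D, hDC.trans hCT, hD, by grind⟩

lemma split3 {B T : Finset V} (m : ℕ) (hTB : T ⊆ B) (hm : ∀ C ⊆ T, C.Nonempty → m ≤ bd G B C)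
    (hb : bd G B T < 3 * m) : T = ∅ ∨ Conn G T ∨ ∃ C D, Conn G C ∧ Conn G D ∧ Disjoint C D ∧
      C ∪ D = T ∧ (∀ x ∈ C, ∀ y ∈ D, ¬ G.Adj x y) ∧ bd G B C + bd G B D = bd G B T := by
  rcases T.eq_empty_or_nonempty with h | h
  · exact Or.inl h
  right
  obtain ⟨C, hCT, hC, hC2⟩ := exists_comp (G := G) T h
  rcases (T \ C).eq_empty_or_nonempty with h1 | h1
  · left
    have : C = T := by
      apply Finset.Subset.antisymm hCT; rwa [← Finset.sdiff_eq_empty_iff_subset]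
    exact this ▸ hC
  right
  obtain ⟨D, hDT, hD, hD2⟩ := exists_comp (G := G) (T \ C) h1
  have hdis : Disjoint C D := by rw [Finset.disjoint_left]; grind
  have hCD : ∀ x ∈ C, ∀ y ∈ D, ¬ G.Adj x y := by
    intro x hx y hy; exact hC2 x hx y (by grind) (by grind)
  have e1 := bd_union (B := B) hdis hCD (by grind) (by grind)
  rcases ((T \ C) \ D).eq_empty_or_nonempty with h2 | h2
  · have hu : C ∪ D = T := by
      rw [Finset.sdiff_eq_empty_iff_subset] at h2
      ext z; have := @h2 z; have := @hDT z; have := @hCT z; simp at *; tauto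
    exact ⟨C, D, hC, hD, hdis, hu, hCD, by rw [← hu, e1]⟩
  · exfalso
    have e2 := bd_union (B := B) (C := C ∪ D) (D := (T \ C) \ D) (G := G)
      (by rw [Finset.disjoint_left]; grind)
      (by
        intro x hx y hy hxy
        simp at hx hy
        rcases hx with hx | hx
        · exact hC2 x hx y hy.1.1 hy.1.2 hxy
        · exact hD2 x hx y (by simp [hy]) hy.2 hxy) (by grind) (by grind)
    have : C ∪ D ∪ (T \ C) \ D = T := by
      ext z; have := @hDT z; have := @hCT z; simp at *; tauto
    rw [this] at e2
    have := hm C hCT hC.1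
    have := hm D (by grind) hD.1
    have := hm _ (by grind) h2
    omega

lemma split2 {B T : Finset V} (m : ℕ) (hTB : T ⊆ B) (hm : ∀ C ⊆ T, C.Nonempty → m ≤ bd G B C)
    (hb : bd G B T < 2 * m) : T = ∅ ∨ Conn G T := by
  rcases split3 m hTB hm (by omega) with h | h | ⟨C, D, hC, hD, h1, h2, h3, h4⟩
  · exact Or.inl h
  · exact Or.inr h
  · have := hm C (by grind) hC.1
    have := hm D (by grind) hD.1
    omega

lemma Conn.of {S A : Finset V} (h : Conn G S) (hA : A ⊆ S) {x : V} (hx : x ∈ A)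
    (he : ∀ a ∈ A, ∀ b ∈ S, b ∉ A → G.Adj a b → a = x) : Conn G A := by
  refine ⟨⟨x, hx⟩, fun C hC hne hCA => ?_⟩
  rw [bd_pos]
  by_cases hxC : x ∈ C
  · have h1 : (A \ C).Nonempty := by
      rw [Finset.sdiff_nonempty]; intro h; exact hCA (Finset.Subset.antisymm hC h)
    obtain ⟨a, ha, b, hb, hb2, hab⟩ := h.edge (C := A \ C) (by grind) h1 (by
      intro h; rw [← h] at hA; have := hA hx; grind)
    have := hab.symm
    by_cases hbA : b ∈ A
    · exact ⟨b, by grind, a, by grind, by grind, this⟩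
    · have := he a (by grind) b hb hbA hab; grind
  · obtain ⟨a, ha, b, hb, hb2, hab⟩ := h.edge (C := C) (by grind) hne (by grind)
    by_cases hbA : b ∈ A
    · exact ⟨a, ha, b, hbA, hb2, hab⟩
    · have := he a (by grind) b hb hbA hab; grind

lemma Conn.ins {A : Finset V} (h : Conn G A) {x a : V} (ha : a ∈ A) (hxa : G.Adj x a) :
    Conn G (insert x A) := by
  by_cases hxA : x ∈ A
  · rwa [Finset.insert_eq_of_mem hxA]
  refine ⟨by simp, fun C hC hne hCA => ?_⟩
  rw [bd_pos]
  by_cases hxC : x ∈ C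
  · by_cases haC : a ∈ C
    · obtain ⟨p, hp, q, hq, hq2, hpq⟩ := h.edge (C := C.erase x) (by grind) ⟨a, by grind⟩ (by
        intro h; apply hCA; rw [← h]; grind)
      exact ⟨p, by grind, q, by grind, by grind, hpq⟩
    · exact ⟨x, hxC, a, by grind, haC, hxa⟩
  · by_cases hCA' : C = A
    · exact ⟨a, by grind, x, by grind, hxC, hxa.symm⟩
    · obtain ⟨p, hp, q, hq, hq2, hpq⟩ := h.edge (C := C) (by grind) hne hCA'
      exact ⟨p, by grind, q, by grind, by grind, hpq⟩

lemma conn_single (x : V) : Conn G {x} := by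
  refine ⟨by simp, fun C hC hne hCA => ?_⟩
  rw [Finset.subset_singleton_iff] at hC
  rcases hC with rfl | rfl
  · simp at hne
  · exact absurd rfl hCA

/-- a proper connected subset spoils cubicity -/
lemma Conn.lowdeg {S : Finset V} (h : Conn G S) {C : Finset V} (hC : C ⊆ S) (hne : C.Nonempty)
    (hCS : C ≠ S) (hyp : Hyp G) : ∃ x ∈ C, dg G x C ≤ 2 := by
  obtain ⟨x, hx, y, hy, hyC, hxy⟩ := h.edge hC hne hCS
  refine ⟨x, hx, ?_⟩
  have := hyp.deg x (insert y C)
  rw [dg_insert _ _ hyC] at this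
  simp [hxy] at this; omega

/-- drop one vertex -/
lemma drop1 {S : Finset V} (h : Conn G S) (PW : ∀ C ⊂ S, Conn G C → W G C 1) {x : V} (hx : x ∈ S)
    (hd : dg G x S ≤ 2) : W G (S.erase x) 2 := by
  have hss : S.erase x ⊂ S := Finset.erase_ssubset hx
  rcases split3 (G := G) (B := S) (T := S.erase x) 1 hss.1
    (fun C hC hne => h.2 C (hC.trans hss.1) hne (by rintro rfl; grind))
    (by rw [bd_erase x hx]; omega) with h1 | h1 | ⟨C, D, hC, hD, h1, h2, h3, h4⟩
  · rw [h1]; exact W.empty.le (by norm_num)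
  · exact (PW _ hss h1).le (by norm_num)
  · rw [← h2]
    exact W.union0 (PW C ((show C ⊆ S.erase x by grind).trans_ssubset hss) hC)
      (PW D ((show D ⊆ S.erase x by grind).trans_ssubset hss) hD) h1 h3

lemma drop1' {S : Finset V} (h : Conn G S) (PW : ∀ C ⊂ S, Conn G C → W G C 1) {x : V} (hx : x ∈ S)
    (hd : dg G x S ≤ 2) (hm : S.card % 3 = 1) : W G (S.erase x) 0 := by
  refine (drop1 h PW hx hd).mod 0 (by norm_num) ?_
  rw [Finset.card_erase_of_mem hx]; omega

/-- tight sets -/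
lemma tight_mod {S : Finset V} (h : W G S 1) (h0 : ¬ W G S 0) : S.card % 3 = 1 := by
  by_contra hne
  apply h0
  have : S.card % 3 = 0 ∨ S.card % 3 = 2 := by omega
  rcases this with h1 | h1
  · exact h.mod 0 (by norm_num) (by omega)
  · exact (h.mod (-1) (by norm_num) (by omega)).le (by norm_num)

end
end URPaper

open SimpleGraph
namespace URPaper
section
set_option linter.unusedSectionVars false
set_option linter.unusedVariables false
variable {V : Type} [Fintype V] [DecidableEq V] {G : SimpleGraph V} [DecidableRel G.Adj]

/-- a vertex with an outside neighbour has degree at most 2 inside -/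
lemma Hyp.deg2 (hyp : Hyp G) {p x : V} {C : Finset V} (hx : x ∉ C) (hpx : G.Adj p x) :
    dg G p C ≤ 2 := by
  have := hyp.deg p (insert x C)
  rw [dg_insert _ _ hx] at this
  simp [hpx] at this; omega

lemma dg_two_le {v a b : V} {D : Finset V} (ha : a ∈ D) (hb : b ∈ D) (hab : a ≠ b)
    (h1 : G.Adj v a) (h2 : G.Adj v b) (hd : dg G v D ≤ 2) : ∀ z ∈ D, G.Adj v z → z = a ∨ z = b := by
  intro z hz hvz
  by_contra hne
  push Not at hne
  have hs : ({z, a, b} : Finset V) ⊆ D.filter (fun z => G.Adj v z) := by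
    intro y hy; simp at hy; rcases hy with rfl | rfl | rfl <;> simp [*]
  have := Finset.card_le_card hs
  rw [Finset.card_eq_three.2 ⟨z, a, b, hne.1, hne.2, hab, rfl⟩] at this
  unfold dg at hd; omega

lemma dg_one_le {v a : V} {D : Finset V} (ha : a ∈ D)
    (h1 : G.Adj v a) (hd : dg G v D ≤ 1) : ∀ z ∈ D, G.Adj v z → z = a := by
  intro z hz hvz
  exact Finset.card_le_one.1 hd z (by simp [*]) a (by simp [*])

lemma card_erase2 {X : Finset V} {x y : V} (hx : x ∈ X) (hy : y ∈ X) (h : x ≠ y) :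
    (X \ {x, y}).card = X.card - 2 := by
  rw [Finset.card_sdiff_of_subset (by grind), Finset.card_pair h]

lemma gadA {C D X : Finset V} {x1 x2 p1 p2 q1 q2 : V} (hne : x1 ≠ x2) (hp1 : p1 ∈ C) (hq1 : q1 ∈ D) (hp2 : p2 ∈ C)
    (hq2 : q2 ∈ D) (memX : ∀ z, z ∈ X ↔ z = x1 ∨ z = x2 ∨ z ∈ C ∨ z ∈ D)
    (nC1 : x1 ∉ C) (nC2 : x2 ∉ C) (nD1 : x1 ∉ D) (nD2 : x2 ∉ D)
    (hdis : ∀ a ∈ C, a ∉ D) (hn2 : ∀ x ∈ C, ∀ y ∈ D, ¬ G.Adj x y) (x12 : ¬ G.Adj x1 x2)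
    (a1 : G.Adj x1 p1) (a3 : G.Adj x2 p2)
    (u1 : ∀ z ∈ C, G.Adj x1 z → z = p1) (u2 : ∀ z ∈ D, G.Adj x1 z → z = q1)
    (u3 : ∀ z ∈ C, G.Adj x2 z → z = p2) (u4 : ∀ z ∈ D, G.Adj x2 z → z = q2) (hpp : p1 ≠ p2)
    (I1 : W G (C \ {p1, p2}) (-1)) (I2 : W G (D.erase q1) 0) : W G X 0 := by
  have J1 := I1.leaf (u := x2) (v := p2) (by grind) (by grind) a3 (by grind)
  have J2 := J1.union I2 (by rw [Finset.disjoint_left]; grind) x2 (by grind)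
  have J3 := J2.leaf (u := x1) (v := p1) (by grind) (by grind) a1 (by grind)
  have J4 := J3.ins q1
  convert J4.le (show _ ≤ (0:ℤ) by norm_num) using 1
  ext z
  rw [memX]
  simp only [FM]
  clear * - hp1 hp2 hq1
  grind

lemma lemA (hyp : Hyp G) (n : ℕ) : ∀ X : Finset V, X.card = n → Conn G X →
    (∀ C ⊂ X, Conn G C → W G C 1) → X.card % 3 = 1 → ¬ W G X 0 →
    ∀ x1 ∈ X, ∀ x2 ∈ X, x1 ≠ x2 → dg G x1 X ≤ 2 → dg G x2 X ≤ 2 →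
    (∀ C ⊆ X \ {x1, x2}, C.Nonempty → 2 ≤ bd G X C) → W G (X \ {x1, x2}) (-1) := by
  induction n using Nat.strong_induction_on with
  | _ n ih =>
  intro X hn hX PW hm h0 x1 h1 x2 h2 hne d1 d2 hb
  have hcard := card_erase2 h1 h2 hne
  have hge : 2 ≤ X.card := by
    rw [← Finset.card_pair hne]; exact Finset.card_le_card (by grind)
  have hsub : X \ {x1, x2} ⊂ X := by
    refine Finset.ssubset_iff_subset_ne.2 ⟨Finset.sdiff_subset, ?_⟩
    intro h; rw [← h] at h1; simp at h1
  have hW1 : W G (X \ {x1, x2}) 1 → W G (X \ {x1, x2}) (-1) := fun h =>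
    h.mod (-1) (by norm_num) (by omega)
  have hX2 : X = insert x1 (insert x2 (X \ {x1, x2})) := by grind
  have m1 := bd_move (G := G) (C := {x1}) h2 (by simpa using hne.symm) (by simpa using h1)
  have hbT : bd G X (X \ {x1, x2}) ≤ 4 := by
    have e1 : bd G X (X \ {x1, x2}) = bd G X {x2, x1} := by
      rw [bd_compl (by grind), Finset.pair_comm]
    rw [bd_single _ h1] at m1
    omega
  rcases split3 (G := G) 2 hsub.1 hb (by omega) with h | h | ⟨C, D, hC, hD, hdis, hU, hn2, hbs⟩
  · exfalso
    have : (X \ {x1, x2}).card = 0 := by rw [h]; rfl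
    omega
  · exact hW1 (PW _ hsub h)
  · have hCs : C ⊆ X \ {x1, x2} := by rw [← hU]; exact Finset.subset_union_left
    have hDs : D ⊆ X \ {x1, x2} := by rw [← hU]; exact Finset.subset_union_right
    have WC := PW C (hCs.trans_ssubset hsub) hC
    have WD := PW D (hDs.trans_ssubset hsub) hD
    by_cases WC0 : W G C 0
    · apply hW1; rw [← hU]; exact (W.union0 WC0 WD hdis hn2).le (by norm_num)
    by_cases WD0 : W G D 0
    · apply hW1; rw [← hU]; exact (W.union0 WC WD0 hdis hn2).le (by norm_num)
    exfalso
    have hdis' := Finset.disjoint_left.1 hdis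
    have memX : ∀ z, z ∈ X ↔ z = x1 ∨ z = x2 ∨ z ∈ C ∨ z ∈ D := by
      intro z; rw [hX2, ← hU]; simp
    have nC1 : x1 ∉ C := fun h => by have := hCs h; simp at this
    have nC2 : x2 ∉ C := fun h => by have := hCs h; simp at this
    have nD1 : x1 ∉ D := fun h => by have := hDs h; simp at this
    have nD2 : x2 ∉ D := fun h => by have := hDs h; simp at this
    have bC : bd G X C = dg G x1 C + dg G x2 C := by
      unfold bd
      rw [show X \ C = insert x1 (insert x2 D) by ext z; simp only [FM, memX]; clear * - hdis' nC1 nC2; grind,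
        ee_insert_right _ (by simp [hne, nD1]), ee_insert_right _ nD2, ee_zero.2 hn2]; omega
    have bD : bd G X D = dg G x1 D + dg G x2 D := by
      unfold bd
      rw [show X \ D = insert x1 (insert x2 C) by ext z; simp only [FM, memX]; clear * - hdis' nD1 nD2; grind,
        ee_insert_right _ (by simp [hne, nC1]), ee_insert_right _ nC2, ee_comm, ee_zero.2 hn2]; omega
    have s1 : dg G x1 C + dg G x1 D ≤ 2 := by
      rw [← dg_union _ hdis]; exact (dg_mono _ (hU ▸ hsub.1)).trans d1
    have s2 : dg G x2 C + dg G x2 D ≤ 2 := by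
      rw [← dg_union _ hdis]; exact (dg_mono _ (hU ▸ hsub.1)).trans d2
    have b1 := hb C hCs hC.1
    have b2 := hb D hDs hD.1
    have mC := bd_move (G := G) h1 nC1 (hCs.trans hsub.1)
    have mD := bd_move (G := G) h1 nD1 (hDs.trans hsub.1)
    have pC := hX.2 (insert x1 C) (Finset.insert_subset h1 (hCs.trans hsub.1)) (by simp) (by
      intro h; rw [← h] at h2; simp [hne.symm, nC2] at h2)
    have pD := hX.2 (insert x1 D) (Finset.insert_subset h1 (hDs.trans hsub.1)) (by simp) (by
      intro h; rw [← h] at h2; simp [hne.symm, nD2] at h2)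
    obtain ⟨p1, hp1, a1, u1⟩ := dg_one (by omega : dg G x1 C = 1)
    obtain ⟨q1, hq1, a2, u2⟩ := dg_one (by omega : dg G x1 D = 1)
    obtain ⟨p2, hp2, a3, u3⟩ := dg_one (by omega : dg G x2 C = 1)
    obtain ⟨q2, hq2, a4, u4⟩ := dg_one (by omega : dg G x2 D = 1)
    have key : ∀ C D : Finset V, ∀ p1 ∈ C, ∀ q1 ∈ D, ∀ p2 ∈ C, ∀ q2 ∈ D, Conn G C → Conn G D →
        (∀ z, z ∈ X ↔ z = x1 ∨ z = x2 ∨ z ∈ C ∨ z ∈ D) → x1 ∉ C → x2 ∉ C → x1 ∉ D → x2 ∉ D →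
        (∀ a ∈ C, a ∉ D) → (∀ x ∈ C, ∀ y ∈ D, ¬ G.Adj x y) → G.Adj x1 p1 → G.Adj x1 q1 → G.Adj x2 p2 →
        G.Adj x2 q2 → (∀ z ∈ C, G.Adj x1 z → z = p1) → (∀ z ∈ D, G.Adj x1 z → z = q1) →
        (∀ z ∈ C, G.Adj x2 z → z = p2) → (∀ z ∈ D, G.Adj x2 z → z = q2) →
        ¬ W G C 0 → ¬ W G D 0 → p1 = p2 := by
      clear a1 a2 a3 a4 u1 u2 u3 u4 hp1 hp2 hq1 hq2 p1 p2 q1 q2 pC pD mC mD s1 s2 b1 b2 bC bD nC1 nC2 nD1 nD2 memX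
        hdis' WC0 WD0 WC WD hCs hDs hU hn2 hbs hdis hC hD C D
      intro C D p1 hp1 q1 hq1 p2 hp2 q2 hq2 hC hD memX nC1 nC2 nD1 nD2 hdis hn2 a1 a2 a3 a4 u1 u2 u3 u4 WC0 WD0
      by_contra hpp
      have hCX : C ⊂ X := by
        refine Finset.ssubset_iff_subset_ne.2 ⟨fun z hz => (memX z).2 (by simp [hz]), by rintro rfl; exact nC1 h1⟩
      have hDX : D ⊂ X := by
        refine Finset.ssubset_iff_subset_ne.2 ⟨fun z hz => (memX z).2 (by simp [hz]), by rintro rfl; exact nD1 h1⟩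
      have x12 : ¬ G.Adj x1 x2 := by
        intro h
        have := dg_two_le (hCX.1 hp1) (hDX.1 hq1) (by rintro rfl; exact hdis _ hp1 hq1) a1 a2 d1 x2 h2 h
        clear * - this nC2 nD2 hp1 hq1; grind
      have PC : ∀ E ⊂ C, Conn G E → W G E 1 := fun E hE => PW E (hE.trans hCX)
      have PD : ∀ E ⊂ D, Conn G E → W G E 1 := fun E hE => PW E (hE.trans hDX)
      have I1 := ih C.card (hn ▸ Finset.card_lt_card hCX) C rfl hC PC (tight_mod (PW C hCX hC) WC0) WC0
        p1 hp1 p2 hp2 hpp (hyp.deg2 nC1 a1.symm) (hyp.deg2 nC2 a3.symm) (by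
          intro E hE hne
          rw [← bd_amb_eq (B := X) (hE.trans Finset.sdiff_subset) hCX.1]
          · exact hb E (by clear * - hE memX nC1 nC2; grind) hne
          · intro x hx y hy hyC hxy
            have := hxy.symm
            clear * - this hE memX nC1 nC2 hn2 hx hy hyC hxy u1 u3
            grind)
      have I2 := drop1' hD PD hq1 (hyp.deg2 nD1 a2.symm) (tight_mod (PW D hDX hD) WD0)
      exact h0 (gadA hne hp1 hq1 hp2 hq2 memX nC1 nC2 nD1 nD2 hdis hn2 x12 a1 a3 u1 u2 u3 u4 hpp I1 I2)
    have e1 := key C D p1 hp1 q1 hq1 p2 hp2 q2 hq2 hC hD memX nC1 nC2 nD1 nD2 (fun a h1 h2 => hdis' h1 h2) hn2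
      a1 a2 a3 a4 u1 u2 u3 u4 WC0 WD0
    have e2 := key D C q1 hq1 p1 hp1 q2 hq2 p2 hp2 hD hC (fun z => by rw [memX, or_comm (a := z ∈ C)]) nD1 nD2 nC1 nC2
      (fun a h1 h2 => hdis' h2 h1) (fun x hx y hy h => hn2 y hy x hx h.symm)
      a2 a1 a4 a3 u2 u1 u4 u3 WD0 WC0
    subst e1 e2
    exact hyp.c4 x1 x2 p1 q1 hne (by rintro rfl; exact hdis' hp1 hq1) a1 a3 a2 a4

lemma lemA_use (hyp : Hyp G) {B X : Finset V} (hXB : X ⊆ B) (hX : Conn G X)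
    (PW : ∀ C ⊆ X, Conn G C → W G C 1) (h0 : ¬ W G X 0) {x1 x2 y1 y2 : V}
    (h1 : x1 ∈ X) (h2 : x2 ∈ X) (hne : x1 ≠ x2) (hy1 : y1 ∉ X) (hy2 : y2 ∉ X)
    (a1 : G.Adj x1 y1) (a2 : G.Adj x2 y2)
    (hout : ∀ x ∈ X, ∀ y ∈ B, y ∉ X → G.Adj x y → x = x1 ∨ x = x2)
    (hb : ∀ C ⊆ X \ {x1, x2}, C.Nonempty → 2 ≤ bd G B C) : W G (X \ {x1, x2}) (-1) := by
  refine lemA hyp X.card X rfl hX (fun C hC => PW C hC.1) (tight_mod (PW X subset_rfl hX) h0) h0 x1 h1 x2 h2 hne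
    (hyp.deg2 hy1 a1) (hyp.deg2 hy2 a2) ?_
  intro C hC hCne
  rw [← bd_amb_eq (B := B) (hC.trans Finset.sdiff_subset) hXB]
  · exact hb C hC hCne
  · intro x hx y hy hyX hxy
    have := hC hx
    simp at this
    rcases hout x this.1 y hy hyX hxy with h | h <;> simp [h] at this

lemma drop1_use (hyp : Hyp G) {X : Finset V} (hX : Conn G X)
    (PW : ∀ C ⊆ X, Conn G C → W G C 1) (h0 : ¬ W G X 0) {x y : V}
    (hx : x ∈ X) (hy : y ∉ X) (a : G.Adj x y) : W G (X.erase x) 0 :=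
  drop1' hX (fun C hC => PW C hC.1) hx (hyp.deg2 hy a) (tight_mod (PW X subset_rfl hX) h0)

lemma sdiff_ss {S A : Finset V} (hA : A ⊆ S) (hne : A.Nonempty) : S \ A ⊂ S :=
  Finset.sdiff_ssubset hA hne

lemma gadBr {S A : Finset V} {x y : V} (hA : A ⊆ S) (hx : x ∈ A)
    (hu : ∀ a ∈ A, ∀ b ∈ S \ A, G.Adj a b → a = x ∧ b = y)
    (I1 : W G (A.erase x) 0) (I2 : W G (insert x (S \ A)) 1) : W G S 1 := by
  have J := I1.union I2 (by rw [Finset.disjoint_left]; grind) x (by grind)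
  refine J.to (by norm_num) ?_
  grind

/-- a bridge gives waste one -/
lemma lemBr (hyp : Hyp G) {S A : Finset V} (hS : Conn G S) (PW : ∀ C ⊂ S, Conn G C → W G C 1)
    (hA : A ⊆ S) (hmin : ∀ v ∈ S, 2 ≤ dg G v S) (hb : bd G S A = 1) : W G S 1 := by
  obtain ⟨x, hx, y, hy, hxy, hu⟩ := ee_one hb
  have hyS := (Finset.mem_sdiff.1 hy).1
  have hyA := (Finset.mem_sdiff.1 hy).2
  have hBS : S \ A ⊂ S := sdiff_ss hA ⟨x, hx⟩
  have hAS : A ⊂ S := Finset.ssubset_iff_subset_ne.2 ⟨hA, by rintro rfl; simp at hy⟩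
  have cA : Conn G A := hS.of hA hx (fun a ha b hb hbA hab => (hu a ha b (by simp [*]) hab).1)
  have cB : Conn G (S \ A) := hS.of hBS.1 hy (fun a ha b hb hbA hab =>
    (hu b (by simpa [hb] using hbA) a ha hab.symm).2)
  have wA := PW A hAS cA
  have wB := PW _ hBS cB
  have hdis : Disjoint A (S \ A) := Finset.disjoint_sdiff
  have hun : A ∪ S \ A = S := by rw [Finset.union_comm]; exact Finset.sdiff_union_of_subset hA
  by_cases wA0 : W G A 0
  · have := wA0.union wB hdis x (fun s hs t ht h => Or.inl (hu s hs t ht h).1)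
    rwa [hun] at this
  have I1 := drop1_use hyp cA (fun C hC => PW C (hC.trans_ssubset hAS)) wA0 hx hyA hxy
  have cB' := cB.ins hy hxy
  have I2 := PW _ (by
    refine Finset.ssubset_iff_subset_ne.2 ⟨Finset.insert_subset (hA hx) hBS.1, fun h => ?_⟩
    have h1 := hmin x (hA hx)
    have h2 : A = {x} := by
      ext z; constructor
      · intro hz
        have : z ∈ insert x (S \ A) := by rw [h]; exact hA hz
        simpa [hz] using this
      · intro hz; rw [Finset.mem_singleton] at hz; exact hz ▸ hx
    rw [← bd_single x (hA hx), ← h2] at h1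
    omega) cB'
  exact gadBr hA hx hu I1 I2

lemma gadN {S X Y : Finset V} {u v w x1 x2 y1 y2 : V}
    (memS : ∀ z, z ∈ S ↔ z = u ∨ z = v ∨ z = w ∨ z ∈ X ∨ z ∈ Y)
    (nu' : u ∉ X ∧ u ∉ Y) (nv : v ∉ X ∧ v ∉ Y) (nw : w ∉ X ∧ w ∉ Y) (huv : u ≠ v) (huw : u ≠ w) (hvw : v ≠ w)
    (hdis : ∀ z ∈ X, z ∉ Y) (hn : ∀ x ∈ X, ∀ y ∈ Y, ¬ G.Adj x y) (auv : G.Adj u v) (auw : G.Adj u w)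
    (navw : ¬ G.Adj v w) (hu : ∀ z ∈ S, G.Adj u z → z = v ∨ z = w)
    (hx1 : x1 ∈ X) (hx2 : x2 ∈ X) (hy1 : y1 ∈ Y) (hy2 : y2 ∈ Y) (hx : x1 ≠ x2)
    (a1 : G.Adj v x1) (u1 : ∀ z ∈ X, G.Adj v z → z = x1) (u2 : ∀ z ∈ Y, G.Adj v z → z = y1)
    (u3 : ∀ z ∈ X, G.Adj w z → z = x2)
    (I1 : W G (X \ {x1, x2}) (-1)) (I2 : W G (Y.erase y1) 0) : W G S (-1) := by
  have hu' : ∀ z, z ∈ X ∨ z ∈ Y → ¬ G.Adj u z ∧ ¬ G.Adj z u := by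
    intro z hz
    have h : ¬ G.Adj u z := by grind
    exact ⟨h, fun h' => h h'.symm⟩
  have nw' : ¬ G.Adj w v := fun h => navw h.symm
  have hnY : ∀ x ∈ X, ∀ y ∈ Y, ¬ G.Adj y x := fun x hx y hy h => hn x hx y hy h.symm
  have uw : ∀ z ∈ X, G.Adj z w → z = x2 := fun z hz h => u3 z hz h.symm
  clear hu u3
  have J1 := I1.leaf (u := v) (v := x1) (by grind) (by grind) a1 (by grind)
  have J2 := I2.leaf (u := u) (v := w) (by grind) (by grind) auw (by grind)
  have J3 := J1.union J2 (by rw [Finset.disjoint_left]; grind) v (by grind)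
  have J4 := (J3.ins x2).ins y1
  convert J4.le (show _ ≤ (-1:ℤ) by norm_num) using 1
  ext z
  rw [memS]
  simp only [FM]
  clear * - hx1 hx2 hy1
  grind

/-- bridgeless case with a vertex of degree two -/
lemma lemN3 (hyp : Hyp G) {S : Finset V} (hS : Conn G S) (PW : ∀ C ⊂ S, Conn G C → W G C 1)
    (hb2 : ∀ C ⊆ S, C.Nonempty → C ≠ S → 2 ≤ bd G S C) {u : V} (hu : u ∈ S) (hd : dg G u S = 2) :
    W G S 1 := by
  obtain ⟨v, hv, w, hw, hvw, auv, auw, hun⟩ := dg_two hd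
  have huv : u ≠ v := auv.ne
  have huw : u ≠ w := auw.ne
  have navw : ¬ G.Adj v w := fun h => hyp.tri u v w auv h auw
  have hsubR : ({u, v, w} : Finset V) ⊆ S := by
    intro z hz; simp at hz; rcases hz with rfl | rfl | rfl <;> assumption
  have hss : S \ {u, v, w} ⊂ S := sdiff_ss hsubR (by simp)
  have nuS : ∀ z ∈ S \ {u, v, w}, ¬ G.Adj u z := by
    intro z hz h
    simp at hz
    rcases hun z hz.1 h with rfl | rfl <;> simp at hz
  have fin : W G (S \ {u, v, w}) 1 → W G S 1 := by
    intro h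
    have J := (h.leaf (u := u) (v := v) (by simp) (by simp) auv nuS).ins w
    refine J.to (by norm_num) ?_
    clear * - hu hv hw
    ext z; simp only [FM]; grind
  have hbT : bd G S (S \ {u, v, w}) ≤ 4 := by
    rw [bd_compl hsubR]
    have m1 := bd_move (G := G) (C := {w}) hv (by simpa using hvw) (by simpa using hw)
    have m2 := bd_move (G := G) (C := {v, w}) hu (by simp [huv, huw])
      (by intro z hz; simp at hz; rcases hz with rfl | rfl <;> assumption)
    rw [bd_single _ hw] at m1
    rw [dg_insert _ _ (by simpa using hvw), dg_single] at m2
    simp [auv, auw] at m2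
    have := hyp.deg v S
    have := hyp.deg w S
    omega
  rcases split3 (G := G) 2 hss.1 (fun C hC hne => hb2 C (hC.trans hss.1) hne
      (by rintro rfl; exact absurd hss (by
        intro h; exact (Finset.ssubset_iff_subset_ne.1 (hC.trans_ssubset h)).2 rfl))) (by omega)
    with h | h | ⟨X, Y, hX, hY, hdis, hU, hn, hbs⟩
  · exact fin (h ▸ W.empty.le (by norm_num))
  · exact fin (PW _ hss h)
  have hXs : X ⊆ S \ {u, v, w} := by rw [← hU]; exact Finset.subset_union_left
  have hYs : Y ⊆ S \ {u, v, w} := by rw [← hU]; exact Finset.subset_union_right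
  have WX := PW X (hXs.trans_ssubset hss) hX
  have WY := PW Y (hYs.trans_ssubset hss) hY
  by_cases WX0 : W G X 0
  · apply fin; rw [← hU]; exact (W.union0 WX0 WY hdis hn).le (by norm_num)
  by_cases WY0 : W G Y 0
  · apply fin; rw [← hU]; exact (W.union0 WX WY0 hdis hn).le (by norm_num)
  have hdis' : ∀ z ∈ X, z ∉ Y := fun z h1 h2 => Finset.disjoint_left.1 hdis h1 h2
  have memS : ∀ z, z ∈ S ↔ z = u ∨ z = v ∨ z = w ∨ z ∈ X ∨ z ∈ Y := by
    intro z
    have : S = insert u (insert v (insert w (X ∪ Y))) := by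
      rw [hU]; clear * - hu hv hw; ext z; simp only [FM]; grind
    rw [this]; simp
  have nX : ∀ z ∈ X, z ≠ u ∧ z ≠ v ∧ z ≠ w := fun z hz => by simpa using (Finset.mem_sdiff.1 (hXs hz)).2
  have nY : ∀ z ∈ Y, z ≠ u ∧ z ≠ v ∧ z ≠ w := fun z hz => by simpa using (Finset.mem_sdiff.1 (hYs hz)).2
  have uX : u ∉ X := fun h => (nX u h).1 rfl
  have uY : u ∉ Y := fun h => (nY u h).1 rfl
  have vX : v ∉ X := fun h => (nX v h).2.1 rfl
  have vY : v ∉ Y := fun h => (nY v h).2.1 rfl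
  have wX : w ∉ X := fun h => (nX w h).2.2 rfl
  have wY : w ∉ Y := fun h => (nY w h).2.2 rfl
  have duX : dg G u X = 0 := dg_zero.2 fun z hz => nuS z (hXs hz)
  have duY : dg G u Y = 0 := dg_zero.2 fun z hz => nuS z (hYs hz)
  have bX : bd G S X = dg G v X + dg G w X := by
    unfold bd
    rw [show S \ X = insert u (insert v (insert w Y)) by
        ext z; simp only [FM, memS]; clear * - hdis' uX vX wX; grind,
      ee_insert_right _ (by simp [huv, huw, uY]), ee_insert_right _ (by simp [hvw, vY]),
      ee_insert_right _ wY, ee_zero.2 hn]; omega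
  have bY : bd G S Y = dg G v Y + dg G w Y := by
    unfold bd
    rw [show S \ Y = insert u (insert v (insert w X)) by
        ext z; simp only [FM, memS]; clear * - hdis' uY vY wY; grind,
      ee_insert_right _ (by simp [huv, huw, uX]), ee_insert_right _ (by simp [hvw, vX]),
      ee_insert_right _ wX, ee_comm, ee_zero.2 hn]; omega
  have s1 : dg G v X + dg G v Y ≤ 2 := by
    rw [← dg_union _ hdis]; exact hyp.deg2 (x := u) (by simp [uX, uY]) auv.symm
  have s2 : dg G w X + dg G w Y ≤ 2 := by
    rw [← dg_union _ hdis]; exact hyp.deg2 (x := u) (by simp [uX, uY]) auw.symm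
  have neS : ∀ C : Finset V, u ∉ C → C ≠ S := by rintro C h rfl; exact h hu
  have b1 := hb2 X (hXs.trans hss.1) hX.1 (neS X uX)
  have b2 := hb2 Y (hYs.trans hss.1) hY.1 (neS Y uY)
  have mX := bd_move (G := G) hv vX (hXs.trans hss.1)
  have mY := bd_move (G := G) hv vY (hYs.trans hss.1)
  have pX := hb2 (insert v X) (Finset.insert_subset hv (hXs.trans hss.1)) (by simp) (neS _ (by simp [huv, uX]))
  have pY := hb2 (insert v Y) (Finset.insert_subset hv (hYs.trans hss.1)) (by simp) (neS _ (by simp [huv, uY]))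
  have dv := hyp.deg v S
  obtain ⟨x1, hx1, a1, u1⟩ := dg_one (by omega : dg G v X = 1)
  obtain ⟨y1, hy1, a2, u2⟩ := dg_one (by omega : dg G v Y = 1)
  obtain ⟨x2, hx2, a3, u3⟩ := dg_one (by omega : dg G w X = 1)
  obtain ⟨y2, hy2, a4, u4⟩ := dg_one (by omega : dg G w Y = 1)
  have hx : x1 ≠ x2 := by
    rintro rfl
    exact hyp.c4 v w u x1 hvw (nX x1 hx1).1.symm auv.symm auw.symm a1 a3
  have I1 := lemA_use hyp (hXs.trans hss.1) hX (fun C hC => PW C (hC.trans_ssubset (hXs.trans_ssubset hss))) WX0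
    hx1 hx2 hx vX wX a1.symm a3.symm (by
      intro x hx y hy hyX hxy
      have h' := hxy.symm
      rcases (memS y).1 hy with rfl | rfl | rfl | h | h
      · exact absurd h' (nuS x (hXs hx))
      · exact Or.inl (u1 x hx h')
      · exact Or.inr (u3 x hx h')
      · exact absurd h hyX
      · exact absurd hxy (hn x hx y h))
    (fun C hC hne => by
      have hC' : C ⊆ X := hC.trans Finset.sdiff_subset
      exact hb2 C (hC'.trans (hXs.trans hss.1)) hne (neS C fun h => uX (hC' h)))
  have I2 := drop1_use hyp hY (fun C hC => PW C (hC.trans_ssubset (hYs.trans_ssubset hss))) WY0 hy1 vY a2.symm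
  exact (gadN memS ⟨uX, uY⟩ ⟨vX, vY⟩ ⟨wX, wY⟩ huv huw hvw hdis' hn auv auw navw hun hx1 hx2 hy1 hy2 hx a1 u1 u2 u3
    I1 I2).le (by norm_num)

theorem thmN (hyp : Hyp G) (n : ℕ) : ∀ S : Finset V, S.card = n → Conn G S → (∃ u ∈ S, dg G u S ≤ 2) →
    W G S 1 := by
  induction n using Nat.strong_induction_on with
  | _ n ih =>
  rintro S hn hS ⟨u, hu, hdu⟩
  have PW : ∀ C ⊂ S, Conn G C → W G C 1 := fun C hC hCc =>
    ih C.card (hn ▸ Finset.card_lt_card hC) C rfl hCc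
      (hS.lowdeg hC.1 hCc.1 (Finset.ssubset_iff_subset_ne.1 hC).2 hyp)
  by_cases h1 : ∃ v ∈ S, dg G v S ≤ 1
  · obtain ⟨v, hv, hdv⟩ := h1
    by_cases hSv : S = {v}
    · rw [hSv]; exact W.single v
    have hp := hS.2 {v} (by simpa using hv) (by simp) (fun h => hSv h.symm)
    rw [bd_single v hv] at hp
    obtain ⟨w, hw, avw, hun⟩ := dg_one (by omega : dg G v S = 1)
    have cS : Conn G (S.erase v) := hS.of (Finset.erase_subset _ _) (x := w) (by simp [hw, avw.ne']) (by
      intro a ha b hb hb2 hab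
      have : b = v := by simpa [hb] using hb2
      subst this
      exact hun a (Finset.mem_of_mem_erase ha) hab.symm)
    have I := drop1 cS (fun C hC => PW C (hC.trans (Finset.erase_ssubset hv))) (x := w) (by simp [hw, avw.ne'])
      (hyp.deg2 (x := v) (by simp) avw.symm)
    have J := I.leaf (u := v) (v := w) (by simp) (by simp) avw (by
      intro z hz hvz
      simp at hz
      exact hz.1 (hun z hz.2.2 hvz))
    refine J.to (by norm_num) ?_
    rw [Finset.insert_erase (by simp [hw, avw.ne']), Finset.insert_erase hv]
  · push Not at h1
    have hmin : ∀ v ∈ S, 2 ≤ dg G v S := fun v hv => h1 v hv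
    by_cases h2 : ∃ A ⊆ S, bd G S A = 1
    · obtain ⟨A, hA, hb⟩ := h2
      exact lemBr hyp hS PW hA hmin hb
    · push Not at h2
      refine lemN3 hyp hS PW (fun C hC hne hCS => ?_) hu (le_antisymm hdu (hmin u hu))
      have := hS.2 C hC hne hCS
      have := h2 C hC
      omega

variable (G) in
structure Cub : Prop where
  hyp : Hyp G
  cub : ∀ v, dg G v Finset.univ = 3
  conn : Conn G Finset.univ
  no : ¬ W G Finset.univ 1

lemma Cub.PW (h : Cub G) {C : Finset V} (hC : C ≠ Finset.univ) (hc : Conn G C) : W G C 1 :=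
  thmN h.hyp C.card C rfl hc (h.conn.lowdeg (Finset.subset_univ _) hc.1 hC h.hyp)

lemma Cub.step1 (h : Cub G) {C : Finset V} (hne : C.Nonempty) (hC : C ≠ Finset.univ) :
    2 ≤ bd G Finset.univ C := by
  have h1 := h.conn.2 C (Finset.subset_univ _) hne hC
  have h2 : bd G Finset.univ C ≠ 1 := fun h2 => h.no (lemBr h.hyp h.conn
    (fun D hD hc => h.PW (Finset.ssubset_iff_subset_ne.1 hD).2 hc) (Finset.subset_univ C)
    (fun v _ => by rw [h.cub]; norm_num) h2)
  omega

lemma Cub.bd_drop (h : Cub G) {X : Finset V} {x : V} (hx : x ∈ X) :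
    bd G Finset.univ (X.erase x) + 2 * dg G x (Finset.univ \ X) = bd G Finset.univ X + 3 := by
  have h1 := bd_move (G := G) (B := Finset.univ) (v := x) (C := X.erase x) (by simp) (by simp) (by simp)
  rw [Finset.insert_erase hx, h.cub] at h1
  have h2 := dg_erase (G := G) x x hx
  have h3 := dg_sdiff (G := G) x (Finset.subset_univ X)
  rw [h.cub] at h3
  simp at h2
  omega

lemma Cub.small (h : Cub G) {T : Finset V} (m : ℕ)
    (hm : ∀ C : Finset V, C.Nonempty → C ⊆ T → m ≤ bd G Finset.univ C) (hT : T ≠ Finset.univ)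
    (hb : bd G Finset.univ T < 2 * m) : W G T 1 := by
  rcases split2 (G := G) m (Finset.subset_univ T) (fun C hC hne => hm C hne hC) hb with h1 | h1
  · rw [h1]; exact W.empty.le (by norm_num)
  · exact h.PW hT h1

lemma ee_two' {C D : Finset V} (h : ee G C D = 2) (hC : ∀ x ∈ C, dg G x D ≤ 1) (hD : ∀ y ∈ D, dg G y C ≤ 1) :
    ∃ x1 ∈ C, ∃ x2 ∈ C, ∃ y1 ∈ D, ∃ y2 ∈ D, x1 ≠ x2 ∧ y1 ≠ y2 ∧ G.Adj x1 y1 ∧ G.Adj x2 y2 ∧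
      ∀ a ∈ C, ∀ b ∈ D, G.Adj a b → (a = x1 ∧ b = y1) ∨ (a = x2 ∧ b = y2) := by
  obtain ⟨x1, hx1, y1, hy1, a1⟩ := ee_pos.1 (by omega : 0 < ee G C D)
  have d1 : 0 < dg G x1 D := dg_pos.2 ⟨y1, hy1, a1⟩
  have d2 := hC x1 hx1
  rw [ee_dg hx1] at h
  obtain ⟨x2, hx2, y2, hy2, a2, hu⟩ := ee_one (by omega : ee G (C.erase x1) D = 1)
  simp at hx2
  refine ⟨x1, hx1, x2, hx2.2, y1, hy1, y2, hy2, Ne.symm hx2.1, ?_, a1, a2, ?_⟩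
  · rintro rfl
    exact hx2.1 (dg_one_le hx1 a1.symm (hD y1 hy1) x2 hx2.2 a2.symm)
  · intro a ha b hb hab
    by_cases hax : a = x1
    · subst hax; exact Or.inl ⟨rfl, dg_one_le hy1 a1 d2 b hb hab⟩
    · exact Or.inr (hu a (by simp [*]) b hb hab)

lemma ee_three' {C D : Finset V} (h : ee G C D = 3) (hC : ∀ x ∈ C, dg G x D ≤ 1) (hD : ∀ y ∈ D, dg G y C ≤ 1) :
    ∃ x1 ∈ C, ∃ x2 ∈ C, ∃ x3 ∈ C, ∃ y1 ∈ D, ∃ y2 ∈ D, ∃ y3 ∈ D, x1 ≠ x2 ∧ x1 ≠ x3 ∧ x2 ≠ x3 ∧ y1 ≠ y2 ∧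
      y1 ≠ y3 ∧ y2 ≠ y3 ∧ G.Adj x1 y1 ∧ G.Adj x2 y2 ∧ G.Adj x3 y3 ∧
      ∀ a ∈ C, ∀ b ∈ D, G.Adj a b → (a = x1 ∧ b = y1) ∨ (a = x2 ∧ b = y2) ∨ (a = x3 ∧ b = y3) := by
  obtain ⟨x1, hx1, y1, hy1, a1⟩ := ee_pos.1 (by omega : 0 < ee G C D)
  have d1 : 0 < dg G x1 D := dg_pos.2 ⟨y1, hy1, a1⟩
  have d2 := hC x1 hx1
  rw [ee_dg hx1] at h
  obtain ⟨x2, hx2, x3, hx3, y2, hy2, y3, hy3, n1, n2, a2, a3, hu⟩ := ee_two' (by omega : ee G (C.erase x1) D = 2)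
    (fun x hx => hC x (Finset.mem_of_mem_erase hx))
    (fun y hy => (dg_mono y (Finset.erase_subset _ _)).trans (hD y hy))
  simp at hx2 hx3
  refine ⟨x1, hx1, x2, hx2.2, x3, hx3.2, y1, hy1, y2, hy2, y3, hy3, Ne.symm hx2.1, Ne.symm hx3.1, n1, ?_, ?_, n2,
    a1, a2, a3, ?_⟩
  · rintro rfl
    exact hx2.1 (dg_one_le hx1 a1.symm (hD y1 hy1) x2 hx2.2 a2.symm)
  · rintro rfl
    exact hx3.1 (dg_one_le hx1 a1.symm (hD y1 hy1) x3 hx3.2 a3.symm)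
  · intro a ha b hb hab
    by_cases hax : a = x1
    · subst hax; exact Or.inl ⟨rfl, dg_one_le hy1 a1 d2 b hb hab⟩
    · exact Or.inr (hu a (by simp [*]) b hb hab)

variable (G) in
structure Cut2 (X R : Finset V) (x1 x2 r1 r2 : V) : Prop where
  cov : ∀ z, z ∈ X ∨ z ∈ R
  dis : ∀ z ∈ X, z ∉ R
  mx1 : x1 ∈ X
  mx2 : x2 ∈ X
  mr1 : r1 ∈ R
  mr2 : r2 ∈ R
  nx : x1 ≠ x2
  nr : r1 ≠ r2
  a1 : G.Adj x1 r1
  a2 : G.Adj x2 r2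
  only : ∀ a ∈ X, ∀ b ∈ R, G.Adj a b → (a = x1 ∧ b = r1) ∨ (a = x2 ∧ b = r2)
  bX : bd G Finset.univ X = 2

lemma compl_of {X R : Finset V} (cov : ∀ z, z ∈ X ∨ z ∈ R) (dis : ∀ z ∈ X, z ∉ R) : R = Finset.univ \ X := by
  ext z; have := cov z; have := dis z; simp; tauto

lemma Cut2.symm {X R : Finset V} {x1 x2 r1 r2 : V} (h : Cut2 G X R x1 x2 r1 r2) : Cut2 G R X r1 r2 x1 x2 where
  cov z := (h.cov z).symm
  dis z h1 h2 := h.dis z h2 h1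
  mx1 := h.mr1
  mx2 := h.mr2
  mr1 := h.mx1
  mr2 := h.mx2
  nx := h.nr
  nr := h.nx
  a1 := h.a1.symm
  a2 := h.a2.symm
  only a ha b hb hab := by have := h.only b hb a ha hab.symm; tauto
  bX := by rw [compl_of h.cov h.dis, bd_compl (Finset.subset_univ _), h.bX]

lemma Cut2.ne {X R : Finset V} {x1 x2 r1 r2 : V} (h : Cut2 G X R x1 x2 r1 r2) {T : Finset V} (hT : T ⊆ X) :
    T ≠ Finset.univ := by
  rintro rfl; exact h.dis _ (hT (Finset.mem_univ r1)) h.mr1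

lemma Cut2.W0 (hc : Cub G) {X R : Finset V} {x1 x2 r1 r2 : V} (h : Cut2 G X R x1 x2 r1 r2) : W G X 1 :=
  hc.small 2 (fun C hne hC => hc.step1 hne (h.ne hC)) (h.ne subset_rfl) (by rw [h.bX]; norm_num)

lemma Cut2.W1 (hc : Cub G) {X R : Finset V} {x1 x2 r1 r2 : V} (h : Cut2 G X R x1 x2 r1 r2) : W G (X.erase x1) 1 := by
  refine hc.small 2 (fun C hne hC => hc.step1 hne (h.ne (hC.trans (Finset.erase_subset _ _))))
    (h.ne (Finset.erase_subset _ _)) ?_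
  have h1 := hc.bd_drop h.mx1
  have h2 : 0 < dg G x1 (Finset.univ \ X) := dg_pos.2 ⟨r1, by rw [← compl_of h.cov h.dis]; exact h.mr1, h.a1⟩
  rw [h.bX] at h1
  omega

lemma Cut2.g1 {X R : Finset V} {x1 x2 r1 r2 : V} (h : Cut2 G X R x1 x2 r1 r2) {a b : ℤ}
    (I1 : W G (X.erase x1) a) (I2 : W G R b) (hab : a + b ≤ 0) : W G Finset.univ 1 := by
  obtain ⟨cov, dis, h1, h2, h3, h4, nx, nr, a1, a2, only, -⟩ := h
  have J := (I1.union I2 (by rw [Finset.disjoint_left]; grind) x2 (by grind)).ins x1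
  refine J.to (by omega) ?_
  ext z; have := cov z; simp; tauto

lemma Cut2.g2 {X R : Finset V} {x1 x2 r1 r2 : V} (h : Cut2 G X R x1 x2 r1 r2)
    (I1 : W G (X \ {x1, x2}) (-1)) (I2 : W G (insert x1 R) 1) : W G Finset.univ 1 := by
  obtain ⟨cov, dis, h1, h2, h3, h4, nx, nr, a1, a2, only, -⟩ := h
  have J := (I1.union I2 (by rw [Finset.disjoint_left]; grind) x1 (by grind)).ins x2
  refine J.to (by omega) ?_
  ext z; have := cov z; simp; tauto

lemma Cut2.conn (hc : Cub G) {X R : Finset V} {x1 x2 r1 r2 : V} (h : Cut2 G X R x1 x2 r1 r2) : Conn G X := by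
  rcases split2 (G := G) 2 (Finset.subset_univ X) (fun C hC hne => hc.step1 hne (h.ne hC)) (by rw [h.bX]; norm_num)
    with h1 | h1
  · have := h.mx1; rw [h1] at this; simp at this
  · exact h1

lemma Cut2.false (hc : Cub G) {X R : Finset V} {x1 x2 r1 r2 : V} (h : Cut2 G X R x1 x2 r1 r2) : False := by
  apply hc.no
  have wX := h.W0 hc
  have wR := h.symm.W0 hc
  have wX1 := h.W1 hc
  have wR1 := h.symm.W1 hc
  have cX : (X.erase x1).card + 1 = X.card := Finset.card_erase_add_one h.mx1
  have cR : (R.erase r1).card + 1 = R.card := Finset.card_erase_add_one h.mr1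
  rcases (by omega : X.card % 3 = 0 ∨ R.card % 3 = 0 ∨ (X.card % 3 = 1 ∧ R.card % 3 = 2) ∨
    (X.card % 3 = 2 ∧ R.card % 3 = 1) ∨ (X.card % 3 = 2 ∧ R.card % 3 = 2) ∨ (X.card % 3 = 1 ∧ R.card % 3 = 1))
    with h1 | h1 | h1 | h1 | h1 | h1
  · exact h.g1 (wX1.mod (-1) (by norm_num) (by omega)) wR (by norm_num)
  · exact h.symm.g1 (wR1.mod (-1) (by norm_num) (by omega)) wX (by norm_num)
  · exact h.g1 (wX1.mod 0 (by norm_num) (by omega)) (wR.mod (-1) (by norm_num) (by omega)) (by norm_num)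
  · exact h.symm.g1 (wR1.mod 0 (by norm_num) (by omega)) (wX.mod (-1) (by norm_num) (by omega)) (by norm_num)
  · exact h.symm.g1 wR1 (wX.mod (-1) (by norm_num) (by omega)) (by norm_num)
  · by_cases w0 : W G X 0
    · exact h.symm.g1 (wR1.mod 0 (by norm_num) (by omega)) w0 (by norm_num)
    · refine h.g2 (lemA_use hc.hyp (Finset.subset_univ X) (h.conn hc) (fun C hC hCc => hc.PW (h.ne hC) hCc) w0 h.mx1 h.mx2
        h.nx (fun h' => h.dis _ h' h.mr1) (fun h' => h.dis _ h' h.mr2) h.a1 h.a2 ?_ ?_) ?_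
      · intro x hx y _ hy hxy
        have := h.only x hx y ((h.cov y).resolve_left hy) hxy
        tauto
      · intro C hC hne
        exact hc.step1 hne (h.ne (hC.trans Finset.sdiff_subset))
      · refine hc.PW ?_ ((h.symm.conn hc).ins h.mr1 h.a1)
        intro h'
        have : x2 ∈ insert x1 R := h' ▸ Finset.mem_univ x2
        simp [h.nx.symm] at this
        exact h.dis _ h.mx2 this

/-- outside degree is at most one for a minimal cut -/
lemma Cub.outdeg (h : Cub G) {X : Finset V} (m : ℕ) (hm : ∀ C ⊆ X, C.Nonempty → m ≤ bd G Finset.univ C)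
    (hb : bd G Finset.univ X = m) (hX : ∀ x, X ≠ {x}) : ∀ x ∈ X, dg G x (Finset.univ \ X) ≤ 1 := by
  intro x hx
  have h1 := h.bd_drop hx
  have h2 := hm (X.erase x) (Finset.erase_subset _ _) (by
    rw [Finset.nonempty_iff_ne_empty]; intro h'
    rw [Finset.erase_eq_empty_iff] at h'
    rcases h' with h' | h'
    · rw [h'] at hx; simp at hx
    · exact hX x h')
  omega

lemma Cub.step2 (h : Cub G) {C : Finset V} (hne : C.Nonempty) (hC : C ≠ Finset.univ) :
    3 ≤ bd G Finset.univ C := by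
  have h1 := h.step1 hne hC
  by_contra h2
  have h3 : bd G Finset.univ C = 2 := by omega
  have h4 : bd G Finset.univ (Finset.univ \ C) = 2 := by rw [bd_compl (Finset.subset_univ _), h3]
  have hs : ∀ x : V, bd G Finset.univ {x} = 3 := fun x => by rw [bd_single x (by simp), h.cub]
  have o1 := h.outdeg 2 (fun D hD hDne => h.step1 hDne (by
    rintro rfl; exact hC (Finset.univ_subset_iff.1 hD))) h3 (by rintro x rfl; rw [hs] at h3; omega)
  have o2 := h.outdeg 2 (X := Finset.univ \ C) (fun D hD hDne => h.step1 hDne (by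
    rintro rfl; obtain ⟨z, hz⟩ := hne; have := hD (Finset.mem_univ z); simp [hz] at this)) h4
    (by rintro x hx; rw [hx, hs] at h4; omega)
  rw [Finset.sdiff_sdiff_eq_self (Finset.subset_univ _)] at o2
  obtain ⟨x1, hx1, x2, hx2, y1, hy1, y2, hy2, n1, n2, a1, a2, hu⟩ := ee_two' h3 o1 o2
  exact Cut2.false h (X := C) (R := Finset.univ \ C) (x1 := x1) (x2 := x2) (r1 := y1) (r2 := y2)
    ⟨by intro z; by_cases hz : z ∈ C <;> simp [hz], by intro z hz; simp [hz], hx1, hx2, hy1, hy2, n1, n2, a1, a2, hu, h3⟩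

variable (G) in
structure Cut3 (X R : Finset V) (x1 x2 x3 r1 r2 r3 : V) : Prop where
  cov : ∀ z, z ∈ X ∨ z ∈ R
  dis : ∀ z ∈ X, z ∉ R
  mx1 : x1 ∈ X
  mx2 : x2 ∈ X
  mx3 : x3 ∈ X
  mr1 : r1 ∈ R
  mr2 : r2 ∈ R
  mr3 : r3 ∈ R
  nx : x1 ≠ x2 ∧ x1 ≠ x3 ∧ x2 ≠ x3
  nr : r1 ≠ r2 ∧ r1 ≠ r3 ∧ r2 ≠ r3
  a1 : G.Adj x1 r1
  a2 : G.Adj x2 r2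
  a3 : G.Adj x3 r3
  only : ∀ a ∈ X, ∀ b ∈ R, G.Adj a b → (a = x1 ∧ b = r1) ∨ (a = x2 ∧ b = r2) ∨ (a = x3 ∧ b = r3)
  bX : bd G Finset.univ X = 3

section
variable {X R : Finset V} {x1 x2 x3 r1 r2 r3 : V}

lemma Cut3.symm (h : Cut3 G X R x1 x2 x3 r1 r2 r3) : Cut3 G R X r1 r2 r3 x1 x2 x3 where
  cov z := (h.cov z).symm
  dis z h1 h2 := h.dis z h2 h1
  mx1 := h.mr1
  mx2 := h.mr2
  mx3 := h.mr3
  mr1 := h.mx1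
  mr2 := h.mx2
  mr3 := h.mx3
  nx := h.nr
  nr := h.nx
  a1 := h.a1.symm
  a2 := h.a2.symm
  a3 := h.a3.symm
  only a ha b hb hab := by have := h.only b hb a ha hab.symm; tauto
  bX := by rw [compl_of h.cov h.dis, bd_compl (Finset.subset_univ _), h.bX]

lemma Cut3.ne (h : Cut3 G X R x1 x2 x3 r1 r2 r3) {T : Finset V} (hT : T ⊆ X) : T ≠ Finset.univ := by
  rintro rfl; exact h.dis _ (hT (Finset.mem_univ r1)) h.mr1

lemma Cut3.sm (hc : Cub G) (h : Cut3 G X R x1 x2 x3 r1 r2 r3) {T : Finset V} (hT : T ⊆ X)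
    (hb : bd G Finset.univ T < 6) : W G T 1 :=
  hc.small 3 (fun C hne hC => hc.step2 hne (h.ne (hC.trans hT))) (h.ne hT) hb

lemma Cut3.b1 (hc : Cub G) (h : Cut3 G X R x1 x2 x3 r1 r2 r3) : bd G Finset.univ (X.erase x1) ≤ 4 := by
  have h1 := hc.bd_drop h.mx1
  have h2 : 0 < dg G x1 (Finset.univ \ X) := dg_pos.2 ⟨r1, by rw [← compl_of h.cov h.dis]; exact h.mr1, h.a1⟩
  rw [h.bX] at h1
  omega

lemma Cut3.b2 (hc : Cub G) (h : Cut3 G X R x1 x2 x3 r1 r2 r3) :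
    bd G Finset.univ ((X.erase x1).erase x2) ≤ 5 := by
  have h1 := hc.bd_drop (X := X.erase x1) (x := x2) (by simp [h.mx2, h.nx.1.symm])
  have h2 : 0 < dg G x2 (Finset.univ \ X.erase x1) := dg_pos.2 ⟨r2, by
    have := h.dis r2; have := h.mr2; simp; tauto, h.a2⟩
  have := h.b1 hc
  omega

lemma Cut3.b3 (hc : Cub G) (h : Cut3 G X R x1 x2 x3 r1 r2 r3) :
    bd G Finset.univ (((X.erase x1).erase x2).erase x3) ≤ 6 := by
  have h1 := hc.bd_drop (X := (X.erase x1).erase x2) (x := x3)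
    (by simp [h.mx3, h.nx.2.1.symm, h.nx.2.2.symm])
  have h2 : 0 < dg G x3 (Finset.univ \ (X.erase x1).erase x2) := dg_pos.2 ⟨r3, by
    have := h.dis r3; have := h.mr3; simp; tauto, h.a3⟩
  have := h.b2 hc
  omega

lemma Cut3.g1 (h : Cut3 G X R x1 x2 x3 r1 r2 r3) {a b : ℤ}
    (I1 : W G (X.erase x1) a) (I2 : W G (R.erase r2) b) (hab : a + b ≤ -1) : W G Finset.univ 1 := by
  obtain ⟨cov, dis, h1, h2, h3, h4, h5, h6, nx, nr, a1, a2, a3, only, -⟩ := h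
  have J := ((I1.union I2 (by rw [Finset.disjoint_left]; grind) x3 (by grind)).ins x1).ins r2
  refine J.to (by omega) ?_
  ext z; have := cov z; simp; tauto

lemma Cut3.g11 (h : Cut3 G X R x1 x2 x3 r1 r2 r3)
    (I1 : W G ((X.erase x1).erase x2) (-1)) (I2 : W G ((R.erase r1).erase r3) (-1)) : W G Finset.univ 1 := by
  obtain ⟨cov, dis, h1, h2, h3, h4, h5, h6, nx, nr, a1, a2, a3, only, -⟩ := h
  have a1' := a1.symm
  have J := I1.leaf (u := r1) (v := x1) (by grind) (by grind) a1' (by intro z hz hh; have := hh.symm; grind)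
  have J := ((J.union I2 (by rw [Finset.disjoint_left]; grind) r1 (by grind)).ins x2).ins r3
  refine J.to (by omega) ?_
  ext z; have := cov z; simp; tauto

lemma Cut3.g12 (h : Cut3 G X R x1 x2 x3 r1 r2 r3) {a b : ℤ}
    (I1 : W G ((X.erase x1).erase x2) a) (I2 : W G R b) (hab : a + b ≤ -1) : W G Finset.univ 1 := by
  obtain ⟨cov, dis, h1, h2, h3, h4, h5, h6, nx, nr, a1, a2, a3, only, -⟩ := h
  have J := ((I1.union I2 (by rw [Finset.disjoint_left]; grind) x3 (by grind)).ins x1).ins x2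
  refine J.to (by omega) ?_
  ext z; have := cov z; simp; tauto

lemma Cut3.g02 (h : Cut3 G X R x1 x2 x3 r1 r2 r3)
    (I1 : W G (X.erase x1) (-1)) (I2 : W G (((R.erase r1).erase r2).erase r3) (-1)) : W G Finset.univ 1 := by
  obtain ⟨cov, dis, h1, h2, h3, h4, h5, h6, nx, nr, a1, a2, a3, only, -⟩ := h
  have a1' := a1.symm
  have J := I1.leaf (u := r1) (v := x1) (by grind) (by grind) a1' (by intro z hz hh; have := hh.symm; grind)
  have J := ((J.union I2 (by rw [Finset.disjoint_left]; grind) r1 (by grind)).ins r2).ins r3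
  refine J.to (by omega) ?_
  ext z; have := cov z; simp; tauto

lemma Cut3.g02' (h : Cut3 G X R x1 x2 x3 r1 r2 r3) {C D : Finset V} {p1 p2 q1 q2 : V}
    (memR : ∀ z, z ∈ R ↔ z = r1 ∨ z = r2 ∨ z = r3 ∨ z ∈ C ∨ z ∈ D)
    (nC : r1 ∉ C ∧ r2 ∉ C ∧ r3 ∉ C) (nD : r1 ∉ D ∧ r2 ∉ D ∧ r3 ∉ D)
    (hdis : ∀ z ∈ C, z ∉ D) (hn : ∀ x ∈ C, ∀ y ∈ D, ¬ G.Adj x y)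
    (hp1 : p1 ∈ C) (hp2 : p2 ∈ C) (hq1 : q1 ∈ D) (hq2 : q2 ∈ D) (hp : p1 ≠ p2)
    (b1 : G.Adj r1 p1) (b2 : G.Adj r2 p2) (n12 : ¬ G.Adj r1 r2)
    (u1 : ∀ z ∈ C, G.Adj r1 z → z = p1) (u2 : ∀ z ∈ C, G.Adj r2 z → z = p2)
    (u3 : ∀ z ∈ D, G.Adj r1 z → z = q1) (u4 : ∀ z ∈ D, G.Adj r2 z → z = q2)
    (I1 : W G (X.erase x1) (-1)) (I2 : W G (C \ {p1, p2}) (-1)) (I3 : W G (D.erase q1) 0) :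
    W G Finset.univ 1 := by
  obtain ⟨cov, dis, h1, h2, h3, h4, h5, h6, nx, nr, a1, a2, a3, only, -⟩ := h
  have only' : ∀ b ∈ R, ∀ a ∈ X, G.Adj b a → (a = x1 ∧ b = r1) ∨ (a = x2 ∧ b = r2) ∨ (a = x3 ∧ b = r3) :=
    fun b hb a ha hh => only a ha b hb hh.symm
  have e2 : r2 ∉ X := fun h => dis _ h h5
  have e1 : r1 ∉ X := fun h => dis _ h h4
  have J := I2.leaf (u := r2) (v := p2) (by grind) (by grind) b2 (by grind)
  have J := J.union I3 (by rw [Finset.disjoint_left]; grind) r2 (by grind)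
  have J := J.union I1 (by rw [Finset.disjoint_left]; grind) r2 (by grind)
  have J := J.leaf (u := r1) (v := p1) (by grind) (by grind) b1 (by
    intro z hz hh
    simp only [FM] at hz
    rcases hz with ((hz | hz | hz) | hz) | hz
    · subst hz; exact n12 hh
    · subst hz; exact hp (u1 z hp2 hh).symm
    · have := u1 z hz.1 hh; tauto
    · exact hz.1 (u3 z hz.2 hh)
    · have := only' r1 h4 z hz.2 hh; have := nr.1; have := nr.2.1; tauto)
  refine (((J.ins q1).ins x1).ins r3).to (by norm_num) ?_
  ext z; have cz := cov z; have mz := memR z; rw [mz] at cz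
  simp only [FM, Finset.mem_univ, true_iff]
  clear * - cz; tauto

lemma Cut3.two (hc : Cub G) (h : Cut3 G X R x1 x2 x3 r1 r2 r3) {C D : Finset V} (cC : Conn G C) (cD : Conn G D)
    (hdis : ∀ z ∈ C, z ∉ D) (hn : ∀ x ∈ C, ∀ y ∈ D, ¬ G.Adj x y)
    (memR : ∀ z, z ∈ R ↔ z = r1 ∨ z = r2 ∨ z = r3 ∨ z ∈ C ∨ z ∈ D)
    (nC : r1 ∉ C ∧ r2 ∉ C ∧ r3 ∉ C) (nD : r1 ∉ D ∧ r2 ∉ D ∧ r3 ∉ D)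
    (wC : ¬ W G C 0) (bC : bd G Finset.univ C = 3) :
    (∃ p ∈ C, G.Adj r1 p ∧ ∀ z ∈ C, G.Adj r1 z → z = p) ∧ (∃ p ∈ C, G.Adj r2 p ∧ ∀ z ∈ C, G.Adj r2 z → z = p) ∧
    dg G r3 C = 1 := by
  have x1C : ∀ T, T ⊆ R → T ≠ Finset.univ := fun T hT => h.symm.ne hT
  have CR : C ⊆ R := fun z hz => (memR z).2 (by tauto)
  have key : ∀ r ∈ R, r ∉ C → dg G r C ≤ 1 := by
    intro r hr hrC
    have h1 := bd_move (G := G) (Finset.mem_univ r) hrC (Finset.subset_univ C)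
    have h2 := hc.step2 (C := insert r C) (by simp) (x1C _ (by
      intro z hz; rw [Finset.mem_insert] at hz; rcases hz with rfl | hz; exacts [hr, CR hz]))
    rw [hc.cub] at h1
    omega
  have k1 := key r1 h.mr1 nC.1
  have k2 := key r2 h.mr2 nC.2.1
  have k3 := key r3 h.mr3 nC.2.2
  have e1 : bd G Finset.univ C = ee G C {r1, r2, r3} := by
    have h1 := ee_sdiff_right (G := G) (D := {r1, r2, r3}) (E := Finset.univ \ C) C (by
      intro z; simp; rintro (rfl | rfl | rfl) <;> tauto)
    have h2 : ee G C ((Finset.univ \ C) \ {r1, r2, r3}) = 0 := by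
      rw [ee_zero]
      intro x hx y hy hh
      simp at hy
      rcases h.cov y with hy' | hy'
      · have := h.only y hy' x (CR hx) hh.symm
        rcases this with ⟨-, rfl⟩ | ⟨-, rfl⟩ | ⟨-, rfl⟩ <;> tauto
      · have h3 := (memR y).1 hy'
        have := hn x hx y
        tauto
    unfold bd; omega
  have e2 : ee G C {r1, r2, r3} = dg G r1 C + (dg G r2 C + dg G r3 C) := by
    rw [ee_comm, ee_insert_left _ (by simp [h.nr]), ee_insert_left _ (by simp [h.nr]), ee_single_left]
  exact ⟨dg_one (by omega), dg_one (by omega), by omega⟩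

lemma Cut3.two' (hc : Cub G) (h : Cut3 G X R x1 x2 x3 r1 r2 r3) {C D : Finset V} (cC : Conn G C) (cD : Conn G D)
    (hdis : ∀ z ∈ C, z ∉ D) (hn : ∀ x ∈ C, ∀ y ∈ D, ¬ G.Adj x y)
    (memR : ∀ z, z ∈ R ↔ z = r1 ∨ z = r2 ∨ z = r3 ∨ z ∈ C ∨ z ∈ D)
    (nC : r1 ∉ C ∧ r2 ∉ C ∧ r3 ∉ C) (nD : r1 ∉ D ∧ r2 ∉ D ∧ r3 ∉ D)
    (wC : ¬ W G C 0) (wD : ¬ W G D 0) (bC : bd G Finset.univ C = 3) (bD : bd G Finset.univ D = 3)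
    (I1 : W G (X.erase x1) (-1)) (hC : ∀ c, C ≠ {c}) : False := by
  obtain ⟨⟨p1, hp1, b1, u1⟩, ⟨p2, hp2, b2, u2⟩, d3⟩ := h.two hc cC cD hdis hn memR nC nD wC bC
  obtain ⟨⟨q1, hq1, b3, u3⟩, ⟨q2, hq2, b4, u4⟩, -⟩ := h.two hc cD cC (fun z h1 h2 => hdis z h2 h1)
    (fun x hx y hy hh => hn y hy x hx hh.symm) (fun z => by rw [memR]; tauto) nD nC wD bD
  have CR : C ⊆ R := fun z hz => (memR z).2 (by tauto)
  have DR : D ⊆ R := fun z hz => (memR z).2 (by tauto)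
  have bb : ∀ C' ⊆ C, C'.Nonempty → 3 ≤ bd G Finset.univ C' := fun C' hC' hne =>
    hc.step2 hne (h.symm.ne (hC'.trans CR))
  have od := hc.outdeg 3 bb bC hC
  have pp : p1 ≠ p2 := by
    rintro rfl
    have := dg_one_le (D := Finset.univ \ C) (a := r1) (by simp [nC]) b1.symm (od p1 hp1) r2 (by simp [nC]) b2.symm
    exact h.nr.1 this.symm
  have n12 : ¬ G.Adj r1 r2 := by
    intro hh
    have h1 := hc.hyp.deg r1
    have : dg G r1 {x1, r2, p1, q1} ≤ dg G r1 Finset.univ := dg_mono _ (Finset.subset_univ _)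
    have e1 : x1 ≠ r2 := fun e => h.dis _ h.mx1 (e ▸ h.mr2)
    have e2 : x1 ≠ p1 := fun e => h.dis _ h.mx1 (e ▸ CR hp1)
    have e3 : x1 ≠ q1 := fun e => h.dis _ h.mx1 (e ▸ DR hq1)
    have e4 : r2 ≠ p1 := fun e => nC.2.1 (e ▸ hp1)
    have e5 : r2 ≠ q1 := fun e => nD.2.1 (e ▸ hq1)
    have e6 : p1 ≠ q1 := fun e => hdis _ hp1 (e ▸ hq1)
    rw [dg_insert _ _ (by simp [*]), dg_insert _ _ (by simp [*]), dg_insert _ _ (by simp [*]), dg_single, hc.cub] at this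
    simp [h.a1.symm, hh, b1, b3] at this
  have PW : ∀ T ⊆ R, Conn G T → W G T 1 := fun T hT => hc.PW (h.symm.ne hT)
  refine hc.no (h.g02' memR nC nD hdis hn hp1 hp2 hq1 hq2 pp b1 b2 n12 u1 u2 u3 u4 I1 ?_ ?_)
  · refine lemA_use (B := Finset.univ.erase r3) hc.hyp (by intro z hz; simp; rintro rfl; exact nC.2.2 hz) cC
      (fun T hT => PW T (hT.trans CR)) wC hp1 hp2 pp nC.1 nC.2.1 b1.symm b2.symm ?_ ?_
    · intro x hx y hy hyC hh
      simp at hy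
      rcases h.cov y with hy' | hy'
      · have := h.only y hy' x (CR hx) hh.symm
        rcases this with ⟨-, rfl⟩ | ⟨-, rfl⟩ | ⟨-, rfl⟩ <;> tauto
      · rcases (memR y).1 hy' with rfl | rfl | rfl | h' | h'
        · exact Or.inl (u1 x hx hh.symm)
        · exact Or.inr (u2 x hx hh.symm)
        · exact absurd rfl hy
        · exact absurd h' hyC
        · exact absurd hh (hn x hx y h')
    · intro C' hC' hne
      have hC'' := hC'.trans Finset.sdiff_subset
      have h1 := bb C' hC'' hne
      rw [bd_amb (A := Finset.univ.erase r3) (by intro z hz; simp; rintro rfl; exact nC.2.2 (hC'' hz)) (by simp)] at h1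
      have h2 : Finset.univ \ Finset.univ.erase r3 = {r3} := by ext z; simp
      rw [h2, ee_comm, ee_single_left] at h1
      have := dg_mono (G := G) r3 hC''
      omega
  · exact drop1_use hc.hyp cD (fun T hT => PW T (hT.trans DR)) wD hq1 nD.1 b3.symm

lemma Cut3.c02 (hc : Cub G) (h : Cut3 G X R x1 x2 x3 r1 r2 r3) (hX : X.card % 3 = 0) (hR : R.card % 3 = 2) : False := by
  have w1 : W G (X.erase x1) (-1) := by
    have := Finset.card_erase_add_one h.mx1
    refine (h.sm hc (Finset.erase_subset _ _) ?_).mod (-1) (by norm_num) (by omega)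
    have := h.b1 hc; omega
  have b3 := h.symm.b3 hc
  have g02 := h.g02 w1
  obtain ⟨T, hT⟩ : ∃ T, T = ((R.erase r1).erase r2).erase r3 := ⟨_, rfl⟩
  rw [← hT] at b3 g02
  have memT : ∀ z, z ∈ T ↔ z ∈ R ∧ z ≠ r1 ∧ z ≠ r2 ∧ z ≠ r3 := by intro z; rw [hT]; simp; tauto
  have cT : T.card + 3 = R.card := by
    rw [hT]
    have e1 := Finset.card_erase_add_one h.mr1
    have e2 := Finset.card_erase_add_one (s := R.erase r1) (a := r2) (by simp [h.mr2, h.nr.1.symm])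
    have e3 := Finset.card_erase_add_one (s := (R.erase r1).erase r2) (a := r3)
      (by simp [h.mr3, h.nr.2.1.symm, h.nr.2.2.symm])
    omega
  have nT : ¬ W G T 1 := fun w => hc.no (g02 (w.mod (-1) (by norm_num) (by omega)))
  have TR : T ⊆ R := fun z hz => ((memT z).1 hz).1
  have bT : ∀ C ⊆ T, C.Nonempty → 3 ≤ bd G Finset.univ C := fun C hC hne =>
    hc.step2 hne (h.symm.ne (hC.trans TR))
  rcases split3 (G := G) 3 (Finset.subset_univ T) bT (by omega) with e | e | ⟨C, D, cC, cD, hd, hu, hn, hb⟩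
  · exact nT (e ▸ W.empty.le (by norm_num))
  · exact nT (hc.PW (h.symm.ne TR) e)
  · have CT : C ⊆ T := hu ▸ Finset.subset_union_left
    have DT : D ⊆ T := hu ▸ Finset.subset_union_right
    have wC1 := hc.PW (h.symm.ne (CT.trans TR)) cC
    have wD1 := hc.PW (h.symm.ne (DT.trans TR)) cD
    have wC : ¬ W G C 0 := fun w => nT (hu ▸ (w.union0 wD1 hd hn).le (by norm_num))
    have wD : ¬ W G D 0 := fun w => nT (hu ▸ (wC1.union0 w hd hn).le (by norm_num))
    have bC := bT C CT cC.1
    have bD := bT D DT cD.1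
    have bbT : bd G Finset.univ T ≤ 6 := b3
    have hdis : ∀ z ∈ C, z ∉ D := fun z hz => Finset.disjoint_left.1 hd hz
    have hdis' : ∀ z ∈ D, z ∉ C := fun z h1 h2 => hdis z h2 h1
    have hn' : ∀ x ∈ D, ∀ y ∈ C, ¬ G.Adj x y := fun x hx y hy hh => hn y hy x hx hh.symm
    have memR : ∀ z, z ∈ R ↔ z = r1 ∨ z = r2 ∨ z = r3 ∨ z ∈ C ∨ z ∈ D := by
      intro z
      have h1 := memT z
      rw [← hu, Finset.mem_union] at h1
      have := h.mr1; have := h.mr2; have := h.mr3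
      constructor
      · intro hz; tauto
      · rintro (rfl | rfl | rfl | h2) <;> tauto
    have memR' : ∀ z, z ∈ R ↔ z = r1 ∨ z = r2 ∨ z = r3 ∨ z ∈ D ∨ z ∈ C := by intro z; rw [memR]; tauto
    have nC : r1 ∉ C ∧ r2 ∉ C ∧ r3 ∉ C := ⟨fun h' => ((memT _).1 (CT h')).2.1 rfl,
      fun h' => ((memT _).1 (CT h')).2.2.1 rfl, fun h' => ((memT _).1 (CT h')).2.2.2 rfl⟩
    have nD : r1 ∉ D ∧ r2 ∉ D ∧ r3 ∉ D := ⟨fun h' => ((memT _).1 (DT h')).2.1 rfl,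
      fun h' => ((memT _).1 (DT h')).2.2.1 rfl, fun h' => ((memT _).1 (DT h')).2.2.2 rfl⟩
    by_cases sC : ∃ c, C = {c}
    · by_cases sD : ∃ d, D = {d}
      · obtain ⟨⟨p1, hp1, b1, u1⟩, ⟨p2, hp2, b2, u2⟩, d3⟩ := h.two hc cC cD hdis hn memR nC nD wC (by omega)
        obtain ⟨⟨q1, hq1, b3, u3⟩, ⟨q2, hq2, b4, u4⟩, -⟩ := h.two hc cD cC hdis' hn' memR' nD nC wD (by omega)
        obtain ⟨c, rfl⟩ := sC
        obtain ⟨d, rfl⟩ := sD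
        simp at hp1 hp2 hq1 hq2
        subst hp1 hp2 hq1 hq2
        exact hc.hyp.c4 _ _ _ _ h.nr.1 (by simpa using hdis) b1 b2 b3 b4
      · exact h.two' hc cD cC hdis' hn' memR' nD nC wD wC (by omega) (by omega) w1 (fun c e => sD ⟨c, e⟩)
    · exact h.two' hc cC cD hdis hn memR nC nD wC wD (by omega) (by omega) w1 (fun c e => sC ⟨c, e⟩)

lemma Cut3.false (hc : Cub G) (h : Cut3 G X R x1 x2 x3 r1 r2 r3) : False := by
  have w0 : ∀ {X R : Finset V} {x1 x2 x3 r1 r2 r3 : V}, Cut3 G X R x1 x2 x3 r1 r2 r3 → W G X 1 := fun h =>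
    h.sm hc subset_rfl (by rw [h.bX]; norm_num)
  have w1 : ∀ {X R : Finset V} {x1 x2 x3 r1 r2 r3 : V}, Cut3 G X R x1 x2 x3 r1 r2 r3 →
      W G (X.erase x1) 1 ∧ (X.erase x1).card + 1 = X.card := fun h =>
    ⟨h.sm hc (Finset.erase_subset _ _) (by have := h.b1 hc; omega), Finset.card_erase_add_one h.mx1⟩
  have w2 : ∀ {X R : Finset V} {x1 x2 x3 r1 r2 r3 : V}, Cut3 G X R x1 x2 x3 r1 r2 r3 →
      W G ((X.erase x1).erase x2) 1 ∧ ((X.erase x1).erase x2).card + 2 = X.card := fun {X R x1 x2 x3 r1 r2 r3} h =>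
    ⟨h.sm hc ((Finset.erase_subset _ _).trans (Finset.erase_subset _ _)) (by have := h.b2 hc; omega), by
      have := Finset.card_erase_add_one h.mx1
      have e2 := Finset.card_erase_add_one (s := X.erase x1) (a := x2) (by simp [h.mx2, h.nx.1.symm])
      omega⟩
  have hp : Cut3 G X R x2 x1 x3 r2 r1 r3 := ⟨h.cov, h.dis, h.mx2, h.mx1, h.mx3, h.mr2, h.mr1, h.mr3,
    ⟨h.nx.1.symm, h.nx.2.2, h.nx.2.1⟩, ⟨h.nr.1.symm, h.nr.2.2, h.nr.2.1⟩, h.a2, h.a1, h.a3,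
    fun a ha b hb hh => by have := h.only a ha b hb hh; tauto, h.bX⟩
  have hq : Cut3 G X R x1 x3 x2 r1 r3 r2 := ⟨h.cov, h.dis, h.mx1, h.mx3, h.mx2, h.mr1, h.mr3, h.mr2,
    ⟨h.nx.2.1, h.nx.1, h.nx.2.2.symm⟩, ⟨h.nr.2.1, h.nr.1, h.nr.2.2.symm⟩, h.a1, h.a3, h.a2,
    fun a ha b hb hh => by have := h.only a ha b hb hh; tauto, h.bX⟩
  obtain ⟨wa, ca⟩ := w1 h
  obtain ⟨wb, cb⟩ := w1 hp.symm
  obtain ⟨wc, cc⟩ := w2 h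
  obtain ⟨wd, cd⟩ := w2 hq.symm
  obtain ⟨we, ce⟩ := w2 h.symm
  have wX := w0 h
  have wR := w0 h.symm
  have e1 : X.card % 3 = 0 ∨ X.card % 3 = 1 ∨ X.card % 3 = 2 := by omega
  have e2 : R.card % 3 = 0 ∨ R.card % 3 = 1 ∨ R.card % 3 = 2 := by omega
  rcases e1 with e1 | e1 | e1 <;> rcases e2 with e2 | e2 | e2
  · exact hc.no (h.g1 (wa.mod (-1) (by norm_num) (by omega)) (wb.mod (-1) (by norm_num) (by omega)) (by norm_num))
  · exact hc.no (h.g1 (wa.mod (-1) (by norm_num) (by omega)) (wb.mod 0 (by norm_num) (by omega)) (by norm_num))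
  · exact h.c02 hc e1 e2
  · exact hc.no (h.g1 (wa.mod 0 (by norm_num) (by omega)) (wb.mod (-1) (by norm_num) (by omega)) (by norm_num))
  · exact hc.no (h.g11 (wc.mod (-1) (by norm_num) (by omega)) (wd.mod (-1) (by norm_num) (by omega)))
  · exact hc.no (h.g12 (wc.mod (-1) (by norm_num) (by omega)) (wR.mod (-1) (by norm_num) (by omega)) (by norm_num))
  · exact h.symm.c02 hc e2 e1
  · exact hc.no (h.symm.g12 (we.mod (-1) (by norm_num) (by omega)) (wX.mod (-1) (by norm_num) (by omega)) (by norm_num))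
  · exact hc.no (h.g12 (wc.mod 0 (by norm_num) (by omega)) (wR.mod (-1) (by norm_num) (by omega)) (by norm_num))

end

lemma Cub.step3 (h : Cub G) {C : Finset V} (hC : ∀ x, C ≠ {x}) (hC' : ∀ x, Finset.univ \ C ≠ {x}) (hne : C.Nonempty)
    (hCu : C ≠ Finset.univ) : 4 ≤ bd G Finset.univ C := by
  have h1 := h.step2 hne hCu
  by_contra h2
  have h3 : bd G Finset.univ C = 3 := by omega
  have h4 : bd G Finset.univ (Finset.univ \ C) = 3 := by rw [bd_compl (Finset.subset_univ _), h3]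
  have o1 := h.outdeg 3 (fun D hD hDne => h.step2 hDne (by
    rintro rfl; exact hCu (Finset.univ_subset_iff.1 hD))) h3 hC
  have o2 := h.outdeg 3 (X := Finset.univ \ C) (fun D hD hDne => h.step2 hDne (by
    rintro rfl; obtain ⟨z, hz⟩ := hne; have := hD (Finset.mem_univ z); simp [hz] at this)) h4 hC'
  rw [Finset.sdiff_sdiff_eq_self (Finset.subset_univ _)] at o2
  obtain ⟨x1, hx1, x2, hx2, x3, hx3, y1, hy1, y2, hy2, y3, hy3, n1, n2, n3, n4, n5, n6, a1, a2, a3, hu⟩ := ee_three' h3 o1 o2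
  exact Cut3.false h (X := C) (R := Finset.univ \ C) (x1 := x1) (x2 := x2) (r1 := y1) (r2 := y2) (x3 := x3) (r3 := y3)
    ⟨by intro z; by_cases hz : z ∈ C <;> simp [hz], by intro z hz; simp [hz], hx1, hx2, hx3, hy1, hy2, hy3,
      ⟨n1, n2, n3⟩, ⟨n4, n5, n6⟩, a1, a2, a3, hu, h3⟩

variable (G) in
structure TBr (T D1 D2 D3 : Finset V) (a s1 s2 s3 : V) : Prop where
  mem : ∀ z, z ∈ T ↔ z = a ∨ z ∈ D1 ∨ z ∈ D2 ∨ z ∈ D3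
  na : a ∉ D1 ∧ a ∉ D2 ∧ a ∉ D3
  d12 : ∀ z ∈ D1, z ∉ D2
  d13 : ∀ z ∈ D1, z ∉ D3
  d23 : ∀ z ∈ D2, z ∉ D3
  n12 : ∀ x ∈ D1, ∀ y ∈ D2, ¬ G.Adj x y
  n13 : ∀ x ∈ D1, ∀ y ∈ D3, ¬ G.Adj x y
  n23 : ∀ x ∈ D2, ∀ y ∈ D3, ¬ G.Adj x y
  c1 : Conn G D1
  c2 : Conn G D2
  c3 : Conn G D3
  w1 : ¬ W G D1 0
  w2 : ¬ W G D2 0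
  w3 : ¬ W G D3 0
  m1 : s1 ∈ D1
  m2 : s2 ∈ D2
  m3 : s3 ∈ D3
  a1 : G.Adj a s1
  a2 : G.Adj a s2
  a3 : G.Adj a s3
  u1 : ∀ z ∈ D1, G.Adj a z → z = s1
  u2 : ∀ z ∈ D2, G.Adj a z → z = s2
  u3 : ∀ z ∈ D3, G.Adj a z → z = s3

lemma TBr.p12 {T D1 D2 D3 : Finset V} {a s1 s2 s3 : V} (h : TBr G T D1 D2 D3 a s1 s2 s3) :
    TBr G T D2 D1 D3 a s2 s1 s3 :=
  ⟨fun z => by rw [h.mem]; tauto, ⟨h.na.2.1, h.na.1, h.na.2.2⟩, fun z h1 h2 => h.d12 z h2 h1, h.d23, h.d13,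
    fun x hx y hy hh => h.n12 y hy x hx hh.symm, h.n23, h.n13, h.c2, h.c1, h.c3, h.w2, h.w1, h.w3,
    h.m2, h.m1, h.m3, h.a2, h.a1, h.a3, h.u2, h.u1, h.u3⟩

lemma TBr.p23 {T D1 D2 D3 : Finset V} {a s1 s2 s3 : V} (h : TBr G T D1 D2 D3 a s1 s2 s3) :
    TBr G T D1 D3 D2 a s1 s3 s2 :=
  ⟨fun z => by rw [h.mem]; tauto, ⟨h.na.1, h.na.2.2, h.na.2.1⟩, h.d13, h.d12, fun z h1 h2 => h.d23 z h2 h1,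
    h.n13, h.n12, fun x hx y hy hh => h.n23 y hy x hx hh.symm, h.c1, h.c3, h.c2, h.w1, h.w3, h.w2,
    h.m1, h.m3, h.m2, h.a1, h.a3, h.a2, h.u1, h.u3, h.u2⟩

lemma TB_aux (hyp : Hyp G) {T : Finset V} (hT : Conn G T) (PW : ∀ C ⊆ T, Conn G C → W G C 1) (h0 : ¬ W G T 0)
    {A A' : Finset V} {x y : V} (hA : A ⊆ T) (hA' : A' = T \ A) (hx : x ∈ A) (hy : y ∈ A') (hxy : G.Adj x y)
    (hu : ∀ a ∈ A, ∀ b ∈ A', G.Adj a b → a = x ∧ b = y) (cA : Conn G A) (cA' : Conn G A') (wA : ¬ W G A 0) :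
    ∃ D1 D2 D3 a s1 s2 s3, TBr G T D1 D2 D3 a s1 s2 s3 := by
  have memT : ∀ z, z ∈ T ↔ z ∈ A ∨ z ∈ A' := by
    intro z; rw [hA', Finset.mem_sdiff]; have := @hA z; tauto
  have dis : ∀ z ∈ A, z ∉ A' := by intro z hz; rw [hA']; simp [hz]
  have A'T : A' ⊆ T := fun z hz => (memT z).2 (Or.inr hz)
  have hu' : ∀ b ∈ A', ∀ a ∈ A, G.Adj b a → a = x ∧ b = y := fun b hb a ha hh => hu a ha b hb hh.symm
  have wA1 := drop1_use hyp cA (fun C hC => PW C (hC.trans hA)) wA hx (fun h => dis _ h hy) hxy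
  have nx : ¬ W G (insert x A') 0 := by
    intro w
    refine h0 ((wA1.union w ?_ x ?_).to (by norm_num) ?_)
    · rw [Finset.disjoint_left]; clear * - dis; grind
    · clear * - hu; grind
    · ext z; have := memT z; clear * - this hx; grind
  have ny : ¬ W G (A'.erase y) 1 := by
    intro w
    refine nx ((w.leaf (u := x) (v := y) ?_ ?_ hxy ?_).to (by norm_num) ?_)
    · have := dis x hx; simp [this]
    · simp
    · intro z hz hh; simp at hz; exact hz.1 (hu x hx z hz.2 hh).2
    · rw [Finset.insert_erase hy]
  have dy : dg G y A' ≤ 2 := hyp.deg2 (fun h => dis x hx h) hxy.symm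
  have PW' : ∀ C ⊆ A', Conn G C → W G C 1 := fun C hC => PW C (hC.trans A'T)
  have eA : A'.erase y ⊆ A' := Finset.erase_subset _ _
  have be := bd_erase (G := G) y hy
  have cm : ∀ C ⊆ A'.erase y, C.Nonempty → 1 ≤ bd G A' C := by
    intro C hC hne
    refine cA'.2 C (hC.trans eA) hne ?_
    rintro rfl
    have := hC hy
    simp at this
  rcases split3 (G := G) 1 eA cm (by omega) with e | e | ⟨C, D, cC, cD, hd, hU, hn, hb⟩
  · exact absurd (e ▸ W.empty.le (by norm_num)) ny
  · exact absurd (PW' _ eA e) ny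
  have CT : C ⊆ A'.erase y := hU ▸ Finset.subset_union_left
  have DT : D ⊆ A'.erase y := hU ▸ Finset.subset_union_right
  have wC1 := PW' C (CT.trans eA) cC
  have wD1 := PW' D (DT.trans eA) cD
  have wC : ¬ W G C 0 := fun w => ny (hU ▸ (w.union0 wD1 hd hn).le (by norm_num))
  have wD : ¬ W G D 0 := fun w => ny (hU ▸ (wC1.union0 w hd hn).le (by norm_num))
  have memA' : ∀ z, z ∈ A' ↔ z = y ∨ z ∈ C ∨ z ∈ D := by
    intro z
    have h1 : z ∈ A'.erase y ↔ z ∈ C ∨ z ∈ D := by rw [← hU, Finset.mem_union]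
    rw [Finset.mem_erase] at h1
    by_cases hz : z = y
    · subst hz; simp [hy]
    · tauto
  have hdis : ∀ z ∈ C, z ∉ D := fun z hz => Finset.disjoint_left.1 hd hz
  have yC : y ∉ C := fun h => by simpa using CT h
  have yD : y ∉ D := fun h => by simpa using DT h
  have pC : 0 < dg G y C := by
    obtain ⟨c, hc, z, hz, hzC, hh⟩ := bd_pos.1 (cm C CT cC.1)
    rcases (memA' z).1 hz with rfl | h' | h'
    · exact dg_pos.2 ⟨c, hc, hh.symm⟩
    · exact absurd h' hzC
    · exact absurd hh (hn c hc z h')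
  have pD : 0 < dg G y D := by
    obtain ⟨c, hc, z, hz, hzC, hh⟩ := bd_pos.1 (cm D DT cD.1)
    rcases (memA' z).1 hz with rfl | h' | h'
    · exact dg_pos.2 ⟨c, hc, hh.symm⟩
    · exact absurd hh.symm (hn z h' c hc)
    · exact absurd h' hzC
  have sm : dg G y C + dg G y D ≤ 2 := by
    rw [← dg_union y hd, hU]; exact (dg_mono y eA).trans dy
  obtain ⟨s2, m2, a2, u2⟩ := dg_one (by omega : dg G y C = 1)
  obtain ⟨s3, m3, a3, u3⟩ := dg_one (by omega : dg G y D = 1)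
  have CA : C ⊆ A' := CT.trans eA
  have DA : D ⊆ A' := DT.trans eA
  refine ⟨A, C, D, y, x, s2, s3, fun z => by rw [memT, memA']; tauto, ⟨fun h => dis _ h hy, yC, yD⟩,
    fun z h1 h2 => dis z h1 (CA h2), fun z h1 h2 => dis z h1 (DA h2), hdis, ?_, ?_, hn, cA, cC, cD, wA, wC, wD, hx, m2, m3,
    hxy.symm, a2, a3, fun z hz hh => (hu z hz y hy hh.symm).1, u2, u3⟩
  · intro p hp q hq hh
    have := (hu p hp q (CA hq) hh).2
    subst this; exact yC hq
  · intro p hp q hq hh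
    have := (hu p hp q (DA hq) hh).2
    subst this; exact yD hq

lemma TB (hyp : Hyp G) {T : Finset V} (hT : Conn G T) (PW : ∀ C ⊆ T, Conn G C → W G C 1) (h0 : ¬ W G T 0)
    {A : Finset V} (hA : A ⊆ T) (hb : bd G T A = 1) :
    ∃ D1 D2 D3 a s1 s2 s3, TBr G T D1 D2 D3 a s1 s2 s3 := by
  obtain ⟨x, hx, y, hy, hxy, hu⟩ := ee_one hb
  have cA : Conn G A := hT.of hA hx (fun a ha b hb hbA hab => (hu a ha b (by simp [*]) hab).1)
  have cA' : Conn G (T \ A) := hT.of Finset.sdiff_subset hy (fun a ha b hb hbA hab =>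
    (hu b (by simp at hbA; exact hbA hb) a ha hab.symm).2)
  by_cases wA : W G A 0
  · have wA' : ¬ W G (T \ A) 0 := by
      intro w
      refine h0 ((wA.union w Finset.disjoint_sdiff x (fun s hs t ht hh => Or.inl (hu s hs t ht hh).1)).to (by norm_num) ?_)
      rw [Finset.union_sdiff_of_subset hA]
    exact TB_aux hyp hT PW h0 Finset.sdiff_subset (Finset.sdiff_sdiff_eq_self hA).symm hy hx hxy.symm
      (fun a ha b hb hh => (hu b hb a ha hh.symm).symm) cA' cA wA'
  · exact TB_aux hyp hT PW h0 hA rfl hx hy hxy hu cA cA' wA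

lemma Cub.single (h : Cub G) {C : Finset V} {p q : V} (hpq : p ≠ q) (hp : p ∉ C) (hq : q ∉ C) (hne : C.Nonempty)
    (hb : bd G Finset.univ C ≤ 3) : ∃ c, C = {c} := by
  by_contra hC
  have := h.step3 (C := C) (fun x e => hC ⟨x, e⟩) (by
    intro x e
    have h1 : p ∈ Finset.univ \ C := by simp [hp]
    have h2 : q ∈ Finset.univ \ C := by simp [hq]
    rw [e] at h1 h2
    simp at h1 h2
    exact hpq (h1.trans h2.symm)) hne (by rintro rfl; simp at hp)
  omega

variable (G) in
structure Nb (X : Finset V) (u v1 v2 v3 : V) : Prop where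
  mem : ∀ z, z ∈ X ↔ z ≠ u ∧ z ≠ v1 ∧ z ≠ v2 ∧ z ≠ v3
  a1 : G.Adj u v1
  a2 : G.Adj u v2
  a3 : G.Adj u v3
  ne : v1 ≠ v2 ∧ v1 ≠ v3 ∧ v2 ≠ v3
  only : ∀ z, G.Adj u z → z = v1 ∨ z = v2 ∨ z = v3
  n12 : ¬ G.Adj v1 v2
  n13 : ¬ G.Adj v1 v3
  n23 : ¬ G.Adj v2 v3

lemma Cub.nb (h : Cub G) (u : V) : ∃ X v1 v2 v3, Nb G X u v1 v2 v3 := by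
  obtain ⟨v1, -, v2, -, v3, -, n1, n2, n3, a1, a2, a3, hu⟩ := dg_three (h.cub u)
  refine ⟨Finset.univ.filter (fun z => z ≠ u ∧ z ≠ v1 ∧ z ≠ v2 ∧ z ≠ v3), v1, v2, v3, by simp, a1, a2, a3, ⟨n1, n2, n3⟩,
    fun z => hu z (by simp), fun h' => h.hyp.tri _ _ _ a1 h' a2, fun h' => h.hyp.tri _ _ _ a1 h' a3,
    fun h' => h.hyp.tri _ _ _ a2 h' a3⟩

section
variable {X : Finset V} {u v1 v2 v3 : V}
lemma Nb.out (hc : Cub G) (h : Nb G X u v1 v2 v3) {d : V} (hd : d ∈ X) : dg G d (Finset.univ \ X) ≤ 1 := by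
  have h1 : Finset.univ \ X = {u, v1, v2, v3} := by
    ext z; have := h.mem z; simp; tauto
  have hd' := (h.mem d).1 hd
  have nu : ¬ G.Adj d u := fun hh => by have := h.only d hh.symm; tauto
  have k : ∀ p q, p ≠ q → G.Adj u p → G.Adj u q → G.Adj d p → G.Adj d q → False := fun p q n b1 b2 b3 b4 =>
    hc.hyp.c4 u d p q (Ne.symm hd'.1) n b1 b3 b2 b4
  have k1 := k v1 v2 h.ne.1 h.a1 h.a2
  have k2 := k v1 v3 h.ne.2.1 h.a1 h.a3
  have k3 := k v2 v3 h.ne.2.2 h.a2 h.a3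
  rw [h1, dg_insert _ _ (by have := h.a1.ne; have := h.a2.ne; have := h.a3.ne; simp [*]),
    dg_insert _ _ (by simp [h.ne]), dg_insert _ _ (by simp [h.ne]), dg_single]
  simp only [nu, if_false]
  split_ifs <;> first | omega | tauto

lemma Nb.bX (hc : Cub G) (h : Nb G X u v1 v2 v3) : bd G Finset.univ X = 6 := by
  have h1 : X = Finset.univ \ {v1, v2, v3, u} := by
    ext z; have := h.mem z; simp; tauto
  rw [h1, bd_compl (Finset.subset_univ _)]
  have e1 := bd_move (G := G) (B := Finset.univ) (v := v1) (C := {v2, v3, u}) (by simp)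
    (by have := h.a1.ne.symm; simp [h.ne, this]) (by simp)
  have e2 := bd_move (G := G) (B := Finset.univ) (v := v2) (C := {v3, u}) (by simp)
    (by have := h.a2.ne.symm; simp [h.ne, this]) (by simp)
  have e3 := bd_move (G := G) (B := Finset.univ) (v := v3) (C := {u}) (by simp)
    (by have := h.a3.ne.symm; simp [h.ne, this]) (by simp)
  rw [bd_single _ (by simp)] at e3
  rw [dg_insert _ _ (by have := h.a2.ne.symm; have := h.a3.ne.symm; simp [h.ne, *]),
    dg_insert _ _ (by have := h.a3.ne.symm; simp [*])] at e1
  rw [dg_insert _ _ (by have := h.a3.ne.symm; simp [*])] at e2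
  simp only [dg_single, hc.cub, h.n12, h.n13, h.n23, h.a1.symm, h.a2.symm, h.a3.symm, if_true, if_false] at e1 e2 e3
  omega

lemma Nb.w (hc : Cub G) (h : Nb G X u v1 v2 v3) : ¬ W G X 0 := by
  intro w
  have hu : u ∉ X := fun hh => ((h.mem u).1 hh).1 rfl
  have hv : v1 ∉ X := fun hh => ((h.mem v1).1 hh).2.1 rfl
  refine hc.no ((((w.leaf hu hv h.a1 ?_).ins v2).ins v3).to (by norm_num) ?_)
  · intro z hz hh
    have := (h.mem z).1 hz
    have := h.only z hh
    tauto
  · ext z; have := h.mem z; simp; tauto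

variable (G) in
structure Block (B : Finset V) : Prop where
  conn : Conn G B
  w : ¬ W G B 0
  nu : B ≠ Finset.univ
  big : ∀ b, B ≠ {b}
  br : ∀ C ⊆ B, C.Nonempty → C ≠ B → 2 ≤ bd G B C

lemma Nb.block (hc : Cub G) (h : Nb G X u v1 v2 v3) : Block G X := by
  have hu : u ∉ X := fun hh => ((h.mem u).1 hh).1 rfl
  have hv : v1 ∉ X := fun hh => ((h.mem v1).1 hh).2.1 rfl
  have Xu : X ≠ Finset.univ := by rintro rfl; simp at hu
  have bX := h.bX hc
  have Xe : X ≠ ∅ := by rintro rfl; rw [bd_empty] at bX; omega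
  have sg : ∀ C ⊆ X, C.Nonempty → bd G Finset.univ C ≤ 3 → ∃ c, C = {c} := fun C hC hne hb =>
    hc.single h.a1.ne (fun h' => hu (hC h')) (fun h' => hv (hC h')) hne hb
  have tot : ∀ c ∈ X, 2 ≤ dg G c X := by
    intro c hcX
    have h1 := dg_sdiff (G := G) c (Finset.subset_univ X)
    rw [hc.cub] at h1
    have := h.out hc hcX
    omega
  have nu : ∀ C ⊆ X, C ≠ Finset.univ := by rintro C hC rfl; exact Xu (Finset.univ_subset_iff.1 hC)
  have m3 : ∀ C ⊆ X, C.Nonempty → 3 ≤ bd G Finset.univ C := fun C hC hne => hc.step2 hne (nu C hC)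
  have cX : Conn G X := by
    rcases split3 (G := G) 3 (Finset.subset_univ X) m3 (by omega) with e | e | ⟨C, D, cC, cD, hd, hU, hn, hb⟩
    · exact absurd e Xe
    · exact e
    · exfalso
      have CT : C ⊆ X := hU ▸ Finset.subset_union_left
      have DT : D ⊆ X := hU ▸ Finset.subset_union_right
      have := m3 C CT cC.1
      have := m3 D DT cD.1
      obtain ⟨c, rfl⟩ := sg C CT cC.1 (by omega)
      have h1 := tot c (by simpa using CT)
      rw [← hU, dg_union _ hd, dg_single, dg_zero.2 (fun z hz => hn c (by simp) z hz)] at h1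
      simp at h1
  refine ⟨cX, h.w hc, Xu, ?_, ?_⟩
  · rintro b rfl; rw [bd_single _ (by simp), hc.cub] at bX; omega
  · intro C hC hne hCX
    have p := cX.2 C hC hne hCX
    by_contra hlt
    obtain ⟨D1, D2, D3, a, s1, s2, s3, tb⟩ := TB hc.hyp cX (fun C hC => hc.PW (nu C hC)) (h.w hc) hC (by omega)
    have D1X : D1 ⊆ X := fun z hz => (tb.mem z).2 (by tauto)
    have D2X : D2 ⊆ X := fun z hz => (tb.mem z).2 (by tauto)
    have D3X : D3 ⊆ X := fun z hz => (tb.mem z).2 (by tauto)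
    have key : ∀ {D1 D2 D3 : Finset V} {a s1 s2 s3 : V}, TBr G X D1 D2 D3 a s1 s2 s3 →
        bd G Finset.univ D1 = 1 + ee G D1 (Finset.univ \ X) ∧ ∀ c, D1 ≠ {c} := by
      intro D1 D2 D3 a s1 s2 s3 tb
      have D1X : D1 ⊆ X := fun z hz => (tb.mem z).2 (by tauto)
      have e2 : X \ D1 = insert a (D2 ∪ D3) := by
        ext z
        have := tb.mem z; have := tb.na; have := tb.d12 z; have := tb.d13 z
        simp only [FM]
        constructor
        · tauto
        · rintro (rfl | h' | h') <;> tauto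
      have e3 : ee G D1 (D2 ∪ D3) = 0 := by
        rw [ee_zero]; intro x hx y hy
        rcases Finset.mem_union.1 hy with h' | h'
        · exact tb.n12 x hx y h'
        · exact tb.n13 x hx y h'
      have e4 : dg G a D1 = 1 := by
        rw [← Finset.insert_erase tb.m1, dg_insert _ _ (by simp), dg_zero.2, if_pos tb.a1]
        intro z hz hh; simp at hz; exact hz.1 (tb.u1 z hz.2 hh)
      have e5 : bd G X D1 = 1 := by
        unfold bd
        rw [e2, ee_insert_right _ (by simp [tb.na]), e3, e4]
      refine ⟨by rw [bd_amb D1X (Finset.subset_univ _), e5], ?_⟩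
      rintro c rfl
      have := tot c (by simpa using D1X)
      rw [bd_single _ (by simpa using D1X)] at e5
      omega
    have h3 := (key tb).1
    have h4 := (key tb.p12).1
    have h5 := (key tb.p23.p12).1
    have q1 := m3 D1 D1X tb.c1.1
    have q2 := m3 D2 D2X tb.c2.1
    have q3 := m3 D3 D3X tb.c3.1
    have eX : bd G Finset.univ X = ee G X (Finset.univ \ X) := rfl
    have dd1 : Disjoint D1 D2 := Finset.disjoint_left.2 (fun z => tb.d12 z)
    have dd2 : Disjoint (D1 ∪ D2) D3 := Finset.disjoint_left.2 (fun z hz => by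
      rcases Finset.mem_union.1 hz with h' | h'
      exacts [tb.d13 z h', tb.d23 z h'])
    have le : ee G (D1 ∪ D2 ∪ D3) (Finset.univ \ X) ≤ ee G X (Finset.univ \ X) := ee_mono_left (by
      intro z hz; simp at hz; rw [tb.mem]; tauto)
    rw [ee_union_left _ dd2, ee_union_left _ dd1] at le
    obtain ⟨c, hc'⟩ := sg D1 D1X tb.c1.1 (by omega)
    exact (key tb).2 c hc'
end

variable (G) in
structure Bx (B T : Finset V) (x v w : V) : Prop where
  mem : ∀ z, z ∈ B ↔ z = x ∨ z = v ∨ z = w ∨ z ∈ T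
  nx : x ∉ T
  nv : v ∉ T
  nw : w ∉ T
  vw : v ≠ w
  av : G.Adj x v
  aw : G.Adj x w
  navw : ¬ G.Adj v w
  ux : ∀ z ∈ B, G.Adj x z → z = v ∨ z = w

section
variable {B T : Finset V} {x v w : V}

lemma Bx.symm (h : Bx G B T x v w) : Bx G B T x w v :=
  ⟨fun z => by rw [h.mem]; tauto, h.nx, h.nw, h.nv, h.vw.symm, h.aw, h.av, fun hh => h.navw hh.symm,
    fun z hz hh => (h.ux z hz hh).symm⟩

lemma Block.deg (hB : Block G B) {z : V} (hz : z ∈ B) : 2 ≤ dg G z B := by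
  have := hB.br {z} (by simpa using hz) (by simp) (fun h => hB.big z h.symm)
  rwa [bd_single z hz] at this

lemma Block.sub (hc : Cub G) (hB : Block G B) {C : Finset V} (hC : C ⊆ B) : C ≠ Finset.univ := by
  rintro rfl; exact hB.nu (Finset.univ_subset_iff.1 hC)

lemma Block.exBx (hc : Cub G) (hB : Block G B) : ∃ T x v w, Bx G B T x v w := by
  obtain ⟨x, hx, hd⟩ := hc.conn.lowdeg (Finset.subset_univ B) hB.conn.1 hB.nu hc.hyp
  have := hB.deg hx
  obtain ⟨v, hv, w, hw, hvw, av, aw, hu⟩ := dg_two (by omega : dg G x B = 2)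
  refine ⟨B \ {x, v, w}, x, v, w, ?_, by simp, by simp, by simp, hvw, av, aw, fun hh => hc.hyp.tri _ _ _ av hh aw, hu⟩
  intro z
  simp only [FM]
  constructor
  · intro h; tauto
  · rintro (rfl | rfl | rfl | h)
    exacts [hx, hv, hw, h.1]

lemma Bx.TB (h : Bx G B T x v w) : T ⊆ B := fun z hz => (h.mem z).2 (by tauto)

lemma Bx.dx (h : Bx G B T x v w) {D : Finset V} (hD : D ⊆ T) : dg G x D = 0 := by
  rw [dg_zero]; intro z hz hh
  rcases h.ux z (h.TB (hD hz)) hh with rfl | rfl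
  · exact h.nv (hD hz)
  · exact h.nw (hD hz)

lemma Bx.bdD (h : Bx G B T x v w) {D : Finset V} (hD : D ⊆ T) :
    bd G B D = bd G T D + dg G v D + dg G w D := by
  rw [bd_amb hD h.TB]
  have e : B \ T = {x, v, w} := by
    ext z; have := h.mem z; have := h.nx; have := h.nv; have := h.nw
    simp only [FM]
    constructor
    · tauto
    · rintro (rfl | rfl | rfl) <;> tauto
  rw [e, ee_comm, ee_insert_left _ (by simp [h.av.ne, h.aw.ne]), ee_insert_left _ (by simp [h.vw]), ee_single_left, h.dx hD]
  omega

lemma Bx.dv (h : Bx G B T x v w) : dg G v B = 1 + dg G v T := by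
  have e : B = insert v (insert w (insert x T)) := by ext z; simp [h.mem]; tauto
  rw [e, dg_insert _ _ (by simp [h.nv, h.vw, h.av.ne']), dg_insert _ _ (by simp [h.nw, h.aw.ne']),
    dg_insert _ _ h.nx]
  simp [h.navw, h.av.symm]; omega

lemma Bx.wT (h : Bx G B T x v w) (hB : Block G B) : ¬ W G T 0 := by
  intro wt
  refine hB.w (((wt.leaf h.nx h.nv h.av ?_).ins w).to (by norm_num) ?_)
  · exact dg_zero.1 (h.dx subset_rfl)
  · ext z; simp [h.mem]; tauto

lemma gadN' {S X Y : Finset V} {u v w x1 x2 y1 : V}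
    (memS : ∀ z, z ∈ S ↔ z = u ∨ z = v ∨ z = w ∨ z ∈ X ∨ z ∈ Y)
    (nu' : u ∉ X ∧ u ∉ Y) (nv : v ∉ X ∧ v ∉ Y) (nw : w ∉ X ∧ w ∉ Y) (huv : u ≠ v) (huw : u ≠ w) (hvw : v ≠ w)
    (hdis : ∀ z ∈ X, z ∉ Y) (hn : ∀ x ∈ X, ∀ y ∈ Y, ¬ G.Adj x y) (auv : G.Adj u v) (auw : G.Adj u w)
    (navw : ¬ G.Adj v w) (hu : ∀ z ∈ S, G.Adj u z → z = v ∨ z = w)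
    (hx1 : x1 ∈ X) (hx2 : x2 ∈ X) (hy1 : y1 ∈ Y) (hx : x1 ≠ x2)
    (a1 : G.Adj v x1) (u1 : ∀ z ∈ X, G.Adj v z → z = x1) (u2 : ∀ z ∈ Y, G.Adj v z → z = y1)
    (u3 : ∀ z ∈ X, G.Adj w z → z = x2)
    (I1 : W G (X \ {x1, x2}) (-1)) (I2 : W G (Y.erase y1) (-1)) : W G S (-2) := by
  have hu' : ∀ z, z ∈ X ∨ z ∈ Y → ¬ G.Adj u z ∧ ¬ G.Adj z u := by
    intro z hz
    have h : ¬ G.Adj u z := by grind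
    exact ⟨h, fun h' => h h'.symm⟩
  have nw' : ¬ G.Adj w v := fun h => navw h.symm
  have hnY : ∀ x ∈ X, ∀ y ∈ Y, ¬ G.Adj y x := fun x hx y hy h => hn x hx y hy h.symm
  have uw : ∀ z ∈ X, G.Adj z w → z = x2 := fun z hz h => u3 z hz h.symm
  clear hu u3
  have J1 := I1.leaf (u := v) (v := x1) (by grind) (by grind) a1 (by grind)
  have J2 := I2.leaf (u := u) (v := w) (by grind) (by grind) auw (by grind)
  have J3 := J1.union J2 (by rw [Finset.disjoint_left]; grind) v (by grind)
  have J4 := (J3.ins x2).ins y1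
  convert J4.le (show _ ≤ (-2:ℤ) by norm_num) using 1
  ext z
  rw [memS]
  simp only [FM]
  clear * - hx1 hx2 hy1
  grind

/-- Two components, one of which is tight. -/
lemma Bx.two (hc : Cub G) (hB : Block G B) (h : Bx G B T x v w) {Y Z : Finset V} (cY : Conn G Y) (cZ : Conn G Z)
    (hd : Disjoint Y Z) (hU : Y ∪ Z = T) (hn : ∀ y ∈ Y, ∀ z ∈ Z, ¬ G.Adj y z) (wY : ¬ W G Y 0) : False := by
  have YT : Y ⊆ T := hU ▸ Finset.subset_union_left
  have ZT : Z ⊆ T := hU ▸ Finset.subset_union_right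
  have nuB : ∀ C ⊆ T, C ≠ Finset.univ := fun C hC => hB.sub hc (hC.trans h.TB)
  have ne : ∀ C ⊆ T, C ≠ B := by rintro C hC rfl; exact h.nx (hC ((h.mem x).2 (Or.inl rfl)))
  have vB : v ∈ B := (h.mem v).2 (by tauto)
  have wB : w ∈ B := (h.mem w).2 (by tauto)
  have xB : x ∈ B := (h.mem x).2 (by tauto)
  have bY0 : bd G T Y = 0 := by
    rw [bd_zero]; intro a ha b hb hbY hh
    rw [← hU, Finset.mem_union] at hb
    exact hn a ha b (hb.resolve_left hbY) hh
  have bZ0 : bd G T Z = 0 := by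
    rw [bd_zero]; intro a ha b hb hbY hh
    rw [← hU, Finset.mem_union] at hb
    exact hn b (hb.resolve_right hbY) a ha hh.symm
  have bY := h.bdD YT
  have bZ := h.bdD ZT
  have dv := h.dv
  have dw := h.symm.dv
  have := hc.hyp.deg v B
  have := hc.hyp.deg w B
  rw [← hU, dg_union _ hd] at dv dw
  have rY := hB.br Y (YT.trans h.TB) cY.1 (ne _ YT)
  have rZ := hB.br Z (ZT.trans h.TB) cZ.1 (ne _ ZT)
  have ins : ∀ C ⊆ T, ∀ q, (q = v ∨ q = w) → 2 ≤ bd G B (insert q C) := by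
    intro C hC q hq
    refine hB.br _ ?_ (by simp) ?_
    · intro z hz; rw [Finset.mem_insert] at hz
      rcases hz with rfl | hz
      · rcases hq with rfl | rfl <;> assumption
      · exact h.TB (hC hz)
    · intro e
      have hx : x ∈ insert q C := e ▸ xB
      rw [Finset.mem_insert] at hx
      rcases hx with hx | hx
      · have := h.av.ne; have := h.aw.ne; rcases hq with rfl | rfl <;> tauto
      · exact h.nx (hC hx)
  have mv := bd_move (G := G) vB (fun hh => h.nv (YT hh)) (YT.trans h.TB)
  have mw := bd_move (G := G) wB (fun hh => h.nw (YT hh)) (YT.trans h.TB)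
  have iv := ins Y YT v (Or.inl rfl)
  have iw := ins Y YT w (Or.inr rfl)
  have mv' := bd_move (G := G) vB (fun hh => h.nv (ZT hh)) (ZT.trans h.TB)
  have mw' := bd_move (G := G) wB (fun hh => h.nw (ZT hh)) (ZT.trans h.TB)
  have iv' := ins Z ZT v (Or.inl rfl)
  have iw' := ins Z ZT w (Or.inr rfl)
  obtain ⟨y1, hy1, a1, u1⟩ := dg_one (by omega : dg G v Y = 1)
  obtain ⟨y2, hy2, a2, u2⟩ := dg_one (by omega : dg G w Y = 1)
  obtain ⟨z1, hz1, a3, u3⟩ := dg_one (by omega : dg G v Z = 1)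
  have y12 : y1 ≠ y2 := by
    rintro rfl
    exact hc.hyp.c4 x y1 v w (by rintro rfl; exact h.nx (YT hy1)) h.vw h.av a1.symm h.aw a2.symm
  have cB := tight_mod (hc.PW hB.nu hB.conn) hB.w
  have cY' := tight_mod (hc.PW (nuB Y YT) cY) wY
  have cards : B.card = 3 + (Y.card + Z.card) := by
    have e : B = insert v (insert w (insert x T)) := by ext z; simp [h.mem]; tauto
    rw [e, Finset.card_insert_of_notMem (by simp [h.nv, h.vw, h.av.ne']),
      Finset.card_insert_of_notMem (by simp [h.nw, h.aw.ne']), Finset.card_insert_of_notMem h.nx, ← hU,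
      Finset.card_union_of_disjoint hd]
    omega
  have I1 : W G (Y \ {y1, y2}) (-1) := by
    refine lemA_use hc.hyp (YT.trans h.TB) cY (fun C hC => hc.PW (nuB C (hC.trans YT))) wY hy1 hy2 y12
      (fun hh => h.nv (YT hh)) (fun hh => h.nw (YT hh)) a1.symm a2.symm ?_ ?_
    · intro a ha b hb hbY hh
      rcases (h.mem b).1 hb with rfl | rfl | rfl | hb
      · exact absurd hh.symm (dg_zero.1 (h.dx YT) a ha)
      · exact Or.inl (u1 a ha hh.symm)
      · exact Or.inr (u2 a ha hh.symm)
      · rw [← hU, Finset.mem_union] at hb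
        exact absurd hh (hn a ha b (hb.resolve_left hbY))
    · intro C hC hne
      have hC' := (hC.trans Finset.sdiff_subset).trans YT
      exact hB.br C (hC'.trans h.TB) hne (ne C hC')
  have eZ : Z.erase z1 ⊆ T := (Finset.erase_subset _ _).trans ZT
  have wZ : W G (Z.erase z1) 1 := by
    have m := bd_move (G := G) (h.TB (ZT hz1)) (by simp) (eZ.trans h.TB)
    rw [Finset.insert_erase hz1] at m
    have q : 1 + dg G z1 (Z.erase z1) ≤ 3 := by
      have := hc.hyp.deg z1 (insert v (Z.erase z1))
      rw [dg_insert _ _ (fun hh => h.nv (eZ hh)), if_pos a3.symm] at this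
      omega
    have q2 : 1 + dg G z1 (Z.erase z1) ≤ dg G z1 B := by
      have := dg_mono (G := G) z1 (D := insert v (Z.erase z1)) (E := B) (by
        intro z hz; rw [Finset.mem_insert] at hz; rcases hz with rfl | hz; exacts [vB, h.TB (eZ hz)])
      rw [dg_insert _ _ (fun hh => h.nv (eZ hh)), if_pos a3.symm] at this
      omega
    rcases split2 (G := G) 2 (eZ.trans h.TB) (fun C hC hne => hB.br C (hC.trans (eZ.trans h.TB)) hne (ne _ (hC.trans eZ)))
      (by omega) with e | e
    · rw [e]; exact W.empty.le (by norm_num)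
    · exact hc.PW (nuB _ eZ) e
  have cz := Finset.card_erase_add_one hz1
  have I2 : W G (Z.erase z1) (-1) := wZ.mod (-1) (by norm_num) (by omega)
  refine hB.w ((gadN' (X := Y) (Y := Z) (fun z => ?_) ⟨fun hh => h.nx (YT hh), fun hh => h.nx (ZT hh)⟩
    ⟨fun hh => h.nv (YT hh), fun hh => h.nv (ZT hh)⟩
    ⟨fun hh => h.nw (YT hh), fun hh => h.nw (ZT hh)⟩ h.av.ne h.aw.ne h.vw (fun z hz => Finset.disjoint_left.1 hd hz) hn
    h.av h.aw h.navw h.ux hy1 hy2 hz1 y12 a1 u1 u3 u2 I1 I2).le (by norm_num))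
  rw [h.mem, ← hU, Finset.mem_union]

lemma Bx.conn (hc : Cub G) (hB : Block G B) (h : Bx G B T x v w) : Conn G T := by
  have ne : ∀ C ⊆ T, C ≠ B := by rintro C hC rfl; exact h.nx (hC ((h.mem x).2 (Or.inl rfl)))
  have nuB : ∀ C ⊆ T, C ≠ Finset.univ := fun C hC => hB.sub hc (hC.trans h.TB)
  have b := h.bdD subset_rfl
  have dv := h.dv
  have dw := h.symm.dv
  have := hc.hyp.deg v B
  have := hc.hyp.deg w B
  rw [bd_self] at b
  rcases split3 (G := G) 2 h.TB (fun C hC hne => hB.br C (hC.trans h.TB) hne (ne _ hC)) (by omega)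
    with e | e | ⟨C, D, cC, cD, hd, hU, hn, hb⟩
  · exact absurd (e ▸ W.empty) (h.wT hB)
  · exact e
  · exfalso
    have CT : C ⊆ T := hU ▸ Finset.subset_union_left
    have DT : D ⊆ T := hU ▸ Finset.subset_union_right
    by_cases wC : W G C 0
    · refine h.two hc hB cD cC hd.symm (by rw [Finset.union_comm, hU]) (fun y hy z hz hh => hn z hz y hy hh.symm) ?_
      intro wD
      exact h.wT hB (hU ▸ (wC.union0 wD hd hn).le (by norm_num))
    · exact h.two hc hB cC cD hd hU hn wC

lemma gadK0 (h : Bx G B T x v w) {y1 y2 : V} (h1 : y1 ∈ T) (h2 : y2 ∈ T) (n : y1 ≠ y2) (a1 : G.Adj v y1)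
    (u1 : ∀ z ∈ T, G.Adj v z → z = y1) (u2 : ∀ z ∈ T, G.Adj w z → z = y2)
    (I : W G (T \ {y1, y2}) (-1)) : W G B (-2) := by
  obtain ⟨mem, nx, nv, nw, vw, av, aw, navw, ux⟩ := h
  have e1 := av.ne
  have e2 := aw.ne
  have nwv : ¬ G.Adj w v := fun hh => navw hh.symm
  have J1 := I.leaf (u := v) (v := y1) (by grind) (by grind) a1 (by grind)
  have J2 := J1.leaf (u := w) (v := x) (by grind) (by grind) aw.symm (by grind)
  refine (J2.ins y2).to (by norm_num) ?_
  ext z; rw [mem]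
  simp only [FM]
  clear * - h1 h2
  grind

lemma Bx.K0 (hc : Cub G) (hB : Block G B) (h : Bx G B T x v w)
    (hbr : ∀ C ⊆ T, C.Nonempty → C ≠ T → 2 ≤ bd G T C) : Block G T ∧ bd G Finset.univ B < bd G Finset.univ T := by
  have ne : ∀ C ⊆ T, C ≠ B := by rintro C hC rfl; exact h.nx (hC ((h.mem x).2 (Or.inl rfl)))
  have vB : v ∈ B := (h.mem v).2 (by tauto)
  have wB : w ∈ B := (h.mem w).2 (by tauto)
  have xB : x ∈ B := (h.mem x).2 (by tauto)
  have cT := h.conn hc hB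
  have dv := h.dv
  have dw := h.symm.dv
  have dv2 := hB.deg vB
  have dw2 := hB.deg wB
  have y12 : ∀ y1 ∈ T, G.Adj v y1 → G.Adj w y1 → False := by
    intro y1 hy1 a1 a2
    exact hc.hyp.c4 x y1 v w (by rintro rfl; exact h.nx hy1) h.vw h.av a1.symm h.aw a2.symm
  refine ⟨⟨cT, h.wT hB, hB.sub hc h.TB, ?_, hbr⟩, ?_⟩
  · rintro b rfl
    rw [dg_single] at dv dw
    refine y12 b (by simp) ?_ ?_
    · by_contra hh; rw [if_neg hh] at dv; omega
    · by_contra hh; rw [if_neg hh] at dw; omega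
  · have j : dg G v T + dg G w T ≠ 2 := by
      intro hj
      obtain ⟨y1, hy1, a1, u1⟩ := dg_one (by omega : dg G v T = 1)
      obtain ⟨y2, hy2, a2, u2⟩ := dg_one (by omega : dg G w T = 1)
      have n12 : y1 ≠ y2 := by rintro rfl; exact y12 _ hy1 a1 a2
      refine hB.w ((gadK0 h hy1 hy2 n12 a1 u1 u2 ?_).le (by norm_num))
      refine lemA_use hc.hyp h.TB cT (fun C hC => hc.PW (hB.sub hc (hC.trans h.TB))) (h.wT hB) hy1 hy2 n12 h.nv h.nw
        a1.symm a2.symm ?_ ?_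
      · intro a ha b hb hbY hh
        rcases (h.mem b).1 hb with rfl | rfl | rfl | hb
        · exact absurd hh.symm (dg_zero.1 (h.dx subset_rfl) a ha)
        · exact Or.inl (u1 a ha hh.symm)
        · exact Or.inr (u2 a ha hh.symm)
        · exact absurd hb hbY
      · intro C hC hne
        have hC' := hC.trans Finset.sdiff_subset
        exact hB.br C (hC'.trans h.TB) hne (ne C hC')
    have m1 := bd_move (G := G) (Finset.mem_univ v) h.nv (Finset.subset_univ T)
    have m2 := bd_move (G := G) (Finset.mem_univ w) (C := insert v T) (by simp [h.nw, h.vw.symm]) (Finset.subset_univ _)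
    have m3 := bd_move (G := G) (Finset.mem_univ x) (C := insert w (insert v T)) (by simp [h.nx, h.av.ne, h.aw.ne])
      (Finset.subset_univ _)
    have e : insert x (insert w (insert v T)) = B := by ext z; simp [h.mem]; tauto
    rw [dg_insert _ _ h.nv, if_neg (fun hh => h.navw hh.symm)] at m2
    rw [e, dg_insert _ _ (by simp [h.nw, h.vw.symm]), dg_insert _ _ h.nv, if_pos h.av, if_pos h.aw, h.dx subset_rfl] at m3
    rw [hc.cub] at m1 m2 m3
    omega

end

lemma gadAC {B D1 D2 D3 : Finset V} {x v w a s p q t : V}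
    (mem : ∀ z, z ∈ B ↔ z = x ∨ z = v ∨ z = w ∨ z = a ∨ z ∈ D1 ∨ z ∈ D2 ∨ z ∈ D3)
    (nx : x ∉ D1 ∧ x ∉ D2 ∧ x ∉ D3) (nv : v ∉ D1 ∧ v ∉ D2 ∧ v ∉ D3) (nw : w ∉ D1 ∧ w ∉ D2 ∧ w ∉ D3)
    (na : a ∉ D1 ∧ a ∉ D2 ∧ a ∉ D3) (d1 : x ≠ v ∧ x ≠ w ∧ x ≠ a ∧ v ≠ w ∧ v ≠ a ∧ w ≠ a)
    (d12 : ∀ z ∈ D1, z ∉ D2) (d13 : ∀ z ∈ D1, z ∉ D3) (d23 : ∀ z ∈ D2, z ∉ D3)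
    (n12 : ∀ x ∈ D1, ∀ y ∈ D2, ¬ G.Adj x y) (n13 : ∀ x ∈ D1, ∀ y ∈ D3, ¬ G.Adj x y)
    (n23 : ∀ x ∈ D2, ∀ y ∈ D3, ¬ G.Adj x y)
    (hs : s ∈ D1) (hp : p ∈ D2) (hq : q ∈ D2) (ht : t ∈ D3) (hpq : p ≠ q)
    (ap : G.Adj a p) (aq : G.Adj w q) (axv : G.Adj x v)
    (u1 : ∀ z ∈ D1, G.Adj a z → z = s) (u2 : ∀ z ∈ D2, G.Adj a z → z = p) (u3 : ∀ z ∈ D3, G.Adj a z → z = t)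
    (nav : ¬ G.Adj a v) (naw : ¬ G.Adj a w) (nvw : ¬ G.Adj v w) (nax : ¬ G.Adj a x)
    (x1 : ∀ z ∈ D1, ¬ G.Adj x z) (x2 : ∀ z ∈ D2, ¬ G.Adj x z) (x3 : ∀ z ∈ D3, ¬ G.Adj x z)
    (v2 : ∀ z ∈ D2, ¬ G.Adj v z) (v3 : ∀ z ∈ D3, ¬ G.Adj v z) (w1 : ∀ z ∈ D1, ¬ G.Adj w z)
    (w2 : ∀ z ∈ D2, G.Adj w z → z = q)
    (I1 : W G (D1.erase s) 0) (I2 : W G (D2 \ {p, q}) (-1)) (I3 : W G (D3.erase t) 0) : W G B (-2) := by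
  have J := I2.leaf (u := a) (v := p) (by grind) (by grind) ap (by grind)
  have J := J.leaf (u := w) (v := q) (by grind) (by grind) aq (by
    have : ¬ G.Adj w a := fun hh => naw hh.symm
    grind)
  have J := J.union I3 (by rw [Finset.disjoint_left]; grind) w (by grind)
  have P := I1.leaf (u := x) (v := v) (by grind) (by grind) axv (by grind)
  have x2' : ∀ z ∈ D2, ¬ G.Adj z x := fun z hz hh => x2 z hz hh.symm
  have x3' : ∀ z ∈ D3, ¬ G.Adj z x := fun z hz hh => x3 z hz hh.symm
  have v2' : ∀ z ∈ D2, ¬ G.Adj z v := fun z hz hh => v2 z hz hh.symm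
  have v3' : ∀ z ∈ D3, ¬ G.Adj z v := fun z hz hh => v3 z hz hh.symm
  have wv' : ¬ G.Adj w v := fun hh => nvw hh.symm
  have n21 : ∀ y ∈ D2, ∀ x ∈ D1, ¬ G.Adj y x := fun y hy x hx hh => n12 x hx y hy hh.symm
  have n31 : ∀ y ∈ D3, ∀ x ∈ D1, ¬ G.Adj y x := fun y hy x hx hh => n13 x hx y hy hh.symm
  clear I1 I2 I3
  have K := J.union P (by
    rw [Finset.disjoint_left]; intro z
    simp only [FM]
    clear * - nx nv nw na d1 d12 d13 hp hq
    grind) x (by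
    intro z hz y hy
    simp only [FM] at hz hy
    clear * - u1 nav nax x2' x3' v2' v3' wv' n21 n31 w1 hp hq hs hz hy
    grind)
  refine ((K.ins s).ins t).to (by norm_num) ?_
  ext z; rw [mem]
  simp only [FM]
  clear * - hs hp hq ht; grind

lemma gadB {B D1 D2 D3 : Finset V} {x v w a s p q t : V}
    (mem : ∀ z, z ∈ B ↔ z = x ∨ z = v ∨ z = w ∨ z = a ∨ z ∈ D1 ∨ z ∈ D2 ∨ z ∈ D3)
    (nx : x ∉ D1 ∧ x ∉ D2 ∧ x ∉ D3) (nv : v ∉ D1 ∧ v ∉ D2 ∧ v ∉ D3) (nw : w ∉ D1 ∧ w ∉ D2 ∧ w ∉ D3)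
    (na : a ∉ D1 ∧ a ∉ D2 ∧ a ∉ D3) (d1 : x ≠ v ∧ x ≠ w ∧ x ≠ a ∧ v ≠ w ∧ v ≠ a ∧ w ≠ a)
    (d12 : ∀ z ∈ D1, z ∉ D2) (d13 : ∀ z ∈ D1, z ∉ D3) (d23 : ∀ z ∈ D2, z ∉ D3)
    (n12 : ∀ x ∈ D1, ∀ y ∈ D2, ¬ G.Adj x y) (n13 : ∀ x ∈ D1, ∀ y ∈ D3, ¬ G.Adj x y)
    (n23 : ∀ x ∈ D2, ∀ y ∈ D3, ¬ G.Adj x y)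
    (hs : s ∈ D1) (hp : p ∈ D2) (hq : q ∈ D2) (ht : t ∈ D3) (hpq : p ≠ q)
    (ap : G.Adj a p) (aq : G.Adj v q) (axw : G.Adj x w)
    (u1 : ∀ z ∈ D1, G.Adj a z → z = s) (u2 : ∀ z ∈ D2, G.Adj a z → z = p) (u3 : ∀ z ∈ D3, G.Adj a z → z = t)
    (nav : ¬ G.Adj a v) (naw : ¬ G.Adj a w) (nvw : ¬ G.Adj v w) (nax : ¬ G.Adj a x)
    (x1 : ∀ z ∈ D1, ¬ G.Adj x z) (x2 : ∀ z ∈ D2, ¬ G.Adj x z) (x3 : ∀ z ∈ D3, ¬ G.Adj x z)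
    (w2 : ∀ z ∈ D2, ¬ G.Adj w z) (v2 : ∀ z ∈ D2, G.Adj v z → z = q)
    (I1 : W G (D1.erase s) 0) (I2 : W G (D2 \ {p, q}) (-1)) (I3 : W G (D3.erase t) 0) : W G B (-2) := by
  have J := I2.leaf (u := a) (v := p) (by grind) (by grind) ap (by grind)
  have J := J.leaf (u := v) (v := q) (by grind) (by grind) aq (by
    have : ¬ G.Adj v a := fun hh => nav hh.symm
    grind)
  have P := I1.union0 I3 (by rw [Finset.disjoint_left]; grind) (by grind)
  have P := P.leaf (u := x) (v := w) (by grind) (by grind) axw (by grind)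
  have x2' : ∀ z ∈ D2, ¬ G.Adj z x := fun z hz hh => x2 z hz hh.symm
  have w2' : ∀ z ∈ D2, ¬ G.Adj z w := fun z hz hh => w2 z hz hh.symm
  have n21 : ∀ y ∈ D2, ∀ x ∈ D1, ¬ G.Adj y x := fun y hy x hx hh => n12 x hx y hy hh.symm
  clear I1 I2 I3
  have K := J.union P (by
    rw [Finset.disjoint_left]; intro z
    simp only [FM]
    clear * - nx nv nw na d1 d12 d23 hp hq
    grind) v (by
    intro z hz y hy
    simp only [FM] at hz hy
    clear * - u1 u3 nav naw nax x2' w2' n21 n23 hp hq hs ht hz hy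
    grind)
  refine ((K.ins s).ins t).to (by norm_num) ?_
  ext z; rw [mem]
  simp only [FM]
  clear * - hs hp hq ht; grind

section
variable {T D1 D2 D3 : Finset V} {a s1 s2 s3 : V}

lemma TBr.t1 (tb : TBr G T D1 D2 D3 a s1 s2 s3) : D1 ⊆ T := fun z hz => (tb.mem z).2 (by tauto)
lemma TBr.t2 (tb : TBr G T D1 D2 D3 a s1 s2 s3) : D2 ⊆ T := fun z hz => (tb.mem z).2 (by tauto)
lemma TBr.t3 (tb : TBr G T D1 D2 D3 a s1 s2 s3) : D3 ⊆ T := fun z hz => (tb.mem z).2 (by tauto)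
lemma TBr.t0 (tb : TBr G T D1 D2 D3 a s1 s2 s3) : a ∈ T := (tb.mem a).2 (Or.inl rfl)

lemma TBr.bd1 (tb : TBr G T D1 D2 D3 a s1 s2 s3) : bd G T D1 = 1 := by
  have e2 : T \ D1 = insert a (D2 ∪ D3) := by
    ext z
    have := tb.mem z; have := tb.na; have := tb.d12 z; have := tb.d13 z
    simp only [FM]
    constructor
    · tauto
    · rintro (rfl | h' | h') <;> tauto
  have e3 : ee G D1 (D2 ∪ D3) = 0 := by
    rw [ee_zero]; intro x hx y hy
    rcases Finset.mem_union.1 hy with h' | h'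
    · exact tb.n12 x hx y h'
    · exact tb.n13 x hx y h'
  have e4 : dg G a D1 = 1 := by
    rw [← Finset.insert_erase tb.m1, dg_insert _ _ (by simp), dg_zero.2, if_pos tb.a1]
    intro z hz hh; simp at hz; exact hz.1 (tb.u1 z hz.2 hh)
  unfold bd
  rw [e2, ee_insert_right _ (by simp [tb.na]), e3, e4]

lemma TBr.na' (hc : Cub G) (tb : TBr G T D1 D2 D3 a s1 s2 s3) {z : V} (hz : z ∉ T) : ¬ G.Adj a z := by
  intro hh
  have := hc.hyp.deg a {z, s1, s2, s3}
  have e1 : s1 ≠ s2 := fun e => tb.d12 _ tb.m1 (e ▸ tb.m2)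
  have e2 : s1 ≠ s3 := fun e => tb.d13 _ tb.m1 (e ▸ tb.m3)
  have e3 : s2 ≠ s3 := fun e => tb.d23 _ tb.m2 (e ▸ tb.m3)
  have e4 : z ≠ s1 := fun e => hz (e ▸ tb.t1 tb.m1)
  have e5 : z ≠ s2 := fun e => hz (e ▸ tb.t2 tb.m2)
  have e6 : z ≠ s3 := fun e => hz (e ▸ tb.t3 tb.m3)
  rw [dg_insert _ _ (by simp [*]), dg_insert _ _ (by simp [*]), dg_insert _ _ (by simp [*]), dg_single] at this
  simp [hh, tb.a1, tb.a2, tb.a3] at this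

lemma TBr.dg (hc : Cub G) (tb : TBr G T D1 D2 D3 a s1 s2 s3) {z : V} (hz : z ∉ T) :
    dg G z T = dg G z D1 + dg G z D2 + dg G z D3 := by
  have e : T = insert a (D1 ∪ D2 ∪ D3) := by ext z; simp [tb.mem]
  have dd1 : Disjoint D1 D2 := Finset.disjoint_left.2 (fun z => tb.d12 z)
  have dd2 : Disjoint (D1 ∪ D2) D3 := Finset.disjoint_left.2 (fun z hz => by
    rcases Finset.mem_union.1 hz with h' | h'
    exacts [tb.d13 z h', tb.d23 z h'])
  rw [e, dg_insert _ _ (by simp [tb.na]), if_neg (fun hh => tb.na' hc hz hh.symm), dg_union _ dd2, dg_union _ dd1, Nat.add_zero]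

variable {B : Finset V} {x v w : V}

lemma TBr.ge (hc : Cub G) (hB : Block G B) (h : Bx G B T x v w) (tb : TBr G T D1 D2 D3 a s1 s2 s3) :
    bd G B D1 = 1 + URPaper.dg G v D1 + URPaper.dg G w D1 ∧ 1 ≤ URPaper.dg G v D1 + URPaper.dg G w D1 := by
  have h1 := h.bdD tb.t1
  rw [tb.bd1] at h1
  have := hB.br D1 (tb.t1.trans h.TB) tb.c1.1 (by
    rintro rfl; exact h.nx (tb.t1 ((h.mem x).2 (Or.inl rfl))))
  omega

lemma TBr.att (hc : Cub G) (hB : Block G B) (h : Bx G B T x v w) (tb : TBr G T D1 D2 D3 a s1 s2 s3)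
    (dv : URPaper.dg G v D1 = 0) (dw : URPaper.dg G w D1 = 1) (hD : ∀ c, D1 ≠ {c}) :
    ∃ p ∈ D1, G.Adj w p ∧ (∀ z ∈ D1, G.Adj w z → z = p) ∧ s1 ≠ p ∧ W G (D1 \ {s1, p}) (-1) := by
  obtain ⟨p, hp, ap, up⟩ := dg_one dw
  have ne : ∀ C ⊆ T, C ≠ B := by rintro C hC rfl; exact h.nx (hC ((h.mem x).2 (Or.inl rfl)))
  have b := (tb.ge hc hB h).1
  have wB : w ∈ B := (h.mem w).2 (by tauto)
  have D1B := tb.t1.trans h.TB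
  have sp : s1 ≠ p := by
    rintro rfl
    have eD : D1.erase s1 ⊆ B := (Finset.erase_subset _ _).trans D1B
    have m := bd_move (G := G) (D1B tb.m1) (by simp) eD
    rw [Finset.insert_erase tb.m1] at m
    have wn : w ∉ insert a (D1.erase s1) := by
      have := h.nw; have := tb.t0; simp only [FM]
      rintro (rfl | h')
      · tauto
      · exact h.nw (tb.t1 h'.2)
    have an : a ∉ D1.erase s1 := by simp [tb.na]
    have q := hc.hyp.deg s1 (insert w (insert a (D1.erase s1)))
    have q2 := dg_mono (G := G) s1 (D := insert w (insert a (D1.erase s1))) (E := B) (by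
        intro z hz; rw [Finset.mem_insert, Finset.mem_insert] at hz
        rcases hz with rfl | rfl | hz; exacts [wB, h.TB tb.t0, eD hz])
    rw [dg_insert _ _ wn, dg_insert _ _ an, if_pos ap.symm, if_pos tb.a1.symm] at q q2
    have := hB.br (D1.erase s1) eD (by
      rw [Finset.nonempty_iff_ne_empty]; intro h'
      rw [Finset.erase_eq_empty_iff] at h'
      rcases h' with h' | h'
      · have := tb.m1; rw [h'] at this; simp at this
      · exact hD s1 h') (ne _ ((Finset.erase_subset _ _).trans tb.t1))
    omega
  refine ⟨p, hp, ap, up, sp, lemA_use hc.hyp D1B tb.c1 (fun C hC => hc.PW (hB.sub hc (hC.trans D1B))) tb.w1 tb.m1 hp sp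
    tb.na.1 (fun hh => h.nw (tb.t1 hh)) tb.a1.symm ap.symm ?_ ?_⟩
  · intro y hy b hb hbD hh
    rcases (h.mem b).1 hb with rfl | rfl | rfl | hb
    · exact absurd hh.symm (dg_zero.1 (h.dx tb.t1) y hy)
    · exact absurd hh.symm (dg_zero.1 dv y hy)
    · exact Or.inr (up y hy hh.symm)
    · rcases (tb.mem b).1 hb with rfl | h' | h' | h'
      · exact Or.inl (tb.u1 y hy hh.symm)
      · exact absurd h' hbD
      · exact absurd hh (tb.n12 _ hy _ h')
      · exact absurd hh (tb.n13 _ hy _ h')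
  · intro C hC hne
    have hC' := (hC.trans Finset.sdiff_subset).trans tb.t1
    exact hB.br C (hC'.trans h.TB) hne (ne C hC')

lemma TBr.er (hc : Cub G) (hT : T ≠ Finset.univ) (tb : TBr G T D1 D2 D3 a s1 s2 s3) : W G (D1.erase s1) 0 :=
  drop1_use hc.hyp tb.c1 (fun C hC => hc.PW (by
    rintro rfl; exact hT (Finset.univ_subset_iff.1 (hC.trans tb.t1)))) tb.w1 tb.m1 tb.na.1 tb.a1.symm

lemma TBr.memB (h : Bx G B T x v w) (tb : TBr G T D1 D2 D3 a s1 s2 s3) :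
    ∀ z, z ∈ B ↔ z = x ∨ z = v ∨ z = w ∨ z = a ∨ z ∈ D1 ∨ z ∈ D2 ∨ z ∈ D3 := by
  intro z; rw [h.mem, tb.mem]

lemma TBr.AC' (hc : Cub G) (hB : Block G B) (h : Bx G B T x v w) (tb : TBr G T D1 D2 D3 a s1 s2 s3)
    (v2 : URPaper.dg G v D2 = 0) (v3 : URPaper.dg G v D3 = 0) (w1 : URPaper.dg G w D1 = 0)
    (w2 : URPaper.dg G w D2 = 1) (hD : ∀ c, D2 ≠ {c}) : False := by
  obtain ⟨q, hq, aq, uq, hpq, I2⟩ := tb.p12.att hc hB h v2 w2 hD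
  have hT := hB.sub hc h.TB
  have nn : ∀ {z}, z ∉ T → z ∉ D1 ∧ z ∉ D2 ∧ z ∉ D3 := fun hz =>
    ⟨fun h' => hz (tb.t1 h'), fun h' => hz (tb.t2 h'), fun h' => hz (tb.t3 h')⟩
  have ne : ∀ {z}, z ∉ T → z ≠ a := fun hz e => hz (e ▸ tb.t0)
  refine hB.w ((gadAC (tb.memB h) (nn h.nx) (nn h.nv) (nn h.nw) tb.na ⟨h.av.ne, h.aw.ne, ne h.nx, h.vw, ne h.nv, ne h.nw⟩
    tb.d12 tb.d13 tb.d23 tb.n12 tb.n13 tb.n23 tb.m1 tb.m2 hq tb.m3 hpq tb.a2 aq h.av tb.u1 tb.u2 tb.u3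
    (tb.na' hc h.nv) (tb.na' hc h.nw) h.navw (tb.na' hc h.nx) (dg_zero.1 (h.dx tb.t1)) (dg_zero.1 (h.dx tb.t2))
    (dg_zero.1 (h.dx tb.t3)) (dg_zero.1 v2) (dg_zero.1 v3) (dg_zero.1 w1) uq (tb.er hc hT) I2
    (tb.p23.p12.er hc hT)).le (by norm_num))

lemma TBr.AC (hc : Cub G) (hB : Block G B) (h : Bx G B T x v w) (tb : TBr G T D1 D2 D3 a s1 s2 s3)
    (v2 : URPaper.dg G v D2 = 0) (v3 : URPaper.dg G v D3 = 0) (w1 : URPaper.dg G w D1 = 0)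
    (w2 : URPaper.dg G w D2 = 1) (w3 : URPaper.dg G w D3 = 1) : False := by
  by_cases e2 : ∃ c, D2 = {c}
  · by_cases e3 : ∃ c, D3 = {c}
    · obtain ⟨p, hp, ap, -⟩ := dg_one w2
      obtain ⟨q, hq, aq, -⟩ := dg_one w3
      have m2 := tb.m2
      have m3 := tb.m3
      have d23 := tb.d23
      have a2 := tb.a2
      have a3 := tb.a3
      obtain ⟨c, rfl⟩ := e2
      obtain ⟨d, rfl⟩ := e3
      simp at hp hq m2 m3 d23
      subst hp hq m2 m3
      exact hc.hyp.c4 a w _ _ (by rintro rfl; exact h.nw tb.t0) d23 a2 ap a3 aq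
    · exact tb.p23.AC' hc hB h v3 v2 w1 w3 (fun c e => e3 ⟨c, e⟩)
  · exact tb.AC' hc hB h v2 v3 w1 w2 (fun c e => e2 ⟨c, e⟩)

lemma TBr.B' (hc : Cub G) (hB : Block G B) (h : Bx G B T x v w) (tb : TBr G T D1 D2 D3 a s1 s2 s3)
    (v2 : URPaper.dg G v D2 = 1) (w2 : URPaper.dg G w D2 = 0) : ∃ c, D2 = {c} := by
  by_contra hD
  obtain ⟨q, hq, aq, uq, hpq, I2⟩ := tb.p12.att hc hB h.symm w2 v2 (fun c e => hD ⟨c, e⟩)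
  have hT := hB.sub hc h.TB
  have nn : ∀ {z}, z ∉ T → z ∉ D1 ∧ z ∉ D2 ∧ z ∉ D3 := fun hz =>
    ⟨fun h' => hz (tb.t1 h'), fun h' => hz (tb.t2 h'), fun h' => hz (tb.t3 h')⟩
  have ne : ∀ {z}, z ∉ T → z ≠ a := fun hz e => hz (e ▸ tb.t0)
  refine hB.w ((gadB (tb.memB h) (nn h.nx) (nn h.nv) (nn h.nw) tb.na ⟨h.av.ne, h.aw.ne, ne h.nx, h.vw, ne h.nv, ne h.nw⟩
    tb.d12 tb.d13 tb.d23 tb.n12 tb.n13 tb.n23 tb.m1 tb.m2 hq tb.m3 hpq tb.a2 aq h.aw tb.u1 tb.u2 tb.u3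
    (tb.na' hc h.nv) (tb.na' hc h.nw) h.navw (tb.na' hc h.nx) (dg_zero.1 (h.dx tb.t1)) (dg_zero.1 (h.dx tb.t2))
    (dg_zero.1 (h.dx tb.t3)) (dg_zero.1 w2) uq (tb.er hc hT) I2
    (tb.p23.p12.er hc hT)).le (by norm_num))
end

variable (G) in
structure Hex (B D : Finset V) (a h v x w k ya yv yw : V) : Prop where
  mem : ∀ z, z ∈ B ↔ z = a ∨ z = h ∨ z = v ∨ z = x ∨ z = w ∨ z = k ∨ z ∈ D
  nd : (a ≠ h ∧ a ≠ v ∧ a ≠ x ∧ a ≠ w ∧ a ≠ k) ∧ (h ≠ v ∧ h ≠ x ∧ h ≠ w ∧ h ≠ k) ∧ (v ≠ x ∧ v ≠ w ∧ v ≠ k) ∧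
    (x ≠ w ∧ x ≠ k) ∧ w ≠ k
  nD : (a ∉ D ∧ v ∉ D ∧ w ∉ D) ∧ h ∉ D ∧ x ∉ D ∧ k ∉ D
  ah : G.Adj a h
  hv : G.Adj h v
  vx : G.Adj v x
  xw : G.Adj x w
  wk : G.Adj w k
  ka : G.Adj k a
  ma : ya ∈ D
  mv : yv ∈ D
  mw : yw ∈ D
  ta : G.Adj a ya
  tv : G.Adj v yv
  tw : G.Adj w yw
  ua : ∀ z ∈ D, G.Adj a z → z = ya
  uv : ∀ z ∈ D, G.Adj v z → z = yv
  uw : ∀ z ∈ D, G.Adj w z → z = yw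
  uh : ∀ z ∈ B, G.Adj h z → z = a ∨ z = v
  ux : ∀ z ∈ B, G.Adj x z → z = v ∨ z = w
  uk : ∀ z ∈ B, G.Adj k z → z = w ∨ z = a
  ny : ya ≠ yv ∧ ya ≠ yw ∧ yv ≠ yw
  nn : ¬ G.Adj a v ∧ ¬ G.Adj v w ∧ ¬ G.Adj a w
  c : Conn G D
  t : ¬ W G D 0

section
variable {B D : Finset V} {a h v x w k ya yv yw : V}

lemma Hex.rot (H : Hex G B D a h v x w k ya yv yw) : Hex G B D v x w k a h yv yw ya := by
  obtain ⟨mem, ⟨⟨q1, q2, q3, q4, q5⟩, ⟨q6, q7, q8, q9⟩, ⟨q10, q11, q12⟩, ⟨q13, q14⟩, q15⟩, ⟨⟨n1, n2, n3⟩, n4, n5, n6⟩, ah, hv, vx, xw, wk, ka, ma, mv, mw, ta, tv, tw, ua, uv, uw, uh, ux, uk, ⟨y1, y2, y3⟩, ⟨p1, p2, p3⟩, c, t⟩ := H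
  exact ⟨fun z => by rw [mem]; tauto,
    ⟨⟨q10, q11, q12, q2.symm, q6.symm⟩, ⟨q13, q14, q3.symm, q7.symm⟩, ⟨q15, q4.symm, q8.symm⟩, ⟨q5.symm, q9.symm⟩, q1⟩,
    ⟨⟨n2, n3, n1⟩, n5, n6, n4⟩, vx, xw, wk, ka, ah, hv, mv, mw, ma, tv, tw, ta, uv, uw, ua, ux, uk, uh,
    ⟨y3, y1.symm, y2.symm⟩, ⟨p2, fun e => p3 e.symm, fun e => p1 e.symm⟩, c, t⟩

lemma Hex.dg0 (H : Hex G B D a h v x w k ya yv yw) : dg G h D = 0 := by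
  rw [dg_zero]; intro z hz hh
  rcases H.uh z ((H.mem z).2 (by tauto)) hh with rfl | rfl
  exacts [H.nD.1.1 hz, H.nD.1.2.1 hz]

lemma Hex.dg1 (H : Hex G B D a h v x w k ya yv yw) : dg G a D = 1 := by
  rw [← Finset.insert_erase H.ma, dg_insert _ _ (by simp), dg_zero.2, if_pos H.ta]
  intro z hz hh; simp at hz; exact hz.1 (H.ua z hz.2 hh)

lemma Hex.DB (H : Hex G B D a h v x w k ya yv yw) : D ⊆ B := fun z hz => (H.mem z).2 (by tauto)

lemma Hex.lt (H : Hex G B D a h v x w k ya yv yw) : D.card < B.card :=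
  Finset.card_lt_card ⟨H.DB, fun hh => H.nD.1.1 (hh ((H.mem a).2 (by tauto)))⟩

lemma Hex.block (hc : Cub G) (hB : Block G B) (H : Hex G B D a h v x w k ya yv yw)
    (hbr : ∀ C ⊆ D, C.Nonempty → C ≠ D → 2 ≤ bd G D C) : Block G D :=
  ⟨H.c, H.t, hB.sub hc H.DB, by
    rintro b rfl
    have h1 := H.ma; have h2 := H.mv
    rw [Finset.mem_singleton] at h1 h2
    exact H.ny.1 (h1.trans h2.symm), hbr⟩

lemma Hex.bd (hc : Cub G) (H : Hex G B D a h v x w k ya yv yw) :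
    bd G Finset.univ B = bd G Finset.univ D := by
  have a1 := H.dg1
  have a2 := H.rot.dg1
  have a3 := H.rot.rot.dg1
  have b1 := H.dg0
  have b2 := H.rot.dg0
  have b3 := H.rot.rot.dg0
  obtain ⟨mem, ⟨⟨q1, q2, q3, q4, q5⟩, ⟨q6, q7, q8, q9⟩, ⟨q10, q11, q12⟩, ⟨q13, q14⟩, q15⟩, ⟨⟨n1, n2, n3⟩, n4, n5, n6⟩, ah, hv, vx, xw, wk, ka, ma, mv, mw, ta, tv, tw, ua, uv, uw, uh, ux, uk, ⟨y1, y2, y3⟩, ⟨p1, p2, p3⟩, c, t⟩ := H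
  have f1 : a ∉ D := n1
  have f2 : v ∉ insert a D := by simp [n2, q2.symm]
  have f3 : w ∉ insert v (insert a D) := by simp [n3, q4.symm, q11.symm]
  have f4 : h ∉ insert w (insert v (insert a D)) := by simp [n4, q8, q6, q1.symm]
  have f5 : x ∉ insert h (insert w (insert v (insert a D))) := by simp [n5, q7.symm, q13, q10.symm, q3.symm]
  have f6 : k ∉ insert x (insert h (insert w (insert v (insert a D)))) := by
    simp [n6, q14.symm, q9.symm, q15.symm, q12.symm, q5.symm]
  have e : insert k (insert x (insert h (insert w (insert v (insert a D))))) = B := by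
    ext z; simp only [mem, Finset.mem_insert]; clear * -; tauto
  have m1 := bd_move (G := G) (Finset.mem_univ _) f1 (Finset.subset_univ _)
  have m2 := bd_move (G := G) (Finset.mem_univ _) f2 (Finset.subset_univ _)
  have m3 := bd_move (G := G) (Finset.mem_univ _) f3 (Finset.subset_univ _)
  have m4 := bd_move (G := G) (Finset.mem_univ _) f4 (Finset.subset_univ _)
  have m5 := bd_move (G := G) (Finset.mem_univ _) f5 (Finset.subset_univ _)
  have m6 := bd_move (G := G) (Finset.mem_univ _) f6 (Finset.subset_univ _)
  have hB : ∀ z, z = a ∨ z = h ∨ z = v ∨ z = x ∨ z = w ∨ z = k ∨ z ∈ D → z ∈ B := fun z => (mem z).2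
  have hw : ¬ G.Adj h w := fun hh => by rcases uh w (hB w (by simp)) hh with e | e <;> simp [e] at q4 q11
  have xa : ¬ G.Adj x a := fun hh => by rcases ux a (hB a (by simp)) hh with e | e <;> simp [e] at q4 q2
  have xh : ¬ G.Adj x h := fun hh => by rcases ux h (hB h (by simp)) hh with e | e <;> simp [e] at q8 q6
  have kv : ¬ G.Adj k v := fun hh => by rcases uk v (hB v (by simp)) hh with e | e <;> simp [e] at q11 q2
  have kx : ¬ G.Adj k x := fun hh => by rcases uk x (hB x (by simp)) hh with e | e <;> simp [e] at q13 q3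
  have kh : ¬ G.Adj k h := fun hh => by rcases uk h (hB h (by simp)) hh with e | e <;> simp [e] at q8 q1
  rw [hc.cub] at m1 m2 m3 m4 m5 m6
  rw [dg_insert _ _ f1, if_neg (fun hh => p1 hh.symm), a2] at m2
  rw [dg_insert _ _ f2, dg_insert _ _ f1, if_neg (fun hh => p3 hh.symm), if_neg (fun hh => p2 hh.symm), a3] at m3
  rw [dg_insert _ _ f3, dg_insert _ _ f2, dg_insert _ _ f1, b1, if_neg hw, if_pos hv, if_pos ah.symm] at m4
  rw [dg_insert _ _ f4, dg_insert _ _ f3, dg_insert _ _ f2, dg_insert _ _ f1, b2, if_neg xh, if_neg xa, if_pos xw,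
    if_pos vx.symm] at m5
  rw [e, dg_insert _ _ f5, dg_insert _ _ f4, dg_insert _ _ f3, dg_insert _ _ f2, dg_insert _ _ f1, b3, if_neg kx, if_neg kh, if_neg kv, if_pos wk.symm,
    if_pos ka] at m6
  omega
end

section
variable {T D1 D2 D3 : Finset V} {a s1 s2 s3 : V} {B : Finset V} {x v w : V}

lemma TBr.hex (hc : Cub G) (hB : Block G B) (h : Bx G B T x v w) (tb : TBr G T D1 D2 D3 a s1 s2 s3)
    (v1 : URPaper.dg G v D1 = 1) (v2 : URPaper.dg G v D2 = 1) (v3 : URPaper.dg G v D3 = 0)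
    (w1 : URPaper.dg G w D1 = 1) (w2 : URPaper.dg G w D2 = 0) (w3 : URPaper.dg G w D3 = 1) :
    ∃ D a h v x w k ya yv yw, Hex G B D a h v x w k ya yv yw := by
  obtain ⟨h2, e2⟩ := tb.B' hc hB h v2 w2
  obtain ⟨h3, e3⟩ := tb.p23.B' hc hB h.symm w3 v3
  obtain ⟨yv, myv, ayv, uyv⟩ := dg_one v1
  obtain ⟨yw, myw, ayw, uyw⟩ := dg_one w1
  have nn : ∀ {z}, z ∉ T → z ∉ D1 ∧ z ∉ D2 ∧ z ∉ D3 := fun hz =>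
    ⟨fun h' => hz (tb.t1 h'), fun h' => hz (tb.t2 h'), fun h' => hz (tb.t3 h')⟩
  have ne : ∀ {z}, z ∉ T → z ≠ a := fun hz e => hz (e ▸ tb.t0)
  have nx := nn h.nx
  have nv := nn h.nv
  have nw := nn h.nw
  have nxa := ne h.nx
  have nva := ne h.nv
  have nwa := ne h.nw
  have mem := tb.memB h
  have m2 := tb.m2
  have m3 := tb.m3
  have d2 := tb.d12
  have d3 := tb.d13
  have d23 := tb.d23 _ m2
  have na := tb.na
  have a2 := tb.a2
  have a3 := tb.a3
  have n12 := tb.n12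
  have n13 := tb.n13
  have n23 := tb.n23 _ m2 _ m3
  have nav := tb.na' hc h.nv
  have naw := tb.na' hc h.nw
  have nax := tb.na' hc h.nx
  obtain ⟨p, mp, ap, -⟩ := dg_one v2
  obtain ⟨q, mq, aq, -⟩ := dg_one w3
  have v3' := dg_zero.1 v3 _ m3
  have w2' := dg_zero.1 w2 _ m2
  have x1 := dg_zero.1 (h.dx tb.t1)
  have x2 := dg_zero.1 (h.dx tb.t2) _ m2
  have x3 := dg_zero.1 (h.dx tb.t3) _ m3
  have u1 := tb.u1
  have c1 := tb.c1
  have w1' := tb.w1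
  have m1 := tb.m1
  have a1 := tb.a1
  subst e2 e3
  simp only [Finset.mem_singleton] at m2 m3 mp mq mem nx nv nw d2 d3 na d23
  subst m2 m3 mp mq
  have c4 := hc.hyp.c4
  have av := h.av
  have aw := h.aw
  have vw := h.vw
  refine ⟨D1, a, p, v, x, w, q, s1, yv, yw, ?_, ?_, ?_, a2, ap.symm, av.symm, aw, aq, a3.symm, m1, myv, myw, a1, ayv, ayw, u1,
    uyv, uyw, ?_, h.ux, ?_, ?_, ⟨nav, h.navw, naw⟩, c1, w1'⟩
  · intro z; rw [mem]; tauto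
  · have i1 := av.ne; have i2 := aw.ne; clear * - nx nv nw na nxa nva nwa vw d23 i1 i2; grind
  · clear * - nx nv nw na d2 d3; grind
  · intro z hz hh
    rcases (mem z).1 hz with rfl | rfl | rfl | rfl | hz | rfl | rfl
    · exact absurd hh.symm x2
    · tauto
    · exact absurd hh.symm w2'
    · tauto
    · exact absurd hh.symm (n12 _ hz _ (by simp))
    · exact absurd hh G.irrefl
    · exact absurd hh n23
  · intro z hz hh
    rcases (mem z).1 hz with rfl | rfl | rfl | rfl | hz | rfl | rfl
    · exact absurd hh.symm x3
    · exact absurd hh.symm v3'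
    · tauto
    · tauto
    · exact absurd hh.symm (n13 _ hz _ (by simp))
    · exact absurd hh.symm n23
    · exact absurd hh G.irrefl
  · refine ⟨?_, ?_, ?_⟩
    · rintro rfl; exact c4 a v p s1 nva.symm (fun e => d2 s1 m1 e.symm) a2 ap a1 ayv
    · rintro rfl; exact c4 a w q s1 nwa.symm (fun e => d3 s1 m1 e.symm) a3 aq a1 ayw
    · rintro rfl; exact c4 v w x yv vw (fun e => nx.1 (e ▸ myv)) av.symm aw.symm ayv ayw

lemma TBr.exhex (hc : Cub G) (hB : Block G B) (h : Bx G B T x v w) (tb : TBr G T D1 D2 D3 a s1 s2 s3) :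
    ∃ D a h v x w k ya yv yw, Hex G B D a h v x w k ya yv yw := by
  have g1 := (tb.ge hc hB h).2
  have g2 := (tb.p12.ge hc hB h).2
  have g3 := (tb.p23.p12.ge hc hB h).2
  have dv := tb.dg hc h.nv
  have dw := tb.dg hc h.nw
  have dv' := h.dv
  have dw' := h.symm.dv
  have b1 := hc.hyp.deg v B
  have b2 := hc.hyp.deg w B
  have key : ∀ p1 p2 p3 q1 q2 q3 : ℕ, 1 ≤ p1 + q1 → 1 ≤ p2 + q2 → 1 ≤ p3 + q3 → p1 + p2 + p3 ≤ 2 → q1 + q2 + q3 ≤ 2 →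
    (p2 = 0 ∧ p3 = 0 ∧ q1 = 0 ∧ q2 = 1 ∧ q3 = 1) ∨ (p1 = 0 ∧ p3 = 0 ∧ q2 = 0 ∧ q1 = 1 ∧ q3 = 1) ∨
    (p1 = 0 ∧ p2 = 0 ∧ q3 = 0 ∧ q1 = 1 ∧ q2 = 1) ∨
    (q2 = 0 ∧ q3 = 0 ∧ p1 = 0 ∧ p2 = 1 ∧ p3 = 1) ∨ (q1 = 0 ∧ q3 = 0 ∧ p2 = 0 ∧ p1 = 1 ∧ p3 = 1) ∨
    (q1 = 0 ∧ q2 = 0 ∧ p3 = 0 ∧ p1 = 1 ∧ p2 = 1) ∨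
    (p1 = 1 ∧ p2 = 1 ∧ p3 = 0 ∧ q1 = 1 ∧ q2 = 0 ∧ q3 = 1) ∨ (p1 = 1 ∧ p3 = 1 ∧ p2 = 0 ∧ q1 = 1 ∧ q3 = 0 ∧ q2 = 1) ∨
    (p2 = 1 ∧ p1 = 1 ∧ p3 = 0 ∧ q2 = 1 ∧ q1 = 0 ∧ q3 = 1) ∨ (p2 = 1 ∧ p3 = 1 ∧ p1 = 0 ∧ q2 = 1 ∧ q3 = 0 ∧ q1 = 1) ∨
    (p3 = 1 ∧ p1 = 1 ∧ p2 = 0 ∧ q3 = 1 ∧ q1 = 0 ∧ q2 = 1) ∨ (p3 = 1 ∧ p2 = 1 ∧ p1 = 0 ∧ q3 = 1 ∧ q2 = 0 ∧ q1 = 1) := by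
    intro p1 p2 p3 q1 q2 q3 h1 h2 h3 h4 h5
    rcases (by omega : p1 = 0 ∨ p1 = 1 ∨ p1 = 2) with rfl | rfl | rfl <;>
    rcases (by omega : p2 = 0 ∨ p2 = 1 ∨ p2 = 2) with rfl | rfl | rfl <;>
    rcases (by omega : p3 = 0 ∨ p3 = 1 ∨ p3 = 2) with rfl | rfl | rfl <;> simp at h4 ⊢ <;> omega
  rcases key _ _ _ _ _ _ g1 g2 g3 (by omega) (by omega) with k | k | k | k | k | k | k | k | k | k | k | k
  · exact (tb.AC hc hB h k.1 k.2.1 k.2.2.1 k.2.2.2.1 k.2.2.2.2).elim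
  · exact (tb.p12.AC hc hB h k.1 k.2.1 k.2.2.1 k.2.2.2.1 k.2.2.2.2).elim
  · exact (tb.p23.p12.AC hc hB h k.1 k.2.1 k.2.2.1 k.2.2.2.1 k.2.2.2.2).elim
  · exact (tb.AC hc hB h.symm k.1 k.2.1 k.2.2.1 k.2.2.2.1 k.2.2.2.2).elim
  · exact (tb.p12.AC hc hB h.symm k.1 k.2.1 k.2.2.1 k.2.2.2.1 k.2.2.2.2).elim
  · exact (tb.p23.p12.AC hc hB h.symm k.1 k.2.1 k.2.2.1 k.2.2.2.1 k.2.2.2.2).elim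
  · exact tb.hex hc hB h k.1 k.2.1 k.2.2.1 k.2.2.2.1 k.2.2.2.2.1 k.2.2.2.2.2
  · exact tb.p23.hex hc hB h k.1 k.2.1 k.2.2.1 k.2.2.2.1 k.2.2.2.2.1 k.2.2.2.2.2
  · exact tb.p12.hex hc hB h k.1 k.2.1 k.2.2.1 k.2.2.2.1 k.2.2.2.2.1 k.2.2.2.2.2
  · exact tb.p12.p23.hex hc hB h k.1 k.2.1 k.2.2.1 k.2.2.2.1 k.2.2.2.2.1 k.2.2.2.2.2
  · exact tb.p23.p12.hex hc hB h k.1 k.2.1 k.2.2.1 k.2.2.2.1 k.2.2.2.2.1 k.2.2.2.2.2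
  · exact tb.p23.p12.p23.hex hc hB h k.1 k.2.1 k.2.2.1 k.2.2.2.1 k.2.2.2.2.1 k.2.2.2.2.2
end

lemma att2 (hc : Cub G) {B D : Finset V} (hB : Block G B) (hDB : D ⊆ B) (cD : Conn G D) (wD : ¬ W G D 0) {s p a w : V}
    (hs : s ∈ D) (hp : p ∈ D) (ha : a ∈ B) (haD : a ∉ D) (hw : w ∈ B) (hwD : w ∉ D) (haw : a ≠ w)
    (as : G.Adj a s) (aw : G.Adj w p) (ho : ∀ z ∈ D, ∀ y ∈ B, y ∉ D → G.Adj z y → z = s ∨ z = p)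
    (hD : ∀ c, D ≠ {c}) : s ≠ p ∧ W G (D \ {s, p}) (-1) := by
  have ne : ∀ C ⊆ D, C ≠ B := by rintro C hC rfl; exact haD (hC ha)
  have sp : s ≠ p := by
    rintro rfl
    have eD : D.erase s ⊆ D := Finset.erase_subset _ _
    have b1 := bd_amb (G := G) eD hDB
    have b2 : ee G (D.erase s) (B \ D) = 0 := by
      rw [ee_zero]; intro z hz y hy hh
      simp only [FM] at hz hy
      rcases ho z hz.2 y hy.1 hy.2 hh with e | e <;> exact hz.1 e
    rw [bd_erase s hs, b2] at b1
    have q := hc.hyp.deg s (insert w (insert a D))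
    rw [dg_insert _ _ (by simp [haw.symm, hwD]), dg_insert _ _ haD, if_pos as.symm, if_pos aw.symm] at q
    have := hB.br (D.erase s) (eD.trans hDB) (by
      rw [Finset.nonempty_iff_ne_empty]; intro h'
      rw [Finset.erase_eq_empty_iff] at h'
      rcases h' with h' | h'
      · rw [h'] at hs; simp at hs
      · exact hD s h') (ne _ eD)
    omega
  exact ⟨sp, lemA_use hc.hyp hDB cD (fun C hC => hc.PW (hB.sub hc (hC.trans hDB))) wD hs hp sp haD hwD as.symm aw.symm ho
    (fun C hC hne => hB.br C ((hC.trans Finset.sdiff_subset).trans hDB) hne (ne C (hC.trans Finset.sdiff_subset)))⟩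

lemma gadH {B E1 E2 E3 : Finset V} {a h v x w k b s1 s2 s3 ya : V}
    (mem : ∀ z, z ∈ B ↔ z = a ∨ z = h ∨ z = v ∨ z = x ∨ z = w ∨ z = k ∨ z = b ∨ z ∈ E1 ∨ z ∈ E2 ∨ z ∈ E3)
    (nd : (a ≠ h ∧ a ≠ v ∧ a ≠ x ∧ a ≠ w ∧ a ≠ k) ∧ (h ≠ v ∧ h ≠ x ∧ h ≠ w ∧ h ≠ k) ∧ (v ≠ x ∧ v ≠ w ∧ v ≠ k) ∧
      (x ≠ w ∧ x ≠ k) ∧ w ≠ k)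
    (nb : b ≠ a ∧ b ≠ h ∧ b ≠ v ∧ b ≠ w ∧ b ≠ k)
    (n1 : a ∉ E1 ∧ h ∉ E1 ∧ v ∉ E1 ∧ w ∉ E1 ∧ k ∉ E1 ∧ b ∉ E1)
    (n2 : a ∉ E2 ∧ h ∉ E2 ∧ v ∉ E2 ∧ w ∉ E2 ∧ k ∉ E2 ∧ b ∉ E2)
    (n3 : a ∉ E3 ∧ h ∉ E3 ∧ v ∉ E3 ∧ w ∉ E3 ∧ k ∉ E3 ∧ b ∉ E3)
    (d12 : ∀ z ∈ E1, z ∉ E2) (d13 : ∀ z ∈ E1, z ∉ E3) (d23 : ∀ z ∈ E2, z ∉ E3)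
    (x12 : ∀ x ∈ E1, ∀ y ∈ E2, ¬ G.Adj x y) (x13 : ∀ x ∈ E1, ∀ y ∈ E3, ¬ G.Adj x y)
    (x23 : ∀ x ∈ E2, ∀ y ∈ E3, ¬ G.Adj x y)
    (m1 : s1 ∈ E1) (m2 : s2 ∈ E2) (m3 : s3 ∈ E3) (my : ya ∈ E1) (ny : s1 ≠ ya)
    (bs : G.Adj b s1) (ay : G.Adj a ya) (hv : G.Adj h v) (kw : G.Adj k w)
    (u1 : ∀ z ∈ E1, G.Adj b z → z = s1) (u2 : ∀ z ∈ E2, G.Adj b z → z = s2) (u3 : ∀ z ∈ E3, G.Adj b z → z = s3)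
    (ua : ∀ z ∈ E1, G.Adj a z → z = ya) (nab : ¬ G.Adj a b) (nbv : ¬ G.Adj b v) (nbw : ¬ G.Adj b w)
    (uh : ∀ z ∈ B, G.Adj h z → z = a ∨ z = v) (uk : ∀ z ∈ B, G.Adj k z → z = w ∨ z = a)
    (nv1 : ∀ z ∈ E1, ¬ G.Adj v z) (nw1 : ∀ z ∈ E1, ¬ G.Adj w z)
    (I1 : W G (E1 \ {s1, ya}) (-1)) (I2 : W G (E2.erase s2) 0) (I3 : W G (E3.erase s3) 0) : W G B (-2) := by
  have J := I1.leaf (u := b) (v := s1) (by clear * - n1; grind) (by clear * - m1; grind) bs (by clear * - u1; grind)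
  have J := J.leaf (u := a) (v := ya) (by clear * - n1 nb m1; grind) (by clear * - n1 my ny; grind) ay (by
    clear * - ua nab ny m1; grind)
  have P := I2.union0 I3 (by rw [Finset.disjoint_left]; clear * - d23; grind) (by clear * - x23; grind)
  have hB : ∀ z, z = a ∨ z = h ∨ z = v ∨ z = x ∨ z = w ∨ z = k ∨ z = b ∨ z ∈ E1 ∨ z ∈ E2 ∨ z ∈ E3 → z ∈ B := fun z => (mem z).2
  have h1 : ∀ z ∈ E1, ¬ G.Adj z h := fun z hz hh => by
    rcases uh z (hB z (by simp [hz])) hh.symm with rfl | rfl <;> tauto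
  have h2 : ∀ z ∈ E2, ¬ G.Adj h z := fun z hz hh => by
    rcases uh z (hB z (by simp [hz])) hh with rfl | rfl <;> tauto
  have h3 : ∀ z ∈ E3, ¬ G.Adj h z := fun z hz hh => by
    rcases uh z (hB z (by simp [hz])) hh with rfl | rfl <;> tauto
  have k1 : ∀ z ∈ E1, ¬ G.Adj z k := fun z hz hh => by
    rcases uk z (hB z (by simp [hz])) hh.symm with rfl | rfl <;> tauto
  have k2 : ∀ z ∈ E2, ¬ G.Adj k z := fun z hz hh => by
    rcases uk z (hB z (by simp [hz])) hh with rfl | rfl <;> tauto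
  have k3 : ∀ z ∈ E3, ¬ G.Adj k z := fun z hz hh => by
    rcases uk z (hB z (by simp [hz])) hh with rfl | rfl <;> tauto
  have bh : ¬ G.Adj b h := fun hh => by
    rcases uh b (hB b (by simp)) hh.symm with e | e <;> tauto
  have bk : ¬ G.Adj b k := fun hh => by
    rcases uk b (hB b (by simp)) hh.symm with e | e <;> tauto
  have kh : ¬ G.Adj k h := fun hh => by
    rcases uk h (hB h (by simp)) hh with e | e
    · exact nd.2.1.2.2.1 e
    · exact nd.1.1 e.symm
  have kv : ¬ G.Adj k v := fun hh => by
    rcases uk v (hB v (by simp)) hh with e | e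
    · exact nd.2.2.1.2.1 e
    · exact nd.1.2.1 e.symm
  have P := P.leaf (u := h) (v := v) (by clear * - n2 n3; grind) (by clear * - n2 n3; grind) hv (by clear * - h2 h3; grind)
  have P := P.leaf (u := k) (v := w) (by clear * - n2 n3 nd; grind) (by clear * - n2 n3 nd; grind) kw (by
    clear * - k2 k3 kh kv; grind)
  have v1' : ∀ z ∈ E1, ¬ G.Adj z v := fun z hz hh => nv1 z hz hh.symm
  have w1' : ∀ z ∈ E1, ¬ G.Adj z w := fun z hz hh => nw1 z hz hh.symm
  have K := J.union P (by
    rw [Finset.disjoint_left]; intro z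
    simp only [FM]
    clear * - n1 n2 n3 nd nb d12 d13 my m1
    grind) a (by
    intro z hz y hy
    simp only [FM] at hz hy
    clear * - u2 u3 nbv nbw bh bk h1 k1 v1' w1' x12 x13 my m1 hz hy
    grind)
  refine (((K.ins s2).ins s3).ins x).to (by norm_num) ?_
  ext z; rw [mem]
  simp only [FM]
  clear * - m1 m2 m3 my; grind

section
variable {B D : Finset V} {a h v x w k ya yv yw : V} {E1 E2 E3 : Finset V} {b s1 s2 s3 : V}

lemma Hex.out (H : Hex G B D a h v x w k ya yv yw) : ∀ z ∈ D, ∀ y ∈ B, y ∉ D → G.Adj z y →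
    (y = a ∧ z = ya) ∨ (y = v ∧ z = yv) ∨ (y = w ∧ z = yw) := by
  intro z hz y hy hyD hh
  have hzB := H.DB hz
  rcases (H.mem y).1 hy with rfl | rfl | rfl | rfl | rfl | rfl | hy
  · exact Or.inl ⟨rfl, H.ua z hz hh.symm⟩
  · rcases H.uh z hzB hh.symm with rfl | rfl
    exacts [absurd hz H.nD.1.1, absurd hz H.nD.1.2.1]
  · exact Or.inr (Or.inl ⟨rfl, H.uv z hz hh.symm⟩)
  · rcases H.ux z hzB hh.symm with rfl | rfl
    exacts [absurd hz H.nD.1.2.1, absurd hz H.nD.1.2.2]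
  · exact Or.inr (Or.inr ⟨rfl, H.uw z hz hh.symm⟩)
  · rcases H.uk z hzB hh.symm with rfl | rfl
    exacts [absurd hz H.nD.1.2.2, absurd hz H.nD.1.1]
  · exact absurd hy hyD

lemma Hex.one (hc : Cub G) (hB : Block G B) (H : Hex G B D a h v x w k ya yv yw)
    (tb : TBr G D E1 E2 E3 b s1 s2 s3) (h1 : ya ∈ E1) (h2 : yv ∈ E2) (h3 : yw ∈ E3) : E1 = {ya} := by
  by_contra hne
  have hE : ∀ c, E1 ≠ {c} := by
    rintro c rfl; rw [Finset.mem_singleton] at h1; exact hne (by rw [h1])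
  have hT : D ≠ Finset.univ := hB.sub hc H.DB
  have aB : a ∈ B := (H.mem a).2 (by tauto)
  have nn : ∀ {z}, z ∉ D → z ∉ E1 ∧ z ∉ E2 ∧ z ∉ E3 := fun hz =>
    ⟨fun h' => hz (tb.t1 h'), fun h' => hz (tb.t2 h'), fun h' => hz (tb.t3 h')⟩
  have ne : ∀ {z}, z ∉ D → b ≠ z := fun hz e => hz (e ▸ tb.t0)
  have ho := H.out
  obtain ⟨sy, I⟩ := att2 hc hB (tb.t1.trans H.DB) tb.c1 tb.w1 tb.m1 h1 (H.DB tb.t0) tb.na.1 aB (nn H.nD.1.1).1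
    (ne H.nD.1.1) tb.a1 H.ta (by
      intro z hz y hy hyE hh
      by_cases hyD : y ∈ D
      · rcases (tb.mem y).1 hyD with rfl | h' | h' | h'
        · exact Or.inl (tb.u1 z hz hh.symm)
        · exact absurd h' hyE
        · exact absurd hh (tb.n12 _ hz _ h')
        · exact absurd hh (tb.n13 _ hz _ h')
      · rcases ho z (tb.t1 hz) y hy hyD hh with ⟨-, e⟩ | ⟨-, e⟩ | ⟨-, e⟩
        · exact Or.inr e
        · exact absurd h2 (tb.d12 _ (e ▸ hz))
        · exact absurd h3 (tb.d13 _ (e ▸ hz))) hE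
  obtain ⟨a1, a2, a3⟩ := nn H.nD.1.1
  obtain ⟨v1, v2, v3⟩ := nn H.nD.1.2.1
  obtain ⟨w1, w2, w3⟩ := nn H.nD.1.2.2
  obtain ⟨h1', h2', h3'⟩ := nn H.nD.2.1
  obtain ⟨k1, k2, k3⟩ := nn H.nD.2.2.2
  refine hB.w ((gadH (x := x) (fun z => ?_) H.nd ⟨ne H.nD.1.1, ne H.nD.2.1, ne H.nD.1.2.1, ne H.nD.1.2.2, ne H.nD.2.2.2⟩
    ⟨a1, h1', v1, w1, k1, tb.na.1⟩ ⟨a2, h2', v2, w2, k2, tb.na.2.1⟩ ⟨a3, h3', v3, w3, k3, tb.na.2.2⟩ tb.d12 tb.d13 tb.d23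
    tb.n12 tb.n13 tb.n23 tb.m1 tb.m2 tb.m3 h1 sy tb.a1 H.ta H.hv H.wk.symm tb.u1 tb.u2 tb.u3
    (fun z hz => H.ua z (tb.t1 hz)) (fun hh => tb.na' hc H.nD.1.1 hh.symm) (tb.na' hc H.nD.1.2.1) (tb.na' hc H.nD.1.2.2)
    H.uh H.uk (fun z hz hh => ?_) (fun z hz hh => ?_)
    I (tb.p12.er hc hT) (tb.p23.p12.er hc hT)).le (by norm_num))
  · rw [H.mem, tb.mem]
  · have e := H.uv z (tb.t1 hz) hh; subst e; exact tb.d12 _ hz h2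
  · have e := H.uw z (tb.t1 hz) hh; subst e; exact tb.d13 _ hz h3

variable (G) in
structure SK (B : Finset V) (g0 g1 g2 g3 b01 b02 b03 b12 b13 b23 : V) : Prop where
  mem : ∀ z, z ∈ B ↔ z = g0 ∨ z = g1 ∨ z = g2 ∨ z = g3 ∨ z = b01 ∨ z = b02 ∨ z = b03 ∨ z = b12 ∨ z = b13 ∨ z = b23
  nd : [g0, g1, g2, g3, b01, b02, b03, b12, b13, b23].Nodup
  e01 : G.Adj b01 g0 ∧ G.Adj b01 g1
  e02 : G.Adj b02 g0 ∧ G.Adj b02 g2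
  e03 : G.Adj b03 g0 ∧ G.Adj b03 g3
  e12 : G.Adj b12 g1 ∧ G.Adj b12 g2
  e13 : G.Adj b13 g1 ∧ G.Adj b13 g3
  e23 : G.Adj b23 g2 ∧ G.Adj b23 g3
  u01 : ∀ z ∈ B, G.Adj b01 z → z = g0 ∨ z = g1
  u02 : ∀ z ∈ B, G.Adj b02 z → z = g0 ∨ z = g2
  u03 : ∀ z ∈ B, G.Adj b03 z → z = g0 ∨ z = g3
  u12 : ∀ z ∈ B, G.Adj b12 z → z = g1 ∨ z = g2
  u13 : ∀ z ∈ B, G.Adj b13 z → z = g1 ∨ z = g3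
  u23 : ∀ z ∈ B, G.Adj b23 z → z = g2 ∨ z = g3

lemma Hex.sk (hc : Cub G) (hB : Block G B) (H : Hex G B D a h v x w k ya yv yw)
    (tb : TBr G D E1 E2 E3 b s1 s2 s3) (h1 : ya ∈ E1) (h2 : yv ∈ E2) (h3 : yw ∈ E3) :
    SK G B a v w b h k ya x yv yw := by
  have f1 := H.one hc hB tb h1 h2 h3
  have f2 := H.rot.one hc hB tb.p12.p23 h2 h3 h1
  have f3 := H.rot.rot.one hc hB tb.p12.p23.p12.p23 h3 h1 h2
  have m1 := tb.m1
  have m2 := tb.m2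
  have m3 := tb.m3
  have a1 := tb.a1
  have a2 := tb.a2
  have a3 := tb.a3
  rw [f1, Finset.mem_singleton] at m1
  rw [f2, Finset.mem_singleton] at m2
  rw [f3, Finset.mem_singleton] at m3
  rw [m1] at a1
  rw [m2] at a2
  rw [m3] at a3
  have mD : ∀ z, z ∈ D ↔ z = b ∨ z = ya ∨ z = yv ∨ z = yw := by
    intro z; rw [tb.mem, f1, f2, f3]; simp only [Finset.mem_singleton]
  have q12 := tb.n12 _ h1 _ h2
  have q13 := tb.n13 _ h1 _ h3
  have q23 := tb.n23 _ h2 _ h3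
  have ho := H.out
  have ya_b : b ≠ ya := fun e => tb.na.1 (e ▸ h1)
  have yv_b : b ≠ yv := fun e => tb.na.2.1 (e ▸ h2)
  have yw_b : b ≠ yw := fun e => tb.na.2.2 (e ▸ h3)
  have i1 := H.DB H.ma
  obtain ⟨mem, nd, nD, ah, hv, vx, xw, wk, ka, ma, mv, mw, ta, tv, tw, ua, uv, uw, uh, ux, uk, ny, nn, c, t⟩ := H
  refine ⟨?_, ?_, ⟨ah.symm, hv⟩, ⟨ka, wk.symm⟩, ⟨ta.symm, a1.symm⟩, ⟨vx.symm, xw⟩, ⟨tv.symm, a2.symm⟩, ⟨tw.symm, a3.symm⟩,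
    uh, fun z hz hh => (uk z hz hh).symm, ?_, ux, ?_, ?_⟩
  · intro z; rw [mem, mD]; clear * -; tauto
  · simp only [mD] at nD
    simp only [List.nodup_cons, List.mem_cons, List.not_mem_nil, or_false, List.nodup_nil, not_false_eq_true, and_true]
    clear * - nd nD ny ya_b yv_b yw_b
    grind
  · intro z hz hh
    by_cases hzD : z ∈ D
    · rcases (mD z).1 hzD with rfl | rfl | rfl | rfl
      exacts [Or.inr rfl, absurd hh G.irrefl, absurd hh q12, absurd hh q13]
    · rcases ho _ ma z hz hzD hh with e | e | e
      exacts [Or.inl e.1, absurd e.2 ny.1, absurd e.2 ny.2.1]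
  · intro z hz hh
    by_cases hzD : z ∈ D
    · rcases (mD z).1 hzD with rfl | rfl | rfl | rfl
      exacts [Or.inr rfl, absurd hh.symm q12, absurd hh G.irrefl, absurd hh q23]
    · rcases ho _ mv z hz hzD hh with e | e | e
      exacts [absurd e.2.symm ny.1, Or.inl e.1, absurd e.2 ny.2.2]
  · intro z hz hh
    by_cases hzD : z ∈ D
    · rcases (mD z).1 hzD with rfl | rfl | rfl | rfl
      exacts [Or.inr rfl, absurd hh.symm q13, absurd hh.symm q23, absurd hh G.irrefl]
    · rcases ho _ mw z hz hzD hh with e | e | e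
      exacts [absurd e.2.symm ny.2.1, absurd e.2.symm ny.2.2, Or.inl e.1]

lemma Hex.att (hB : Block G B) (H : Hex G B D a h v x w k ya yv yw)
    (tb : TBr G D E1 E2 E3 b s1 s2 s3) : ya ∈ E1 ∨ yv ∈ E1 ∨ yw ∈ E1 := by
  have b1 := tb.bd1
  have h1 := hB.br E1 (tb.t1.trans H.DB) tb.c1.1 (by
    rintro rfl; exact H.nD.1.1 (tb.t1 ((H.mem a).2 (by tauto))))
  rw [bd_amb tb.t1 H.DB] at h1
  obtain ⟨z, hz, y, hy, hh⟩ := ee_pos.1 (by omega : 0 < ee G E1 (B \ D))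
  rw [Finset.mem_sdiff] at hy
  rcases H.out z (tb.t1 hz) y hy.1 hy.2 hh with e | e | e
  exacts [Or.inl (e.2 ▸ hz), Or.inr (Or.inl (e.2 ▸ hz)), Or.inr (Or.inr (e.2 ▸ hz))]

lemma Hex.exsk (hc : Cub G) (hB : Block G B) (H : Hex G B D a h v x w k ya yv yw)
    (tb : TBr G D E1 E2 E3 b s1 s2 s3) : ∃ g0 g1 g2 g3 b01 b02 b03 b12 b13 b23, SK G B g0 g1 g2 g3 b01 b02 b03 b12 b13 b23 := by
  have t1 := H.att hB tb
  have t2 := H.att hB tb.p12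
  have t3 := H.att hB tb.p23.p12
  have x12 := tb.d12
  have x13 := tb.d13
  have x23 := tb.d23
  have key : (ya ∈ E1 ∧ yv ∈ E2 ∧ yw ∈ E3) ∨ (ya ∈ E1 ∧ yv ∈ E3 ∧ yw ∈ E2) ∨ (ya ∈ E2 ∧ yv ∈ E1 ∧ yw ∈ E3) ∨
     (ya ∈ E2 ∧ yv ∈ E3 ∧ yw ∈ E1) ∨ (ya ∈ E3 ∧ yv ∈ E1 ∧ yw ∈ E2) ∨ (ya ∈ E3 ∧ yv ∈ E2 ∧ yw ∈ E1) := by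
    clear * - t1 t2 t3 x12 x13 x23
    grind
  rcases key with ⟨k1, k2, k3⟩ | ⟨k1, k2, k3⟩ | ⟨k1, k2, k3⟩ | ⟨k1, k2, k3⟩ | ⟨k1, k2, k3⟩ | ⟨k1, k2, k3⟩
  · exact ⟨_, _, _, _, _, _, _, _, _, _, H.sk hc hB tb k1 k2 k3⟩
  · exact ⟨_, _, _, _, _, _, _, _, _, _, H.sk hc hB tb.p23 k1 k2 k3⟩
  · exact ⟨_, _, _, _, _, _, _, _, _, _, H.sk hc hB tb.p12 k1 k2 k3⟩
  · exact ⟨_, _, _, _, _, _, _, _, _, _, H.sk hc hB tb.p12.p23 k1 k2 k3⟩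
  · exact ⟨_, _, _, _, _, _, _, _, _, _, H.sk hc hB tb.p23.p12 k1 k2 k3⟩
  · exact ⟨_, _, _, _, _, _, _, _, _, _, H.sk hc hB tb.p23.p12.p23 k1 k2 k3⟩

lemma SK.bd {g0 g1 g2 g3 b01 b02 b03 b12 b13 b23 : V} (hc : Cub G) (S : SK G B g0 g1 g2 g3 b01 b02 b03 b12 b13 b23) :
    bd G Finset.univ B ≤ 6 := by
  have hb : ∀ {p g g' : V}, g ≠ g' → G.Adj p g ∧ G.Adj p g' → g ∈ B → g' ∈ B → URPaper.dg G p (Finset.univ \ B) ≤ 1 := by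
    intro p g g' hn he m m'
    have := dg_sdiff (G := G) p (Finset.subset_univ B)
    have h2 := dg_mono (G := G) p (D := {g, g'}) (E := B) (by
      intro z; simp only [FM]; rintro (rfl | rfl) <;> assumption)
    rw [dg_insert _ _ (by simp [hn]), dg_single, if_pos he.1, if_pos he.2] at h2
    rw [hc.cub] at this; omega
  have hg : ∀ {g p q r : V}, p ≠ q → p ≠ r → q ≠ r → G.Adj p g → G.Adj q g → G.Adj r g → p ∈ B → q ∈ B → r ∈ B →
      URPaper.dg G g (Finset.univ \ B) = 0 := by
    intro g p q r n1 n2 n3 a1 a2 a3 m1 m2 m3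
    have := dg_sdiff (G := G) g (Finset.subset_univ B)
    have h2 := dg_mono (G := G) g (D := {p, q, r}) (E := B) (by
      intro z; simp only [FM]; rintro (rfl | rfl | rfl) <;> assumption)
    rw [dg_insert _ _ (by simp [n1, n2]), dg_insert _ _ (by simp [n3]), dg_single, if_pos a1.symm, if_pos a2.symm,
      if_pos a3.symm] at h2
    rw [hc.cub] at this; omega
  obtain ⟨mem, nd, e01, e02, e03, e12, e13, e23, -, -, -, -, -, -⟩ := S
  have e : B = insert g0 (insert g1 (insert g2 (insert g3 (insert b01 (insert b02 (insert b03 (insert b12 (insert b13 {b23})))))))) := by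
    ext z; rw [mem]; simp only [FM]
  simp only [NL, or_false, not_false_eq_true, and_true, not_or] at nd
  obtain ⟨⟨a1, a2, a3, a4, a5, a6, a7, a8, a9⟩, ⟨c2, c3, c4, c5, c6, c7, c8, c9⟩, ⟨d3, d4, d5, d6, d7, d8, d9⟩,
    ⟨f4, f5, f6, f7, f8, f9⟩, ⟨i5, i6, i7, i8, i9⟩, ⟨j6, j7, j8, j9⟩, ⟨k7, k8, k9⟩, ⟨l8, l9⟩, o9⟩ := nd
  have M0 : g0 ∈ B := (mem _).2 (by simp)
  have M1 : g1 ∈ B := (mem _).2 (by simp)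
  have M2 : g2 ∈ B := (mem _).2 (by simp)
  have M3 : g3 ∈ B := (mem _).2 (by simp)
  have M01 : b01 ∈ B := (mem _).2 (by simp)
  have M02 : b02 ∈ B := (mem _).2 (by simp)
  have M03 : b03 ∈ B := (mem _).2 (by simp)
  have M12 : b12 ∈ B := (mem _).2 (by simp)
  have M13 : b13 ∈ B := (mem _).2 (by simp)
  have M23 : b23 ∈ B := (mem _).2 (by simp)
  have z0 := hg i5 i6 j6 e01.1 e02.1 e03.1 M01 M02 M03
  have z1 := hg i7 i8 l8 e01.2 e12.1 e13.1 M01 M12 M13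
  have z2 := hg j7 j9 l9 e02.2 e12.2 e23.1 M02 M12 M23
  have z3 := hg k8 k9 o9 e03.2 e13.2 e23.2 M03 M13 M23
  have y1 := hb a1 e01 M0 M1
  have y2 := hb a2 e02 M0 M2
  have y3 := hb a3 e03 M0 M3
  have y4 := hb c2 e12 M1 M2
  have y5 := hb c3 e13 M1 M3
  have y6 := hb d3 e23 M2 M3
  unfold URPaper.bd
  obtain ⟨R, hR⟩ : ∃ R, R = Finset.univ \ B := ⟨_, rfl⟩
  rw [← hR] at z0 z1 z2 z3 y1 y2 y3 y4 y5 y6 ⊢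
  clear hR
  rw [e, ee_insert_left _ (by simp [*]), ee_insert_left _ (by simp [*]), ee_insert_left _ (by simp [*]), ee_insert_left _ (by simp [*]),
    ee_insert_left _ (by simp [*]), ee_insert_left _ (by simp [*]), ee_insert_left _ (by simp [*]), ee_insert_left _ (by simp [*]),
    ee_insert_left _ (by simp [*]), ee_single_left]
  omega
end

lemma class5 (hc : Cub G) {B : Finset V} (hB : Block G B) :
    (∃ T, T.card < B.card ∧ Block G T ∧ bd G Finset.univ B < bd G Finset.univ T) ∨
    (∃ D a h v x w k ya yv yw, Hex G B D a h v x w k ya yv yw ∧ Block G D) ∨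
    (∃ g0 g1 g2 g3 b01 b02 b03 b12 b13 b23, SK G B g0 g1 g2 g3 b01 b02 b03 b12 b13 b23) := by
  obtain ⟨T, x, v, w, h⟩ := hB.exBx hc
  by_cases hbr : ∀ C ⊆ T, C.Nonempty → C ≠ T → 2 ≤ bd G T C
  · refine Or.inl ⟨T, Finset.card_lt_card ⟨h.TB, fun hh => h.nx (hh ((h.mem x).2 (by tauto)))⟩, h.K0 hc hB hbr⟩
  right
  push Not at hbr
  obtain ⟨C, hC, hne, hCT, hb⟩ := hbr
  have cT := h.conn hc hB
  have := cT.2 C hC hne hCT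
  obtain ⟨D1, D2, D3, a, s1, s2, s3, tb⟩ := TB hc.hyp cT (fun C hC => hc.PW (hB.sub hc (hC.trans h.TB))) (h.wT hB) hC (by omega)
  obtain ⟨D, a, h, v, x, w, k, ya, yv, yw, H⟩ := tb.exhex hc hB h
  by_cases hbr : ∀ C ⊆ D, C.Nonempty → C ≠ D → 2 ≤ bd G D C
  · exact Or.inl ⟨D, a, h, v, x, w, k, ya, yv, yw, H, H.block hc hB hbr⟩
  right
  push Not at hbr
  obtain ⟨C, hC, hne, hCT, hb⟩ := hbr
  have := H.c.2 C hC hne hCT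
  obtain ⟨D1, D2, D3, a, s1, s2, s3, tb⟩ := TB hc.hyp H.c (fun C hC => hc.PW (hB.sub hc (hC.trans H.DB))) H.t hC (by omega)
  exact H.exsk hc hB tb

lemma Block.bd6 (hc : Cub G) {B : Finset V} (hB : Block G B) : bd G Finset.univ B ≤ 6 := by
  induction hn : B.card using Nat.strong_induction_on generalizing B with
  | _ n ih =>
    subst hn
    rcases class5 hc hB with ⟨T, h1, h2, h3⟩ | ⟨D, a, h, v, x, w, k, ya, yv, yw, H, hD⟩ | ⟨g0, g1, g2, g3, b01, b02, b03, b12, b13, b23, S⟩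
    · have := ih _ h1 h2 rfl; omega
    · rw [H.bd hc]; exact ih _ H.lt hD rfl
    · exact S.bd hc

lemma Block.cls (hc : Cub G) {B : Finset V} (hB : Block G B) (h6 : bd G Finset.univ B = 6) :
    (∃ D a h v x w k ya yv yw, Hex G B D a h v x w k ya yv yw ∧ Block G D ∧ bd G Finset.univ D = 6) ∨
    (∃ g0 g1 g2 g3 b01 b02 b03 b12 b13 b23, SK G B g0 g1 g2 g3 b01 b02 b03 b12 b13 b23) := by
  rcases class5 hc hB with ⟨T, h1, h2, h3⟩ | ⟨D, a, h, v, x, w, k, ya, yv, yw, H, hD⟩ | S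
  · have := h2.bd6 hc; omega
  · exact Or.inl ⟨D, a, h, v, x, w, k, ya, yv, yw, H, hD, by rw [← H.bd hc, h6]⟩
  · exact Or.inr S

lemma iso_of (hyp : Hyp G) {n : ℕ} (E : Set (Sym2 (Fin n))) (el : List (Fin n × Fin n))
    (h1 : ∀ p ∈ el, s(p.1, p.2) ∈ E) (h2 : ∀ e ∈ E, ∃ p ∈ el, e = s(p.1, p.2)) (hne : ∀ p ∈ el, p.1 ≠ p.2)
    (hdeg : ∀ i, 3 ≤ (Finset.univ.filter (fun j => (i, j) ∈ el ∨ (j, i) ∈ el)).card)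
    (F : Fin n → V) (hF : Function.Injective F) (hcard : Fintype.card V = n)
    (hA : ∀ p ∈ el, G.Adj (F p.1) (F p.2)) : Nonempty (G ≃g SimpleGraph.fromEdgeSet E) := by
  have hb : Function.Bijective F := (Fintype.bijective_iff_injective_and_card F).2 ⟨hF, by simp [hcard]⟩
  have hadj : ∀ i j, (SimpleGraph.fromEdgeSet E).Adj i j ↔ (i, j) ∈ el ∨ (j, i) ∈ el := by
    intro i j
    rw [SimpleGraph.fromEdgeSet_adj]
    constructor
    · rintro ⟨h, -⟩
      obtain ⟨p, hp, e⟩ := h2 _ h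
      rw [Sym2.eq_iff] at e
      rcases e with ⟨rfl, rfl⟩ | ⟨rfl, rfl⟩
      · exact Or.inl hp
      · exact Or.inr hp
    · rintro (h | h)
      · exact ⟨h1 _ h, hne _ h⟩
      · exact ⟨by rw [Sym2.eq_swap]; exact h1 _ h, (hne _ h).symm⟩
  have hto : ∀ i j, ((i, j) ∈ el ∨ (j, i) ∈ el) → G.Adj (F i) (F j) := by
    rintro i j (h | h)
    · exact hA _ h
    · exact (hA _ h).symm
  refine ⟨(RelIso.mk (Equiv.ofBijective F hb) ?_ : SimpleGraph.fromEdgeSet E ≃g G).symm⟩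
  intro i j
  rw [hadj]
  constructor
  · intro h
    have h : G.Adj (F i) (F j) := h
    by_contra hn
    have hd := hyp.deg (F i) (insert (F j) ((Finset.univ.filter (fun j => (i, j) ∈ el ∨ (j, i) ∈ el)).image F))
    have hi : F j ∉ (Finset.univ.filter (fun j => (i, j) ∈ el ∨ (j, i) ∈ el)).image F := by
      intro h'
      rw [Finset.mem_image] at h'
      obtain ⟨l, hl, e⟩ := h'
      rw [hF e, Finset.mem_filter] at hl
      exact hn hl.2
    rw [dg_insert _ _ hi, if_pos h] at hd
    unfold dg at hd
    rw [Finset.filter_true_of_mem, Finset.card_image_of_injective _ hF] at hd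
    · have := hdeg i; omega
    · intro z hz
      rw [Finset.mem_image] at hz
      obtain ⟨l, hl, rfl⟩ := hz
      exact hto i l (Finset.mem_filter.1 hl).2
  · exact hto i j

lemma third (hc : Cub G) {B : Finset V} {p g g' : V} (hn : g ≠ g') (he : G.Adj p g ∧ G.Adj p g')
    (hu : ∀ z ∈ B, G.Adj p z → z = g ∨ z = g') (m : g ∈ B) (m' : g' ∈ B) :
    ∃ y, y ∉ B ∧ G.Adj p y ∧ ∀ z, G.Adj p z → z = g ∨ z = g' ∨ z = y := by
  obtain ⟨a, -, b, -, c, -, n1, n2, n3, a1, a2, a3, h⟩ := dg_three (hc.cub p)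
  have k1 := h g (by simp) he.1
  have k2 := h g' (by simp) he.2
  have h' : ∀ z, G.Adj p z → z = a ∨ z = b ∨ z = c := fun z => h z (by simp)
  by_cases ha : a ≠ g ∧ a ≠ g'
  · exact ⟨a, fun hh => by have := hu a hh a1; tauto, a1, fun z hz => by have := h' z hz; clear * - this k1 k2 hn ha; grind⟩
  by_cases hb : b ≠ g ∧ b ≠ g'
  · exact ⟨b, fun hh => by have := hu b hh a2; tauto, a2, fun z hz => by have := h' z hz; clear * - this k1 k2 hn hb; grind⟩
  have hcc : c ≠ g ∧ c ≠ g' := by clear * - ha hb n1 n2 n3; grind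
  exact ⟨c, fun hh => by have := hu c hh a3; tauto, a3, fun z hz => by have := h' z hz; clear * - this k1 k2 hn hcc; grind⟩

section
variable {B : Finset V} {g0 g1 g2 g3 b01 b02 b03 b12 b13 b23 : V}

lemma SK.w01 (S : SK G B g0 g1 g2 g3 b01 b02 b03 b12 b13 b23) : SK G B g1 g0 g2 g3 b01 b12 b13 b02 b03 b23 := by
  obtain ⟨mem, nd, e01, e02, e03, e12, e13, e23, u01, u02, u03, u12, u13, u23⟩ := S
  refine ⟨fun z => ?_, ?_, e01.symm, e12, e13, e02, e03, e23, fun z hz hh => (u01 z hz hh).symm, u12, u13, u02, u03, u23⟩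
  · rw [mem]; clear * -; tauto
  · clear * - nd
    simp only [NL, or_false, not_false_eq_true, and_true, not_or] at nd ⊢
    grind

lemma SK.w12 (S : SK G B g0 g1 g2 g3 b01 b02 b03 b12 b13 b23) : SK G B g0 g2 g1 g3 b02 b01 b03 b12 b23 b13 := by
  obtain ⟨mem, nd, e01, e02, e03, e12, e13, e23, u01, u02, u03, u12, u13, u23⟩ := S
  refine ⟨fun z => ?_, ?_, e02, e01, e03, e12.symm, e23, e13, u02, u01, u03, fun z hz hh => (u12 z hz hh).symm, u23, u13⟩
  · rw [mem]; clear * -; tauto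
  · clear * - nd
    simp only [NL, or_false, not_false_eq_true, and_true, not_or] at nd ⊢
    grind

lemma SK.w23 (S : SK G B g0 g1 g2 g3 b01 b02 b03 b12 b13 b23) : SK G B g0 g1 g3 g2 b01 b03 b02 b13 b12 b23 := by
  obtain ⟨mem, nd, e01, e02, e03, e12, e13, e23, u01, u02, u03, u12, u13, u23⟩ := S
  refine ⟨fun z => ?_, ?_, e01, e03, e02, e13, e12, e23.symm, u01, u03, u02, u13, u12, fun z hz hh => (u23 z hz hh).symm⟩
  · rw [mem]; clear * -; tauto
  · clear * - nd
    simp only [NL, or_false, not_false_eq_true, and_true, not_or] at nd ⊢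
    grind

lemma SK.crd (S : SK G B g0 g1 g2 g3 b01 b02 b03 b12 b13 b23) : B.card = 10 := by
  have e : B = [g0, g1, g2, g3, b01, b02, b03, b12, b13, b23].toFinset := by
    ext z; rw [S.mem]; simp
  rw [e, List.toFinset_card_of_nodup S.nd]; rfl

lemma SK.m0 (S : SK G B g0 g1 g2 g3 b01 b02 b03 b12 b13 b23) : (g0 ∈ B ∧ g1 ∈ B ∧ g2 ∈ B ∧ g3 ∈ B) ∧
    b01 ∈ B ∧ b02 ∈ B ∧ b03 ∈ B ∧ b12 ∈ B ∧ b13 ∈ B ∧ b23 ∈ B := by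
  simp only [S.mem]; simp

lemma SK.g01 (S : SK G B g0 g1 g2 g3 b01 b02 b03 b12 b13 b23) : g0 ≠ g1 := by
  have := S.nd; rintro rfl; simp at this

lemma SK.bb (S : SK G B g0 g1 g2 g3 b01 b02 b03 b12 b13 b23) : b01 ≠ b02 := by
  have := S.nd; rintro rfl; simp at this

/-- third neighbours -/
lemma SK.third (hc : Cub G) (S : SK G B g0 g1 g2 g3 b01 b02 b03 b12 b13 b23) :
    ∃ y, y ∉ B ∧ G.Adj b01 y ∧ ∀ z, G.Adj b01 z → z = g0 ∨ z = g1 ∨ z = y :=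
  URPaper.third hc S.g01 S.e01 S.u01 S.m0.1.1 S.m0.1.2.1

lemma SK.c4 (hc : Cub G) (S : SK G B g0 g1 g2 g3 b01 b02 b03 b12 b13 b23) {y y' : V} (hy : y ∉ B)
    (h1 : G.Adj b01 y) (h2 : G.Adj b02 y') : y ≠ y' := by
  rintro rfl
  exact hc.hyp.c4 b01 b02 g0 y S.bb (fun e => hy (e ▸ S.m0.1.1)) S.e01.1 S.e02.1 h1 h2
end

def elH1 : List (Fin 14 × Fin 14) := [(0,4), (1,4), (0,5), (2,5), (0,6), (3,6), (1,7), (2,7), (1,8), (3,8), (2,9), (3,9), (10,6), (10,7), (11,8), (11,5), (12,4), (12,9), (13,10), (13,11), (13,12)]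

lemma elH1_set : GraphH1 = SimpleGraph.fromEdgeSet {e | ∃ p ∈ elH1, e = s(p.1, p.2)} := by
  unfold GraphH1
  congr 1
  ext e
  simp only [elH1, Set.mem_insert_iff, Set.mem_singleton_iff, Set.mem_ofPred_eq, List.exists_mem_cons_iff, List.not_mem_nil, false_and, exists_false, or_false]

set_option maxRecDepth 20000 in
lemma isoH1 (hyp : Hyp G) {g0 g1 g2 g3 b01 b02 b03 b12 b13 b23 z3 z2 z1 u : V}
    (hnd : [g0, g1, g2, g3, b01, b02, b03, b12, b13, b23, z3, z2, z1, u].Nodup) (hcard : Fintype.card V = 14)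
    (e01 : G.Adj b01 g0 ∧ G.Adj b01 g1) (e02 : G.Adj b02 g0 ∧ G.Adj b02 g2) (e03 : G.Adj b03 g0 ∧ G.Adj b03 g3)
    (e12 : G.Adj b12 g1 ∧ G.Adj b12 g2) (e13 : G.Adj b13 g1 ∧ G.Adj b13 g3) (e23 : G.Adj b23 g2 ∧ G.Adj b23 g3)
    (a3 : G.Adj b03 z3) (c3 : G.Adj b12 z3) (c2 : G.Adj b13 z2) (a2 : G.Adj b02 z2) (a1 : G.Adj b01 z1) (c1 : G.Adj b23 z1)
    (u3 : G.Adj u z3) (u2 : G.Adj u z2) (u1 : G.Adj u z1) : Nonempty (G ≃g GraphH1) := by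
  rw [elH1_set]
  have hA : ∀ p ∈ elH1, G.Adj ([g0, g1, g2, g3, b01, b02, b03, b12, b13, b23, z3, z2, z1, u].get p.1)
      ([g0, g1, g2, g3, b01, b02, b03, b12, b13, b23, z3, z2, z1, u].get p.2) := by
    unfold elH1
    simp only [List.forall_mem_cons]
    exact ⟨e01.1.symm, e01.2.symm, e02.1.symm, e02.2.symm, e03.1.symm, e03.2.symm, e12.1.symm, e12.2.symm,
      e13.1.symm, e13.2.symm, e23.1.symm, e23.2.symm, a3.symm, c3.symm, c2.symm, a2.symm, a1.symm, c1.symm, u3, u2, u1, by simp⟩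
  exact iso_of hyp _ elH1 (fun p hp => ⟨p, hp, rfl⟩) (fun e he => he) (by decide) (by decide)
    (fun i => [g0, g1, g2, g3, b01, b02, b03, b12, b13, b23, z3, z2, z1, u].get i)
    (List.nodup_iff_injective_get.1 hnd) hcard hA

lemma Cub.caseH1 (hc : Cub G) {X : Finset V} {u v1 v2 v3 : V} (N : Nb G X u v1 v2 v3)
    {g0 g1 g2 g3 b01 b02 b03 b12 b13 b23 : V} (S : SK G X g0 g1 g2 g3 b01 b02 b03 b12 b13 b23) :
    Nonempty (G ≃g GraphH1) := by
  obtain ⟨y1, m1, a1, -⟩ := S.third hc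
  obtain ⟨y2, m2, a2, -⟩ := S.w12.third hc
  obtain ⟨y3, m3, a3, -⟩ := S.w23.w12.third hc
  obtain ⟨z3, n3, c3, -⟩ := S.w01.w12.third hc
  obtain ⟨z2, n2, c2, -⟩ := S.w01.w23.w12.third hc
  obtain ⟨z1, n1, c1, -⟩ := S.w12.w23.w01.w12.third hc
  have k12 := S.c4 hc m1 a1 a2
  have k13 := S.w23.c4 hc m1 a1 a3
  have k23 := S.w12.w23.c4 hc m2 a2 a3
  -- z1 (b23) differs from y2, y3
  have q12 := S.w12.w01.w23.c4 hc m2 a2 c1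
  have q13 := S.w23.w12.w01.w23.c4 hc m3 a3 c1
  -- z2 (b13) differs from y1, y3
  have q21 := S.w01.w23.c4 hc m1 a1 c2
  have q23 := S.w23.w12.w01.c4 hc m3 a3 c2
  -- z3 (b12) differs from y1, y2
  have q31 := S.w01.c4 hc m1 a1 c3
  have q32 := S.w12.w01.c4 hc m2 a2 c3
  have mX := S.m0
  have out : ∀ b ∈ X, ∀ y, y ∉ X → G.Adj b y → y = v1 ∨ y = v2 ∨ y = v3 := by
    intro b hb y hy hh
    by_contra h'
    have : y = u := by
      by_contra h''
      exact hy ((N.mem y).2 (by tauto))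
    subst this
    have := N.only b hh.symm
    have := (N.mem b).1 hb
    tauto
  have o1 := out _ (by simp [mX]) _ m1 a1
  have o2 := out _ (by simp [mX]) _ m2 a2
  have o3 := out _ (by simp [mX]) _ m3 a3
  have p1 := out _ (by simp [mX]) _ n1 c1
  have p2 := out _ (by simp [mX]) _ n2 c2
  have p3 := out _ (by simp [mX]) _ n3 c3
  obtain ⟨rfl, rfl, rfl⟩ : z1 = y1 ∧ z2 = y2 ∧ z3 = y3 := by
    clear * - o1 o2 o3 p1 p2 p3 k12 k13 k23 q12 q13 q21 q23 q31 q32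
    grind
  have uX : u ∉ X := fun hh => ((N.mem u).1 hh).1 rfl
  have au : ∀ y, y = v1 ∨ y = v2 ∨ y = v3 → G.Adj u y := by
    rintro y (rfl | rfl | rfl); exacts [N.a1, N.a2, N.a3]
  have u1 := au _ o1
  have u2 := au _ o2
  have u3 := au _ o3
  have hnd : [g0, g1, g2, g3, b01, b02, b03, b12, b13, b23, z3, z2, z1, u].Nodup := by
    have : [g0, g1, g2, g3, b01, b02, b03, b12, b13, b23, z3, z2, z1, u] = [g0, g1, g2, g3, b01, b02, b03, b12, b13, b23] ++ [z3, z2, z1, u] := rfl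
    rw [this, List.nodup_append]
    refine ⟨S.nd, ?_, ?_⟩
    · simp [k12.symm, k13.symm, k23.symm, u1.ne', u2.ne', u3.ne']
    · intro p hp q hq e
      subst e
      have pX : p ∈ X := (S.mem p).2 (by simpa using hp)
      simp only [List.mem_cons, List.not_mem_nil, or_false] at hq
      rcases hq with rfl | rfl | rfl | rfl <;> contradiction
  have hcard : Fintype.card V = 14 := by
    have e : (Finset.univ : Finset V) = X ∪ {v1, v2, v3, u} := by
      ext z; have hz := N.mem z; simp only [FM, Finset.mem_univ, true_iff]; clear * - hz; tauto
    have ee := N.ne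
    rw [← Finset.card_univ, e, Finset.card_union_of_disjoint, S.crd]
    · rw [Finset.card_insert_of_notMem (by simp [ee, N.a1.ne']), Finset.card_insert_of_notMem (by simp [ee, N.a2.ne']),
        Finset.card_pair N.a3.ne']
    · rw [Finset.disjoint_left]; intro z hz; have hz := (N.mem z).1 hz; simp only [FM]; clear * - hz; tauto
  exact isoH1 hc.hyp hnd hcard S.e01 S.e02 S.e03 S.e12 S.e13 S.e23 a3 c3 c2 a2 a1 c1 u3 u2 u1

lemma full (hc : Cub G) {p a b c : V} (n1 : a ≠ b) (n2 : a ≠ c) (n3 : b ≠ c) (h1 : G.Adj p a) (h2 : G.Adj p b)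
    (h3 : G.Adj p c) : ∀ z, G.Adj p z → z = a ∨ z = b ∨ z = c := by
  obtain ⟨a', -, b', -, c', -, -, -, -, -, -, -, h⟩ := dg_three (hc.cub p)
  have k1 := h a (by simp) h1
  have k2 := h b (by simp) h2
  have k3 := h c (by simp) h3
  intro z hz
  have k4 := h z (by simp) hz
  clear * - k1 k2 k3 k4 n1 n2 n3
  grind

lemma Block.one2 (hc : Cub G) {D : Finset V} (hD : Block G D) {d p q : V} (hd : d ∈ D) (hp : p ∉ D) (hq : q ∉ D) (hn : p ≠ q)
    (a1 : G.Adj p d) (a2 : G.Adj q d) : False := by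
  have h := hc.hyp.deg d (insert p (insert q D))
  rw [dg_insert _ _ (by simp [hp, hn]), dg_insert _ _ hq, if_pos a1.symm, if_pos a2.symm] at h
  have := hD.deg hd
  omega

lemma Block.m1 (hc : Cub G) {D : Finset V} (hD : Block G D) {x1 x2 y1 y2 : V} (h1 : x1 ∈ D) (h2 : x2 ∈ D) (hne : x1 ≠ x2)
    (hy1 : y1 ∉ D) (hy2 : y2 ∉ D) (a1 : G.Adj x1 y1) (a2 : G.Adj x2 y2) : W G (D \ {x1, x2}) (-1) := by
  refine lemA_use hc.hyp subset_rfl hD.conn (fun C hC hcc => hc.PW (hD.sub hc hC) hcc) hD.w h1 h2 hne hy1 hy2 a1 a2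
    (fun x _ y hy hy' => absurd hy hy') ?_
  intro C hC hne'
  refine hD.br C (hC.trans Finset.sdiff_subset) hne' ?_
  rintro rfl
  have := hC h1
  simp at this

lemma hexSK_pure (hyp : Hyp G) {X D : Finset V} {u v1 v2 v3 a h v x w k ya yv yw yh yx yk : V}
    (N : Nb G X u v1 v2 v3) (H : Hex G X D a h v x w k ya yv yw)
    (mh : yh ∉ X) (mx : yx ∉ X) (mk : yk ∉ X) (th : G.Adj h yh) (tx : G.Adj x yx) (tk : G.Adj k yk)
    (fh : ∀ z, G.Adj h z → z = a ∨ z = v ∨ z = yh) (fx : ∀ z, G.Adj x z → z = v ∨ z = w ∨ z = yx)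
    (fk : ∀ z, G.Adj k z → z = w ∨ z = a ∨ z = yk)
    (fa : ∀ z, G.Adj a z → z = h ∨ z = k ∨ z = ya) (fv : ∀ z, G.Adj v z → z = h ∨ z = x ∨ z = yv)
    (fw : ∀ z, G.Adj w z → z = x ∨ z = k ∨ z = yw) :
    SK G (Finset.univ \ D) u h x k yh yx yk v a w := by
  have m : h ∈ X ∧ x ∈ X ∧ k ∈ X ∧ a ∈ X ∧ v ∈ X ∧ w ∈ X := by simp [H.mem]
  obtain ⟨nah, nvh, nhx⟩ : yh ≠ yx ∧ yh ≠ yk ∧ yx ≠ yk := by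
    refine ⟨?_, ?_, ?_⟩ <;> rintro rfl
    · exact hyp.c4 h x v yh H.nd.2.1.2.1 (fun e => mh (e ▸ m.2.2.2.2.1)) H.hv H.vx.symm th tx
    · exact hyp.c4 h k a yh H.nd.2.1.2.2.2 (fun e => mh (e ▸ m.2.2.2.1)) H.ah.symm H.ka th tk
    · exact hyp.c4 x k w yx H.nd.2.2.2.1.2 (fun e => mx (e ▸ m.2.2.2.2.2)) H.xw H.wk.symm tx tk
  have out : ∀ b ∈ X, ∀ y, y ∉ X → G.Adj b y → y = v1 ∨ y = v2 ∨ y = v3 := by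
    intro b hb y hy hh
    by_contra h'
    have : y = u := by
      by_contra h''
      exact hy ((N.mem y).2 ⟨h'', by tauto, by tauto, by tauto⟩)
    subst this
    have k1 := N.only b hh.symm
    have k2 := (N.mem b).1 hb
    clear * - k1 k2
    tauto
  have oh := out _ m.1 _ mh th
  have ox := out _ m.2.1 _ mx tx
  have ok := out _ m.2.2.1 _ mk tk
  have au : ∀ y, y = v1 ∨ y = v2 ∨ y = v3 → G.Adj u y := by
    rintro y (rfl | rfl | rfl); exacts [N.a1, N.a2, N.a3]
  have uh := au _ oh
  have ux := au _ ox
  have uk := au _ ok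
  have uX : u ∉ X := fun hh => ((N.mem u).1 hh).1 rfl
  have nn : ∀ y z, (y = v1 ∨ y = v2 ∨ y = v3) → (z = v1 ∨ z = v2 ∨ z = v3) → ¬ G.Adj y z := by
    intro y z hy hz hh
    exact hyp.tri u y z (au y hy) hh (au z hz)
  have nhx' := nn _ _ oh ox
  have nhk' := nn _ _ oh ok
  have nxk' := nn _ _ ox ok
  have perm : ∀ z, z ∈ X ↔ z ≠ u ∧ z ≠ yh ∧ z ≠ yx ∧ z ≠ yk := by
    intro z; rw [N.mem]; clear * - oh ox ok nah nvh nhx; grind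
  have hm := H.mem
  have hdm := H.nD
  have nd := H.nd
  have hma := H.ma
  have hmv := H.mv
  have hmw := H.mw
  have DX : ∀ z ∈ D, z ∈ X := fun z hz => H.DB hz
  have key : ∀ z, z ∈ Finset.univ \ D ↔ z = u ∨ z = h ∨ z = x ∨ z = k ∨ z = yh ∨ z = yx ∨ z = yk ∨ z = v ∨ z = a ∨ z = w := by
    intro z
    have h1 := hm z
    have h2 := perm z
    have h3 := DX z
    simp only [Finset.mem_sdiff, Finset.mem_univ, true_and]
    clear * - h1 h2 h3 uX mh mx mk hdm
    grind
  have fu : ∀ z, G.Adj u z → z = yh ∨ z = yx ∨ z = yk := by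
    intro z hz
    have := N.only z hz
    clear * - this oh ox ok nah nvh nhx; grind
  have sh := th.symm
  have sx := tx.symm
  have sk := tk.symm
  have uh' := uh.symm
  have ux' := ux.symm
  have uk' := uk.symm
  refine ⟨key, ?_, ⟨uh', sh⟩, ⟨ux', sx⟩, ⟨uk', sk⟩, ⟨H.hv.symm, H.vx⟩, ⟨H.ah, H.ka.symm⟩, ⟨H.xw.symm, H.wk⟩, ?_, ?_, ?_, ?_, ?_, ?_⟩
  · have q1 := uh.ne
    have q2 := ux.ne
    have q3 := uk.ne
    simp only [NL, or_false, not_false_eq_true, and_true, not_or]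
    clear * - q1 q2 q3 uX mh mx mk m nd nah nvh nhx
    constructorm* _ ∧ _ <;> grind
  · intro z hz hh
    have k1 := (key z).1 hz
    rcases k1 with rfl | rfl | rfl | rfl | rfl | rfl | rfl | rfl | rfl | rfl
    · exact Or.inl rfl
    · exact Or.inr rfl
    · have := fx _ hh.symm; clear * - this nah mh m; grind
    · have := fk _ hh.symm; clear * - this nvh mh m; grind
    · exact (hh.ne rfl).elim
    · exact (nhx' hh).elim
    · exact (nhk' hh).elim
    · have := fv _ hh.symm; have q := DX _ hmv; clear * - this q mh m; grind
    · have := fa _ hh.symm; have q := DX _ hma; clear * - this q mh m; grind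
    · have := fw _ hh.symm; have q := DX _ hmw; clear * - this q mh m; grind
  · intro z hz hh
    have k1 := (key z).1 hz
    rcases k1 with rfl | rfl | rfl | rfl | rfl | rfl | rfl | rfl | rfl | rfl
    · exact Or.inl rfl
    · have := fh _ hh.symm; clear * - this nah mx m; grind
    · exact Or.inr rfl
    · have := fk _ hh.symm; clear * - this nhx mx m; grind
    · exact (nhx' hh.symm).elim
    · exact (hh.ne rfl).elim
    · exact (nxk' hh).elim
    · have := fv _ hh.symm; have q := DX _ hmv; clear * - this q mx m; grind
    · have := fa _ hh.symm; have q := DX _ hma; clear * - this q mx m; grind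
    · have := fw _ hh.symm; have q := DX _ hmw; clear * - this q mx m; grind
  · intro z hz hh
    have k1 := (key z).1 hz
    rcases k1 with rfl | rfl | rfl | rfl | rfl | rfl | rfl | rfl | rfl | rfl
    · exact Or.inl rfl
    · have := fh _ hh.symm; clear * - this nvh mk m; grind
    · have := fx _ hh.symm; clear * - this nhx mk m; grind
    · exact Or.inr rfl
    · exact (nhk' hh.symm).elim
    · exact (nxk' hh.symm).elim
    · exact (hh.ne rfl).elim
    · have := fv _ hh.symm; have q := DX _ hmv; clear * - this q mk m; grind
    · have := fa _ hh.symm; have q := DX _ hma; clear * - this q mk m; grind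
    · have := fw _ hh.symm; have q := DX _ hmw; clear * - this q mk m; grind
  · intro z hz hh
    rcases fv z hh with e | e | e
    exacts [Or.inl e, Or.inr e, by subst e; simp [hmv] at hz]
  · intro z hz hh
    rcases fa z hh with e | e | e
    exacts [Or.inl e, Or.inr e, by subst e; simp [hma] at hz]
  · intro z hz hh
    rcases fw z hh with e | e | e
    exacts [Or.inl e, Or.inr e, by subst e; simp [hmw] at hz]

lemma Cub.hexSK (hc : Cub G) {X D : Finset V} {u v1 v2 v3 a h v x w k ya yv yw : V}
    (N : Nb G X u v1 v2 v3) (H : Hex G X D a h v x w k ya yv yw) :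
    ∃ g0 g1 g2 g3 b01 b02 b03 b12 b13 b23, SK G (Finset.univ \ D) g0 g1 g2 g3 b01 b02 b03 b12 b13 b23 := by
  have m : h ∈ X ∧ x ∈ X ∧ k ∈ X ∧ a ∈ X ∧ v ∈ X ∧ w ∈ X := by simp [H.mem]
  have nd := H.nd
  obtain ⟨yh, mh, th, fh⟩ := third hc nd.1.2.1 ⟨H.ah.symm, H.hv⟩ H.uh m.2.2.2.1 m.2.2.2.2.1
  obtain ⟨yx, mx, tx, fx⟩ := third hc nd.2.2.1.2.1 ⟨H.vx.symm, H.xw⟩ H.ux m.2.2.2.2.1 m.2.2.2.2.2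
  obtain ⟨yk, mk, tk, fk⟩ := third hc nd.1.2.2.2.1.symm ⟨H.wk.symm, H.ka⟩ H.uk m.2.2.2.2.2 m.2.2.2.1
  have fa := full hc nd.2.1.2.2.2 (fun e => H.nD.2.1 (e ▸ H.ma)) (fun e => H.nD.2.2.2 (e ▸ H.ma)) H.ah H.ka.symm H.ta
  have fv := full hc nd.2.1.2.1 (fun e => H.nD.2.1 (e ▸ H.mv)) (fun e => H.nD.2.2.1 (e ▸ H.mv)) H.hv.symm H.vx H.tv
  have fw := full hc nd.2.2.2.1.2 (fun e => H.nD.2.2.1 (e ▸ H.mw)) (fun e => H.nD.2.2.2 (e ▸ H.mw)) H.xw.symm H.wk H.tw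
  exact ⟨_, _, _, _, _, _, _, _, _, _, hexSK_pure hc.hyp N H mh mx mk th tx tk fh fx fk fa fv fw⟩

variable (G) in
structure TT (D : Finset V) (g0 g1 g2 g3 b01 b02 b03 b12 b13 b23 d01 d02 d03 d12 d13 d23 : V) : Prop where
  S : SK G (Finset.univ \ D) g0 g1 g2 g3 b01 b02 b03 b12 b13 b23
  dm : d01 ∈ D ∧ d02 ∈ D ∧ d03 ∈ D ∧ d12 ∈ D ∧ d13 ∈ D ∧ d23 ∈ D
  t01 : G.Adj b01 d01
  t02 : G.Adj b02 d02
  t03 : G.Adj b03 d03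
  t12 : G.Adj b12 d12
  t13 : G.Adj b13 d13
  t23 : G.Adj b23 d23
  f01 : ∀ z, G.Adj b01 z → z = g0 ∨ z = g1 ∨ z = d01
  f02 : ∀ z, G.Adj b02 z → z = g0 ∨ z = g2 ∨ z = d02
  f03 : ∀ z, G.Adj b03 z → z = g0 ∨ z = g3 ∨ z = d03
  f12 : ∀ z, G.Adj b12 z → z = g1 ∨ z = g2 ∨ z = d12
  f13 : ∀ z, G.Adj b13 z → z = g1 ∨ z = g3 ∨ z = d13
  f23 : ∀ z, G.Adj b23 z → z = g2 ∨ z = g3 ∨ z = d23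

section
variable {D : Finset V} {g0 g1 g2 g3 b01 b02 b03 b12 b13 b23 d01 d02 d03 d12 d13 d23 : V}

lemma or3 {p q r : Prop} (h : p ∨ q ∨ r) : q ∨ p ∨ r := by tauto

lemma TT.w01 (T : TT G D g0 g1 g2 g3 b01 b02 b03 b12 b13 b23 d01 d02 d03 d12 d13 d23) :
    TT G D g1 g0 g2 g3 b01 b12 b13 b02 b03 b23 d01 d12 d13 d02 d03 d23 := by
  obtain ⟨S, ⟨m1, m2, m3, m4, m5, m6⟩, t01, t02, t03, t12, t13, t23, f01, f02, f03, f12, f13, f23⟩ := T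
  exact ⟨S.w01, ⟨m1, m4, m5, m2, m3, m6⟩, t01, t12, t13, t02, t03, t23, fun z hz => or3 (f01 z hz), f12, f13, f02, f03, f23⟩

lemma TT.w12 (T : TT G D g0 g1 g2 g3 b01 b02 b03 b12 b13 b23 d01 d02 d03 d12 d13 d23) :
    TT G D g0 g2 g1 g3 b02 b01 b03 b12 b23 b13 d02 d01 d03 d12 d23 d13 := by
  obtain ⟨S, ⟨m1, m2, m3, m4, m5, m6⟩, t01, t02, t03, t12, t13, t23, f01, f02, f03, f12, f13, f23⟩ := T
  exact ⟨S.w12, ⟨m2, m1, m3, m4, m6, m5⟩, t02, t01, t03, t12, t23, t13, f02, f01, f03, fun z hz => or3 (f12 z hz), f23, f13⟩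

lemma TT.w23 (T : TT G D g0 g1 g2 g3 b01 b02 b03 b12 b13 b23 d01 d02 d03 d12 d13 d23) :
    TT G D g0 g1 g3 g2 b01 b03 b02 b13 b12 b23 d01 d03 d02 d13 d12 d23 := by
  obtain ⟨S, ⟨m1, m2, m3, m4, m5, m6⟩, t01, t02, t03, t12, t13, t23, f01, f02, f03, f12, f13, f23⟩ := T
  exact ⟨S.w23, ⟨m1, m3, m2, m5, m4, m6⟩, t01, t03, t02, t13, t12, t23, f01, f03, f02, f13, f12, fun z hz => or3 (f23 z hz)⟩

lemma SK.toTT (hc : Cub G) (S : SK G (Finset.univ \ D) g0 g1 g2 g3 b01 b02 b03 b12 b13 b23) :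
    ∃ d01 d02 d03 d12 d13 d23, TT G D g0 g1 g2 g3 b01 b02 b03 b12 b13 b23 d01 d02 d03 d12 d13 d23 := by
  obtain ⟨y1, m1, a1, h1⟩ := S.third hc
  obtain ⟨y2, m2, a2, h2⟩ := S.w12.third hc
  obtain ⟨y3, m3, a3, h3⟩ := S.w23.w12.third hc
  obtain ⟨z3, n3, c3, k3⟩ := S.w01.w12.third hc
  obtain ⟨z2, n2, c2, k2⟩ := S.w01.w23.w12.third hc
  obtain ⟨z1, n1, c1, k1⟩ := S.w12.w23.w01.w12.third hc
  simp only [Finset.mem_sdiff, Finset.mem_univ, true_and, not_not] at m1 m2 m3 n1 n2 n3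
  exact ⟨y1, y2, y3, z3, z2, z1, S, ⟨m1, m2, m3, n3, n2, n1⟩, a1, a2, a3, c3, c2, c1, h1, h2, h3, k3, k2, k1⟩

lemma SK.full (hc : Cub G) {B : Finset V} (S : SK G B g0 g1 g2 g3 b01 b02 b03 b12 b13 b23) :
    ∀ z, G.Adj g0 z → z = b01 ∨ z = b02 ∨ z = b03 :=
  URPaper.full hc S.bb S.w23.bb S.w12.w23.bb S.e01.1.symm S.e02.1.symm S.e03.1.symm

lemma SK.notD (S : SK G (Finset.univ \ D) g0 g1 g2 g3 b01 b02 b03 b12 b13 b23) : (g0 ∉ D ∧ g1 ∉ D ∧ g2 ∉ D ∧ g3 ∉ D) ∧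
    b01 ∉ D ∧ b02 ∉ D ∧ b03 ∉ D ∧ b12 ∉ D ∧ b13 ∉ D ∧ b23 ∉ D := by
  have := S.m0
  simpa using this

lemma TT.nd (hc : Cub G) (hD : Block G D) (T : TT G D g0 g1 g2 g3 b01 b02 b03 b12 b13 b23 d01 d02 d03 d12 d13 d23) :
    [d01, d02, d03, d12, d13, d23].Nodup := by
  have key : ∀ {p q d e : V}, p ∉ D → q ∉ D → p ≠ q → d ∈ D → G.Adj p d → G.Adj q e → d ≠ e := by
    rintro p q d _ hp hq hn hd h1 h2 rfl
    exact hD.one2 hc hd hp hq hn h1 h2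
  obtain ⟨-, m1, m2, m3, m4, m5, m6⟩ := T.S.notD
  have nd := T.S.nd
  obtain ⟨r1, r2, r3, r4, r5, r6⟩ := T.dm
  simp only [NL, or_false, not_false_eq_true, and_true, not_or] at nd ⊢
  obtain ⟨-, -, -, -, ⟨n1, n2, n3, n4, n5⟩, ⟨n6, n7, n8, n9⟩, ⟨n10, n11, n12⟩, ⟨n13, n14⟩, n15⟩ := nd
  refine ⟨⟨?_, ?_, ?_, ?_, ?_⟩, ⟨?_, ?_, ?_, ?_⟩, ⟨?_, ?_, ?_⟩, ⟨?_, ?_⟩, ?_⟩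
  exacts [key m1 m2 n1 r1 T.t01 T.t02, key m1 m3 n2 r1 T.t01 T.t03, key m1 m4 n3 r1 T.t01 T.t12, key m1 m5 n4 r1 T.t01 T.t13,
    key m1 m6 n5 r1 T.t01 T.t23, key m2 m3 n6 r2 T.t02 T.t03, key m2 m4 n7 r2 T.t02 T.t12, key m2 m5 n8 r2 T.t02 T.t13,
    key m2 m6 n9 r2 T.t02 T.t23, key m3 m4 n10 r3 T.t03 T.t12, key m3 m5 n11 r3 T.t03 T.t13, key m3 m6 n12 r3 T.t03 T.t23,
    key m4 m5 n13 r4 T.t12 T.t13, key m4 m6 n14 r4 T.t12 T.t23, key m5 m6 n15 r5 T.t13 T.t23]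

lemma TT.out (hc : Cub G) (T : TT G D g0 g1 g2 g3 b01 b02 b03 b12 b13 b23 d01 d02 d03 d12 d13 d23) :
    ∀ z ∈ D, ∀ y, y ∉ D → G.Adj z y → z = d01 ∨ z = d02 ∨ z = d03 ∨ z = d12 ∨ z = d13 ∨ z = d23 := by
  intro z hz y hy hh
  obtain ⟨⟨q0, q1, q2, q3⟩, m1, m2, m3, m4, m5, m6⟩ := T.S.notD
  have hh := hh.symm
  rcases (T.S.mem y).1 (by simpa using hy) with rfl | rfl | rfl | rfl | rfl | rfl | rfl | rfl | rfl | rfl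
  · have k := T.S.full hc z hh; clear * - k hz m1 m2 m3 m4 m5 m6; grind
  · have k := T.S.w01.full hc z hh; clear * - k hz m1 m2 m3 m4 m5 m6; grind
  · have k := T.S.w12.w01.full hc z hh; clear * - k hz m1 m2 m3 m4 m5 m6; grind
  · have k := T.S.w23.w12.w01.full hc z hh; clear * - k hz m1 m2 m3 m4 m5 m6; grind
  · have k := T.f01 z hh; clear * - k hz q0 q1 q2 q3; grind
  · have k := T.f02 z hh; clear * - k hz q0 q1 q2 q3; grind
  · have k := T.f03 z hh; clear * - k hz q0 q1 q2 q3; grind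
  · have k := T.f12 z hh; clear * - k hz q0 q1 q2 q3; grind
  · have k := T.f13 z hh; clear * - k hz q0 q1 q2 q3; grind
  · have k := T.f23 z hh; clear * - k hz q0 q1 q2 q3; grind

lemma TT.tri (hc : Cub G) (hD : Block G D) (T : TT G D g0 g1 g2 g3 b01 b02 b03 b12 b13 b23 d01 d02 d03 d12 d13 d23) :
    ¬ W G (D \ {d01, d02, d12}) (-2) := by
  intro hW
  have f3 := T.S.w23.w12.w01.full hc
  have nD := T.S.notD
  have nb := T.S.nd
  have nd := T.nd hc hD
  have dm := T.dm
  have mem := T.S.mem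
  have f01 := T.f01
  have f02 := T.f02
  have f12 := T.f12
  simp only [NL, or_false, not_false_eq_true, and_true, not_or] at nd nb
  have s1 := hW.leaf (u := b01) (v := d01) (by clear * - nD; simp only [Finset.mem_sdiff]; tauto) (by simp) T.t01 (by
    intro z hz hh
    have := f01 z hh
    simp only [FM] at hz
    clear * - nD hz this; grind)
  have s2 := s1.leaf (u := g3) (v := b23)
    (by simp only [FM]; clear * - nD nb dm; grind)
    (by simp only [FM]; clear * - nD nb dm; grind) T.S.e23.2.symm (by
    intro z hz hh
    have := f3 z hh
    simp only [FM] at hz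
    clear * - nD hz this nb dm; grind)
  have s3 := s2.leaf (u := b02) (v := g0)
    (by simp only [FM]; clear * - nD nb dm; grind)
    (by simp only [FM]; clear * - nD nb dm; grind) T.S.e02.1 (by
    intro z hz hh
    have := f02 z hh
    simp only [FM] at hz
    clear * - nD hz this nb dm nd; grind)
  have s4 := s3.leaf (u := b12) (v := g1)
    (by simp only [FM]; clear * - nD nb dm; grind)
    (by simp only [FM]; clear * - nD nb dm; grind) T.S.e12.1 (by
    intro z hz hh
    have := f12 z hh
    simp only [FM] at hz
    clear * - nD hz this nb dm nd; grind)
  refine hc.no (((((s4.ins d02).ins d12).ins g2).ins b03).ins b13 |>.to (by norm_num) ?_)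
  ext z
  have := mem z
  simp only [FM, Finset.mem_univ, true_and, true_iff] at this ⊢
  clear * - this
  tauto
end

section
variable {D E : Finset V} {a h v x w k ya yv yw : V}

lemma Hex.fr1 (hc : Cub G) (hE : Block G E) (H : Hex G D E a h v x w k ya yv yw) : W G (D \ {h, x, k}) (-2) := by
  have s0 := hE.m1 hc H.ma H.mv H.ny.1 H.nD.1.1 H.nD.1.2.1 H.ta.symm H.tv.symm
  have nd := H.nd
  have nD := H.nD
  have ma := H.ma
  have mv := H.mv
  have ny := H.ny
  have nn := H.nn
  have ua := H.ua
  have uv := H.uv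
  have ta := H.ta
  have tv := H.tv
  have nya : ¬ G.Adj v ya := fun hh => ny.1 (uv _ ma hh)
  have nva : ¬ G.Adj v a := fun hh => nn.1 hh.symm
  have s1 := s0.leaf (u := a) (v := ya)
    (by simp only [FM]; clear * - nD; grind)
    (by simp) ta (by
      intro z hz hh
      simp only [FM] at hz
      exact hz.2 (Or.inl (ua z hz.1 hh)))
  have s2 := s1.leaf (u := v) (v := yv)
    (by simp only [FM]; clear * - nD nd ma; grind)
    (by simp only [FM]; clear * - nD nd mv ny; grind) tv (by
      intro z hz hh
      have := uv z
      simp only [FM] at hz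
      clear * - hz hh this nya nva; grind)
  refine (s2.ins w).to (by norm_num) ?_
  ext z
  have hz := H.mem z
  simp only [FM]
  rw [hz]
  clear * - nd nD ma mv
  grind

lemma Hex.fr2 (hc : Cub G) (hE : Block G E) (H : Hex G D E a h v x w k ya yv yw) {e b : V} (he : e ∈ E) (hb : b ∉ E)
    (hbe : G.Adj b e) (hne : e ≠ yv) : W G (D \ {h, x, e}) (-2) := by
  have s0 := hE.m1 hc H.mv he hne.symm H.nD.1.2.1 hb H.tv.symm hbe.symm
  have nd := H.nd
  have nD := H.nD
  have mv := H.mv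
  have nn := H.nn
  have uv := H.uv
  have uk := H.uk
  have tv := H.tv
  have DB : ∀ z ∈ E, z ∈ D := fun z hz => H.DB hz
  have vD : v ∈ D := (H.mem v).2 (by simp)
  have s1 := s0.leaf (u := v) (v := yv)
    (by simp only [FM]; clear * - nD; grind)
    (by simp) tv (by
      intro z hz hh
      simp only [FM] at hz
      exact hz.2 (Or.inl (uv z hz.1 hh)))
  have s2 := s1.leaf (u := k) (v := w)
    (by simp only [FM]; clear * - nD nd mv; grind)
    (by simp only [FM]; clear * - nD nd mv; grind) H.wk.symm (by
      intro z hz hh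
      have q := uk z
      have q' := DB z
      simp only [FM] at hz
      clear * - hz hh q q' nD nd vD mv; grind)
  refine (s2.ins a).to (by norm_num) ?_
  ext z
  have hz := H.mem z
  simp only [FM]
  rw [hz]
  clear * - nd nD mv he hne
  grind

lemma Hex.fr3 (hc : Cub G) (hE : Block G E) (H : Hex G D E a h v x w k ya yv yw) {e b e' b' : V} (he : e ∈ E) (hb : b ∉ E)
    (hbe : G.Adj b e) (he' : e' ∈ E) (hb' : b' ∉ E) (hbe' : G.Adj b' e') (hne : e ≠ e') : W G (D \ {h, e, e'}) (-2) := by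
  have s0 := hE.m1 hc he he' hne hb hb' hbe.symm hbe'.symm
  have nd := H.nd
  have nD := H.nD
  have ux := H.ux
  have uk := H.uk
  have DB : ∀ z ∈ E, z ∈ D := fun z hz => H.DB hz
  have vD : v ∈ D := (H.mem v).2 (by simp)
  have xD : x ∈ D := (H.mem x).2 (by simp)
  have s1 := s0.leaf (u := x) (v := v)
    (by simp only [FM]; clear * - nD; grind)
    (by simp only [FM]; clear * - nD; grind) H.vx.symm (by
      intro z hz hh
      have q := ux z
      have q' := DB z
      simp only [FM] at hz
      clear * - hz hh q q' nD; grind)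
  have s2 := s1.leaf (u := k) (v := a)
    (by simp only [FM]; clear * - nD nd; grind)
    (by simp only [FM]; clear * - nD nd; grind) H.ka (by
      intro z hz hh
      have q := uk z
      have q' := DB z
      simp only [FM] at hz
      clear * - hz hh q q' nD nd vD xD; grind)
  refine (s2.ins w).to (by norm_num) ?_
  ext z
  have hz := H.mem z
  simp only [FM]
  rw [hz]
  clear * - nd nD he he' hne
  grind

lemma trip_swap {p q r : V} (hW : W G (D \ {p, q, r}) (-2)) : W G (D \ {p, r, q}) (-2) :=
  hW.to le_rfl (by congr 1; ext z; simp only [FM]; tauto)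

lemma trip_swap' {p q r : V} (hW : W G (D \ {p, q, r}) (-2)) : W G (D \ {q, p, r}) (-2) :=
  hW.to le_rfl (by congr 1; ext z; simp only [FM]; tauto)

/-- removing three vertices with neighbours outside, one of them `h` -/
lemma Hex.fr (hc : Cub G) (hE : Block G E) (H : Hex G D E a h v x w k ya yv yw) {e b e' b' : V} (he : e ∈ D) (hb : b ∉ D)
    (hbe : G.Adj b e) (he' : e' ∈ D) (hb' : b' ∉ D) (hbe' : G.Adj b' e') (hne : e ≠ e') (h1 : e ≠ h) (h2 : e' ≠ h) :
    W G (D \ {h, e, e'}) (-2) := by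
  have nd := H.nd
  have DB : ∀ z ∈ E, z ∈ D := fun z hz => H.DB hz
  have m : h ∈ D ∧ x ∈ D ∧ k ∈ D ∧ a ∈ D ∧ v ∈ D ∧ w ∈ D := by simp [H.mem]
  have fa := full hc nd.2.1.2.2.2 (fun e => H.nD.2.1 (e ▸ H.ma)) (fun e => H.nD.2.2.2 (e ▸ H.ma)) H.ah H.ka.symm H.ta
  have fv := full hc nd.2.1.2.1 (fun e => H.nD.2.1 (e ▸ H.mv)) (fun e => H.nD.2.2.1 (e ▸ H.mv)) H.hv.symm H.vx H.tv
  have fw := full hc nd.2.2.2.1.2 (fun e => H.nD.2.2.1 (e ▸ H.mw)) (fun e => H.nD.2.2.2 (e ▸ H.mw)) H.xw.symm H.wk H.tw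
  have ra := DB _ H.ma
  have rv := DB _ H.mv
  have rw' := DB _ H.mw
  have cl : ∀ e b, e ∈ D → b ∉ D → G.Adj b e → e ≠ h → e = x ∨ e = k ∨ (e ∈ E ∧ b ∉ E ∧ e ≠ yv ∧ e ≠ ya) := by
    intro e b he hb hbe hh
    have q1 := fa b
    have q2 := fv b
    have q3 := fw b
    have mm := (H.mem e).1 he
    have hbE : b ∉ E := fun hh => hb (DB b hh)
    have n1 : e ≠ yv := by
      rintro rfl
      exact hE.one2 hc H.mv hbE H.nD.1.2.1 (fun e => hb (e ▸ m.2.2.2.2.1)) hbe H.tv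
    have n2 : e ≠ ya := by
      rintro rfl
      exact hE.one2 hc H.ma hbE H.nD.1.1 (fun e => hb (e ▸ m.2.2.2.1)) hbe H.ta
    have hs := hbe.symm
    rcases mm with rfl | rfl | rfl | rfl | rfl | rfl | mm
    · have := q1 hs; clear * - this hb m ra; grind
    · exact (hh rfl).elim
    · have := q2 hs; clear * - this hb m rv; grind
    · exact Or.inl rfl
    · have := q3 hs; clear * - this hb m rw'; grind
    · exact Or.inr (Or.inl rfl)
    · exact Or.inr (Or.inr ⟨mm, hbE, n1, n2⟩)
  rcases cl e b he hb hbe h1 with rfl | rfl | ⟨q1, q2, q3, q4⟩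
  · rcases cl e' b' he' hb' hbe' h2 with rfl | rfl | ⟨r1, r2, r3, r4⟩
    · exact (hne rfl).elim
    · exact H.fr1 hc hE
    · exact H.fr2 hc hE r1 r2 hbe' r3
  · rcases cl e' b' he' hb' hbe' h2 with rfl | rfl | ⟨r1, r2, r3, r4⟩
    · exact trip_swap (H.fr1 hc hE)
    · exact (hne rfl).elim
    · exact trip_swap' (H.rot.rot.fr2 hc hE r1 r2 hbe' r4)
  · rcases cl e' b' he' hb' hbe' h2 with rfl | rfl | ⟨r1, r2, r3, r4⟩
    · exact trip_swap (H.fr2 hc hE q1 q2 hbe q3)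
    · exact trip_swap (trip_swap' (H.rot.rot.fr2 hc hE q1 q2 hbe q4))
    · exact H.fr3 hc hE q1 q2 hbe r1 r2 hbe' hne

variable {g0 g1 g2 g3 b01 b02 b03 b12 b13 b23 d01 d02 d03 d12 d13 d23 : V}

lemma TT.hex0 (hc : Cub G) (hD : Block G D) (T : TT G D g0 g1 g2 g3 b01 b02 b03 b12 b13 b23 d01 d02 d03 d12 d13 d23)
    (hE : Block G E) (H : Hex G D E a h v x w k ya yv yw) (e : h = d01) : False := by
  subst e
  have nd := T.nd hc hD
  have nD := T.S.notD
  simp only [NL, or_false, not_false_eq_true, and_true, not_or] at nd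
  refine T.tri hc hD (H.fr hc hE T.dm.2.1 nD.2.2.1 T.t02 T.dm.2.2.2.1 nD.2.2.2.2.1 T.t12 nd.2.1.2.1 (fun e => nd.1.1 e.symm) (fun e => nd.1.2.2.1 e.symm))

lemma TT.hex (hc : Cub G) (hD : Block G D) (T : TT G D g0 g1 g2 g3 b01 b02 b03 b12 b13 b23 d01 d02 d03 d12 d13 d23)
    (hE : Block G E) (H : Hex G D E a h v x w k ya yv yw) : False := by
  have m : h ∈ D ∧ x ∈ D ∧ k ∈ D ∧ a ∈ D ∧ v ∈ D ∧ w ∈ D := by simp [H.mem]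
  obtain ⟨y, my, ty, -⟩ := third hc H.nd.1.2.1 ⟨H.ah.symm, H.hv⟩ H.uh m.2.2.2.1 m.2.2.2.2.1
  rcases T.out hc h m.1 y my ty with e | e | e | e | e | e
  · exact T.hex0 hc hD hE H e
  · exact T.w12.hex0 hc hD hE H e
  · exact T.w23.w12.hex0 hc hD hE H e
  · exact T.w01.w12.hex0 hc hD hE H e
  · exact T.w01.w23.w12.hex0 hc hD hE H e
  · exact T.w12.w23.w01.w12.hex0 hc hD hE H e

variable (G) in
def QQ (D : Finset V) (p q r : V) : Prop := (∃ z ∈ D, G.Adj z p ∧ G.Adj z q ∧ G.Adj z r) ∨ W G (D \ {p, q, r}) (-2)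

lemma QQ.sw {p q r : V} (hq : QQ G D p q r) : QQ G D p r q := by
  rcases hq with ⟨z, h0, h1, h2, h3⟩ | hq
  · exact Or.inl ⟨z, h0, h1, h3, h2⟩
  · exact Or.inr (trip_swap hq)

/-- auxiliary construction -/
lemma skq (m : ∀ z, z ∈ D ↔ z = g0 ∨ z = g1 ∨ z = g2 ∨ z = g3 ∨ z = b01 ∨ z = b02 ∨ z = b03 ∨ z = b12 ∨ z = b13 ∨ z = b23)
    {p q r s t u y : V} {S : Finset V} (hS : S = {p, q, r, s, t, u, y})
    (nd : [p, q, r, s, t, u, y].Nodup) (a1 : G.Adj p q) (a2 : G.Adj r s) (a3 : G.Adj t u)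
    (n1 : ¬ G.Adj r p) (n2 : ¬ G.Adj r q) (n3 : ¬ G.Adj t p) (n4 : ¬ G.Adj t q) (n5 : ¬ G.Adj t r) (n6 : ¬ G.Adj t s) :
    W G S (-2) := by
  simp only [NL, or_false, not_false_eq_true, and_true, not_or] at nd
  have s1 := (W.empty (G := G)).leaf (u := p) (v := q) (by simp) (by simp) a1 (by simp)
  have s2 := s1.leaf (u := r) (v := s) (by clear * - nd; simp; grind) (by clear * - nd; simp; grind) a2 (by
    intro z hz
    simp at hz
    rcases hz with rfl | rfl <;> assumption)
  have s3 := s2.leaf (u := t) (v := u) (by clear * - nd; simp; grind) (by clear * - nd; simp; grind) a3 (by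
    intro z hz
    simp at hz
    rcases hz with rfl | rfl | rfl | rfl <;> assumption)
  refine (s3.ins y).to (by norm_num) ?_
  rw [hS]; ext z
  simp only [FM, Finset.notMem_empty]
  clear * -
  tauto

lemma SK.ng (hyp : Hyp G) (S : SK G D g0 g1 g2 g3 b01 b02 b03 b12 b13 b23) : ¬ G.Adj g0 g1 ∧ ¬ G.Adj g2 b01 ∧ ¬ G.Adj g3 b01 := by
  have nb := S.nd
  simp only [NL, or_false, not_false_eq_true, and_true, not_or] at nb
  have m := S.m0.1
  have u := S.u01
  refine ⟨fun hh => hyp.tri b01 g0 g1 S.e01.1 hh S.e01.2, fun hh => ?_, fun hh => ?_⟩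
  · have := u g2 m.2.2.1 hh.symm; clear * - this nb; grind
  · have := u g3 m.2.2.2 hh.symm; clear * - this nb; grind

lemma SK.t2 (hyp : Hyp G) (S : SK G D g0 g1 g2 g3 b01 b02 b03 b12 b13 b23) {r : V} (h1 : r ≠ b01) (h2 : r ≠ b02)
    (hr : r = b01 ∨ r = b02 ∨ r = b03 ∨ r = b12 ∨ r = b13 ∨ r = b23) : QQ G D b01 b02 r := by
  have mem := S.mem
  have nb := S.nd
  simp only [NL, or_false, not_false_eq_true, and_true, not_or] at nb
  obtain ⟨o01, o01', o01''⟩ := S.ng hyp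
  obtain ⟨o02, o02', o02''⟩ := S.w12.ng hyp
  obtain ⟨o03, o03', o03''⟩ := S.w23.w12.ng hyp
  obtain ⟨o12, o12', o12''⟩ := S.w01.w12.ng hyp
  obtain ⟨o13, o13', o13''⟩ := S.w01.w23.w12.ng hyp
  obtain ⟨o23, o23', o23''⟩ := S.w12.w23.w01.w12.ng hyp
  have bnb : ∀ {p q : V}, p ∈ D → (∀ z ∈ D, G.Adj q z → z = g0 ∨ z = g1 ∨ z = g2 ∨ z = g3) → (p ≠ g0 ∧ p ≠ g1 ∧ p ≠ g2 ∧ p ≠ g3) → ¬ G.Adj q p := by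
    intro p q hp hq hn hh
    have := hq p hp hh
    clear * - this hn; tauto
  have sep : ∀ {P : V → Prop}, True := trivial
  rcases hr with rfl | rfl | rfl | rfl | rfl | rfl
  · exact (h1 rfl).elim
  · exact (h2 rfl).elim
  · exact Or.inl ⟨g0, S.m0.1.1, S.e01.1.symm, S.e02.1.symm, S.e03.1.symm⟩
  · refine Or.inr (skq mem (p := g0) (q := b03) (r := g1) (s := b13) (t := g2) (u := b23) (y := g3) ?_ ?_ S.e03.1.symm S.e13.1.symm S.e23.1.symm ?_ ?_ ?_ ?_ ?_ ?_)
    · ext z; simp only [FM]; rw [mem]; clear * - nb; grind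
    · simp only [NL, or_false, not_false_eq_true, and_true, not_or]; clear * - nb; grind
    all_goals (first | assumption | exact fun hh => absurd hh.symm (by assumption))
  · refine Or.inr (skq mem (p := g0) (q := b03) (r := g1) (s := b12) (t := b23) (u := g3) (y := g2) ?_ ?_ S.e03.1.symm S.e12.1.symm S.e23.2 ?_ ?_ ?_ ?_ ?_ ?_)
    · ext z; simp only [FM]; rw [mem]; clear * - nb; grind
    · simp only [NL, or_false, not_false_eq_true, and_true, not_or]; clear * - nb; grind
    all_goals (first | assumption | exact fun hh => absurd hh.symm (by assumption) | skip)
    all_goals exact fun hh => by have := S.u23 _ ((mem _).2 (by simp)) hh; clear * - this nb; grind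
  · refine Or.inr (skq mem (p := g0) (q := b03) (r := g2) (s := b12) (t := b13) (u := g3) (y := g1) ?_ ?_ S.e03.1.symm S.e12.2.symm S.e13.2 ?_ ?_ ?_ ?_ ?_ ?_)
    · ext z; simp only [FM]; rw [mem]; clear * - nb; grind
    · simp only [NL, or_false, not_false_eq_true, and_true, not_or]; clear * - nb; grind
    all_goals (first | assumption | exact fun hh => absurd hh.symm (by assumption) | skip)
    all_goals exact fun hh => by have := S.u13 _ ((mem _).2 (by simp)) hh; clear * - this nb; grind

lemma SK.t1 (hyp : Hyp G) (S : SK G D g0 g1 g2 g3 b01 b02 b03 b12 b13 b23) {q r : V} (h1 : q ≠ b01) (h2 : r ≠ b01) (hqr : q ≠ r)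
    (hq : q = b01 ∨ q = b02 ∨ q = b03 ∨ q = b12 ∨ q = b13 ∨ q = b23)
    (hr : r = b01 ∨ r = b02 ∨ r = b03 ∨ r = b12 ∨ r = b13 ∨ r = b23) : QQ G D b01 q r := by
  have key : ∀ {q r : V}, r ≠ b01 → q ≠ r → q = b02 ∨ q = b03 ∨ q = b12 ∨ q = b13 →
      (r = b01 ∨ r = b02 ∨ r = b03 ∨ r = b12 ∨ r = b13 ∨ r = b23) → QQ G D b01 q r := by
    clear * - S hyp
    rintro q r h1 h2 (rfl | rfl | rfl | rfl) hr
    · exact S.t2 hyp h1 h2.symm hr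
    · exact S.w23.t2 hyp h1 h2.symm (by clear * - hr; tauto)
    · exact S.w01.t2 hyp h1 h2.symm (by clear * - hr; tauto)
    · exact S.w01.w23.t2 hyp h1 h2.symm (by clear * - hr; tauto)
  by_cases h3 : q = b23
  · refine QQ.sw (key h1 hqr.symm ?_ hq)
    clear * - h3 hr h2 hqr; grind
  · refine key h2 hqr ?_ hr
    clear * - h3 hq h1; tauto

lemma SK.t0 (hyp : Hyp G) (S : SK G D g0 g1 g2 g3 b01 b02 b03 b12 b13 b23) {p q r : V} (hpq : p ≠ q) (hpr : p ≠ r) (hqr : q ≠ r)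
    (hp : p = b01 ∨ p = b02 ∨ p = b03 ∨ p = b12 ∨ p = b13 ∨ p = b23)
    (hq : q = b01 ∨ q = b02 ∨ q = b03 ∨ q = b12 ∨ q = b13 ∨ q = b23)
    (hr : r = b01 ∨ r = b02 ∨ r = b03 ∨ r = b12 ∨ r = b13 ∨ r = b23) : QQ G D p q r := by
  rcases hp with rfl | rfl | rfl | rfl | rfl | rfl
  · exact S.t1 hyp hpq.symm hpr.symm hqr hq hr
  · exact S.w12.t1 hyp hpq.symm hpr.symm hqr (by clear * - hq; tauto) (by clear * - hr; tauto)
  · exact S.w23.w12.t1 hyp hpq.symm hpr.symm hqr (by clear * - hq; tauto) (by clear * - hr; tauto)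
  · exact S.w01.w12.t1 hyp hpq.symm hpr.symm hqr (by clear * - hq; tauto) (by clear * - hr; tauto)
  · exact S.w01.w23.w12.t1 hyp hpq.symm hpr.symm hqr (by clear * - hq; tauto) (by clear * - hr; tauto)
  · exact S.w12.w23.w01.w12.t1 hyp hpq.symm hpr.symm hqr (by clear * - hq; tauto) (by clear * - hr; tauto)
end

lemma deg4 (hc : Cub G) {p a b c d : V} (h1 : G.Adj p a) (h2 : G.Adj p b) (h3 : G.Adj p c) (h4 : G.Adj p d)
    (nd : [a, b, c, d].Nodup) : False := by
  simp only [NL, or_false, not_false_eq_true, and_true, not_or] at nd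
  have := full hc nd.1.1 nd.1.2.1 nd.2.1.1 h1 h2 h3 d h4
  clear * - nd this
  grind

def elH2 : List (Fin 20 × Fin 20) := [(0,1), (1,2), (2,3), (3,4), (4,5), (5,0), (6,7), (7,8), (8,9), (9,10), (10,11), (11,6), (12,0), (13,1), (14,2), (15,3), (16,4), (17,5), (12,6), (13,7), (14,8), (15,9), (16,10), (17,11), (18,12), (18,14), (18,16), (19,13), (19,15), (19,17)]

lemma elH2_set : GraphH2 = SimpleGraph.fromEdgeSet {e | ∃ p ∈ elH2, e = s(p.1, p.2)} := by
  unfold GraphH2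
  congr 1
  ext e
  simp only [elH2, Set.mem_insert_iff, Set.mem_singleton_iff, Set.mem_ofPred_eq, List.exists_mem_cons_iff, List.not_mem_nil, false_and, exists_false, or_false]

def sgH2 : Fin 20 → Fin 20 := ![8, 1, 7, 2, 9, 3, 18, 10, 19, 11, 17, 12, 14, 4, 13, 5, 15, 6, 16, 0]

set_option maxRecDepth 20000 in
lemma isoH2 (hyp : Hyp G) {g0 g1 g2 g3 b01 b02 b03 b12 b13 b23 d01 d02 d03 d12 d13 d23 c0 c1 c2 c3 : V}
    (hnd : [g0, g1, g2, g3, b01, b02, b03, b12, b13, b23, d01, d02, d03, d12, d13, d23, c0, c1, c2, c3].Nodup)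
    (hcard : Fintype.card V = 20)
    (e01 : G.Adj b01 g0 ∧ G.Adj b01 g1) (e02 : G.Adj b02 g0 ∧ G.Adj b02 g2) (e03 : G.Adj b03 g0 ∧ G.Adj b03 g3)
    (e12 : G.Adj b12 g1 ∧ G.Adj b12 g2) (e13 : G.Adj b13 g1 ∧ G.Adj b13 g3) (e23 : G.Adj b23 g2 ∧ G.Adj b23 g3)
    (t01 : G.Adj b01 d01) (t02 : G.Adj b02 d02) (t03 : G.Adj b03 d03) (t12 : G.Adj b12 d12) (t13 : G.Adj b13 d13)
    (t23 : G.Adj b23 d23)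
    (k3 : G.Adj c3 d01 ∧ G.Adj c3 d02 ∧ G.Adj c3 d12) (k2 : G.Adj c2 d01 ∧ G.Adj c2 d03 ∧ G.Adj c2 d13)
    (k1 : G.Adj c1 d02 ∧ G.Adj c1 d03 ∧ G.Adj c1 d23) (k0 : G.Adj c0 d12 ∧ G.Adj c0 d13 ∧ G.Adj c0 d23) :
    Nonempty (G ≃g GraphH2) := by
  rw [elH2_set]
  have hA : ∀ p ∈ elH2, G.Adj ([g0, g1, g2, g3, b01, b02, b03, b12, b13, b23, d01, d02, d03, d12, d13, d23, c0, c1, c2, c3].get (sgH2 p.1))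
      ([g0, g1, g2, g3, b01, b02, b03, b12, b13, b23, d01, d02, d03, d12, d13, d23, c0, c1, c2, c3].get (sgH2 p.2)) := by
    unfold elH2
    simp only [List.forall_mem_cons]
    exact ⟨e13.1, e12.1.symm, e12.2, e23.1.symm, e23.2, e13.2.symm, k2.1, k3.1.symm, k3.2.1, k1.1.symm, k1.2.1, k2.2.1.symm,
      t13.symm, e01.2, t12.symm, e02.2, t23.symm, e03.2, k2.2.2.symm, t01, k3.2.2.symm, t02, k1.2.2.symm, t03, k0.2.1, k0.1, k0.2.2,
      e01.1.symm, e02.1.symm, e03.1.symm, by simp⟩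
  exact iso_of hyp _ elH2 (fun p hp => ⟨p, hp, rfl⟩) (fun e he => he) (by decide) (by decide)
    (fun i => [g0, g1, g2, g3, b01, b02, b03, b12, b13, b23, d01, d02, d03, d12, d13, d23, c0, c1, c2, c3].get (sgH2 i))
    ((List.nodup_iff_injective_get.1 hnd).comp (by decide : Function.Injective sgH2)) hcard hA

section
variable {D : Finset V} {g0 g1 g2 g3 b01 b02 b03 b12 b13 b23 d01 d02 d03 d12 d13 d23 : V}
variable {k0 k1 k2 k3 s01 s02 s03 s12 s13 s23 : V}

lemma SK.beta (hc : Cub G) (S : SK G D k0 k1 k2 k3 s01 s02 s03 s12 s13 s23) {d b : V} (hd : d ∈ D) (hb : b ∉ D) (hh : G.Adj b d) :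
    d = s01 ∨ d = s02 ∨ d = s03 ∨ d = s12 ∨ d = s13 ∨ d = s23 := by
  have m := S.m0.2
  have hh := hh.symm
  rcases (S.mem d).1 hd with rfl | rfl | rfl | rfl | e
  · have k := S.full hc b hh; clear * - k hb m; grind
  · have k := S.w01.full hc b hh; clear * - k hb m; grind
  · have k := S.w12.w01.full hc b hh; clear * - k hb m; grind
  · have k := S.w23.w12.w01.full hc b hh; clear * - k hb m; grind
  · exact e

lemma TT.ctr (hc : Cub G) (hD : Block G D) (T : TT G D g0 g1 g2 g3 b01 b02 b03 b12 b13 b23 d01 d02 d03 d12 d13 d23)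
    (S : SK G D k0 k1 k2 k3 s01 s02 s03 s12 s13 s23) : ∃ z ∈ D, G.Adj z d01 ∧ G.Adj z d02 ∧ G.Adj z d12 := by
  have nd := T.nd hc hD
  have nD := T.S.notD
  simp only [NL, or_false, not_false_eq_true, and_true, not_or] at nd
  rcases S.t0 hc.hyp (p := d01) (q := d02) (r := d12) nd.1.1 nd.1.2.2.1 nd.2.1.2.1 (S.beta hc T.dm.1 nD.2.1 T.t01) (S.beta hc T.dm.2.1 nD.2.2.1 T.t02)
    (S.beta hc T.dm.2.2.2.1 nD.2.2.2.2.1 T.t12) with hq | hq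
  · exact hq
  · exact (T.tri hc hD hq).elim

/-- the centre avoids the six attachment vertices -/
lemma TT.ctrne (hc : Cub G) (hD : Block G D) (T : TT G D g0 g1 g2 g3 b01 b02 b03 b12 b13 b23 d01 d02 d03 d12 d13 d23)
    {z : V} (h1 : G.Adj z d01) (h2 : G.Adj z d02) (h3 : G.Adj z d12) :
    z ≠ d01 ∧ z ≠ d02 ∧ z ≠ d03 ∧ z ≠ d12 ∧ z ≠ d13 ∧ z ≠ d23 := by
  have nd := T.nd hc hD
  have nD := T.S.notD
  have dm := T.dm
  simp only [NL, or_false, not_false_eq_true, and_true, not_or] at nd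
  have key : ∀ {b d : V}, b ∉ D → G.Adj b d → z ≠ d := by
    rintro b _ hb hh rfl
    refine deg4 hc h1 h2 h3 hh.symm ?_
    simp only [NL, or_false, not_false_eq_true, and_true, not_or]
    clear * - nd dm hb
    grind
  exact ⟨h1.ne, h2.ne, key nD.2.2.2.1 T.t03, h3.ne, key nD.2.2.2.2.2.1 T.t13, key nD.2.2.2.2.2.2 T.t23⟩

lemma TT.caseH2 (hc : Cub G) (hD : Block G D) (T : TT G D g0 g1 g2 g3 b01 b02 b03 b12 b13 b23 d01 d02 d03 d12 d13 d23)
    (S : SK G D k0 k1 k2 k3 s01 s02 s03 s12 s13 s23) : Nonempty (G ≃g GraphH2) := by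
  obtain ⟨c3, m3, q3, q3', q3''⟩ := T.ctr hc hD S
  obtain ⟨c2, m2, q2, q2', q2''⟩ := T.w23.ctr hc hD S
  obtain ⟨c1, m1, q1, q1', q1''⟩ := T.w12.w23.ctr hc hD S
  obtain ⟨c0, m0, q0, q0', q0''⟩ := T.w01.w12.w23.ctr hc hD S
  have r3 := T.ctrne hc hD q3 q3' q3''
  have r2 := T.w23.ctrne hc hD q2 q2' q2''
  have r1 := T.w12.w23.ctrne hc hD q1 q1' q1''
  have r0 := T.w01.w12.w23.ctrne hc hD q0 q0' q0''
  have nd := T.nd hc hD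
  have hcard : Fintype.card V = 20 := by
    rw [← Finset.card_univ, ← Finset.card_sdiff_add_card_eq_card (Finset.subset_univ D), T.S.crd, S.crd]
  refine isoH2 hc.hyp ?_ hcard T.S.e01 T.S.e02 T.S.e03 T.S.e12 T.S.e13 T.S.e23 T.t01 T.t02 T.t03 T.t12 T.t13 T.t23
    ⟨q3, q3', q3''⟩ ⟨q2, q2', q2''⟩ ⟨q1, q1', q1''⟩ ⟨q0, q0', q0''⟩
  have nd' := nd
  simp only [NL, or_false, not_false_eq_true, and_true, not_or] at nd'
  have n01 : c0 ≠ c1 := by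
    rintro rfl
    exact deg4 hc q1 q1' q0 q0' (by
      simp only [NL, or_false, not_false_eq_true, and_true, not_or]
      clear * - nd'; grind)
  have n02 : c0 ≠ c2 := by
    rintro rfl
    exact deg4 hc q2 q2' q0 q0' (by
      simp only [NL, or_false, not_false_eq_true, and_true, not_or]
      clear * - nd'; grind)
  have n03 : c0 ≠ c3 := by
    rintro rfl
    exact deg4 hc q3 q3' q0 q0' (by
      simp only [NL, or_false, not_false_eq_true, and_true, not_or]
      clear * - nd'; grind)
  have n12 : c1 ≠ c2 := by
    rintro rfl
    exact deg4 hc q1 q1' q2 q2'' (by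
      simp only [NL, or_false, not_false_eq_true, and_true, not_or]
      clear * - nd'; grind)
  have n13 : c1 ≠ c3 := by
    rintro rfl
    exact deg4 hc q1 q1' q3 q3'' (by
      simp only [NL, or_false, not_false_eq_true, and_true, not_or]
      clear * - nd'; grind)
  have n23 : c2 ≠ c3 := by
    rintro rfl
    exact deg4 hc q2 q2' q3' q3'' (by
      simp only [NL, or_false, not_false_eq_true, and_true, not_or]
      clear * - nd'; grind)
  change ([g0, g1, g2, g3, b01, b02, b03, b12, b13, b23] ++ ([d01, d02, d03, d12, d13, d23] ++ [c0, c1, c2, c3])).Nodup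
  rw [List.nodup_append, List.nodup_append]
  refine ⟨T.S.nd, ⟨nd, ?_, ?_⟩, ?_⟩
  · simp only [NL, or_false, not_false_eq_true, and_true, not_or]
    exact ⟨⟨n01, n02, n03⟩, ⟨n12, n13⟩, n23⟩
  · intro p hp q hq e
    subst e
    simp only [List.mem_cons, List.not_mem_nil, or_false] at hp hq
    clear * - hp hq r0 r1 r2 r3
    rcases hq with rfl | rfl | rfl | rfl <;> tauto
  · intro p hp q hq e
    subst e
    have pX : p ∈ Finset.univ \ D := (T.S.mem p).2 (by simpa using hp)
    have pX : p ∉ D := by simpa using pX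
    have dm := T.dm
    simp only [List.mem_cons, List.mem_append, List.not_mem_nil, or_false] at hq
    clear * - hq pX dm m0 m1 m2 m3
    grind
end

lemma Cub.final (hc : Cub G) : Nonempty (G ≃g GraphH1) ∨ Nonempty (G ≃g GraphH2) := by
  obtain ⟨v0, -⟩ := hc.conn.1
  obtain ⟨X, v1, v2, v3, N⟩ := hc.nb v0
  rcases (N.block hc).cls hc (N.bX hc) with ⟨D, a, h, v, x, w, k, ya, yv, yw, H, hD, h6⟩ | ⟨_, _, _, _, _, _, _, _, _, _, S⟩
  · right
    obtain ⟨_, _, _, _, _, _, _, _, _, _, S⟩ := hc.hexSK N H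
    obtain ⟨_, _, _, _, _, _, T⟩ := S.toTT hc
    rcases hD.cls hc h6 with ⟨E, a', h', v', x', w', k', _, _, _, H', hE, -⟩ | ⟨_, _, _, _, _, _, _, _, _, _, S'⟩
    · exact (T.hex hc hD hE H').elim
    · exact T.caseH2 hc hD S'
  · exact Or.inl (hc.caseH1 N S)

lemma dg_univ (v : V) (S : Finset V) : dg G v S ≤ (G.neighborSet v).ncard := by
  unfold dg
  rw [← Set.ncard_coe_finset]
  refine Set.ncard_le_ncard ?_ (Set.toFinite _)
  intro z hz
  simp at hz
  exact hz.2

lemma hyp_of (h3 : ∀ v : V, (G.neighborSet v).ncard ≤ 3) (hg : 5 ≤ G.egirth) : Hyp G := by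
  refine ⟨fun v S => (dg_univ v S).trans (h3 v), ?_, ?_⟩
  · intro a b c h1 h2 h3
    have := SimpleGraph.le_egirth.1 hg a (Walk.cons h1 (Walk.cons h2 (Walk.cons h3.symm Walk.nil))) (by
      have := h1.ne; have := h2.ne; have := h3.ne
      simp [Walk.isCycle_def, Walk.isTrail_def]
      grind)
    simp at this
    exact absurd this (by decide)
  · intro a b c d n1 n2 h1 h2 h3 h4
    have := SimpleGraph.le_egirth.1 hg a (Walk.cons h1 (Walk.cons h2.symm (Walk.cons h4 (Walk.cons h3.symm Walk.nil)))) (by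
      have := h1.ne; have := h2.ne; have := h3.ne; have := h4.ne
      simp [Walk.isCycle_def, Walk.isTrail_def]
      grind)
    simp at this
    exact absurd this (by decide)

lemma main_W (hconn : G.Connected) (h3 : ∀ v : V, (G.neighborSet v).ncard ≤ 3) (hg : 5 ≤ G.egirth)
    (hH1 : ¬ Nonempty (G ≃g GraphH1)) (hH2 : ¬ Nonempty (G ≃g GraphH2)) : W G Finset.univ 1 := by
  have hyp := hyp_of h3 hg
  have conn : Conn G Finset.univ := by
    refine ⟨(Finset.univ_nonempty_iff.2 hconn.nonempty), ?_⟩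
    intro C _ hC hne
    obtain ⟨c, hcC⟩ := hC
    obtain ⟨y, hy⟩ : ∃ y, y ∉ C := by
      by_contra h'
      push Not at h'
      exact hne (Finset.eq_univ_iff_forall.2 h')
    obtain ⟨p⟩ := hconn.preconnected c y
    obtain ⟨d, -, h1, h2⟩ := p.exists_boundary_dart (C : Set V) (by simpa using hcC) (by simpa using hy)
    exact bd_pos.2 ⟨d.fst, by simpa using h1, d.snd, by simp, by simpa using h2, d.adj⟩
  by_cases hd : ∃ u ∈ (Finset.univ : Finset V), dg G u Finset.univ ≤ 2
  · exact thmN hyp _ _ rfl conn hd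
  by_contra hno
  have hc : Cub G := ⟨hyp, fun v => by
    by_contra hv
    have := hyp.deg v Finset.univ
    exact hd ⟨v, by simp, by omega⟩, conn, hno⟩
  rcases hc.final with h | h
  exacts [hH1 h, hH2 h]
end
end URPaper

namespace URPaper

/-- Theorem 1 of the paper. If `G` is a connected subcubic
graph of girth at least `5` that is isomorphic to neither `H₁` nor `H₂`, then
`ν_ur(G) ≥ (n(G) - 1)/3`. -/
theorem statement0 {V : Type} [Fintype V] (G : SimpleGraph V)
    (hconn : G.Connected)
    (hsubcubic : ∀ v : V, (G.neighborSet v).ncard ≤ 3)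
    (hgirth : 5 ≤ G.egirth)
    (hH1 : ¬ Nonempty (G ≃g GraphH1)) (hH2 : ¬ Nonempty (G ≃g GraphH2)) :
    ((Nat.card V : ℝ) - 1) / 3 ≤ nuUR G := by
  classical
  exact nuUR_ge (main_W hconn hsubcubic hgirth hH1 hH2)

end URPaper
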